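/- arXiv:2403.20265 — 4 statements merged into one kernel-verified Lean document; each statement's English description precedes it below -/
import Mathlib

section
/- Let A, A₁, A₂ ∈ ℝ^{d×m} be matrices such that rank(A₁ − A₂) = 1 and A = λ₁A₁ + λ₂A₂ for some λ₁, λ₂ > 0 with λ₁ + λ₂ = 1. Then for any b ∈ ℝ^d, any ε > 0 and any regular domain Ω ⊂ ℝ^m there exists a piecewise affine Lipschitz map u : Ω → ℝ^d such that u = l_{A,b} on ∂Ω, ‖∇u‖_{L^∞(Ω)} ≤ max(|A₁|, |A₂|), and for i = 1, 2: (1−ε)λ_i|Ω| ≤ |{x ∈ Ω : ∇u(x) = A_i}| ≤ (1+ε)λ_i|Ω|. -/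
open MeasureTheory Set Filter Topology

noncomputable section

namespace Paper

variable {ι κ : Type*}

/-- Frobenius (Hilbert–Schmidt) norm of a matrix. -/
def frobNorm [Fintype ι] [Fintype κ] (A : Matrix κ ι ℝ) : ℝ :=
  Real.sqrt (∑ k, ∑ i, (A k i) ^ 2)

/-- Frobenius distance from a matrix to a set of matrices. -/
def frobDist [Fintype ι] [Fintype κ] (X : Matrix κ ι ℝ) (S : Set (Matrix κ ι ℝ)) : ℝ :=
  sInf ((fun Y => frobNorm (X - Y)) '' S)

/-- The affine map `x ↦ A x + b`. -/
def lmap [Fintype ι] (A : Matrix κ ι ℝ) (b : κ → ℝ) (x : ι → ℝ) : κ → ℝ :=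
  fun k => (∑ i, A k i * x i) + b k

/-- A regular domain: open, bounded, connected, with Lebesgue-null boundary. -/
def IsRegularDomain [Fintype ι] (Ω : Set (ι → ℝ)) : Prop :=
  IsOpen Ω ∧ Bornology.IsBounded Ω ∧ IsConnected Ω ∧ volume (frontier Ω) = 0

/-- `u` agrees with an affine map on `S`. -/
def IsAffineOn [Fintype ι] (u : (ι → ℝ) → κ → ℝ) (S : Set (ι → ℝ)) : Prop :=
  ∃ (B : Matrix κ ι ℝ) (c : κ → ℝ), ∀ x ∈ S, u x = lmap B c x

/-- `u` is piecewise affine on `Ω`. -/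
def IsPiecewiseAffineOn [Fintype ι] (u : (ι → ℝ) → κ → ℝ) (Ω : Set (ι → ℝ)) : Prop :=
  ∃ 𝒮 : Set (Set (ι → ℝ)), 𝒮.Countable ∧
    (∀ V ∈ 𝒮, IsRegularDomain V ∧ V ⊆ Ω ∧ IsAffineOn u V) ∧
    𝒮.PairwiseDisjoint id ∧ volume (Ω \ ⋃₀ 𝒮) = 0

/-- `G` is the weak (distributional) gradient of `u` on `Ω`, and `u ∈ W^{1,1}(Ω)`. -/
structure HasWeakGradientOn [Fintype ι] [DecidableEq ι] [Fintype κ]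
    (u : (ι → ℝ) → κ → ℝ) (G : (ι → ℝ) → Matrix κ ι ℝ) (Ω : Set (ι → ℝ)) : Prop where
  integrable : IntegrableOn u Ω volume
  integrable_grad : ∀ (k : κ) (i : ι), IntegrableOn (fun x => G x k i) Ω volume
  parts : ∀ φ : (ι → ℝ) → ℝ, (∀ n : ℕ, ContDiff ℝ n φ) → HasCompactSupport φ →
    tsupport φ ⊆ Ω → ∀ (k : κ) (i : ι),
      ∫ x in Ω, u x k * fderiv ℝ φ x (Pi.single i 1) = - ∫ x in Ω, G x k i * φ x

/-- Membership in `C^α(S)`: continuous on `S` and (for `α > 0`) `α`-Hölder on `S`. -/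
def MemHolder [Fintype ι] [Fintype κ] (α : ℝ) (S : Set (ι → ℝ)) (u : (ι → ℝ) → κ → ℝ) : Prop :=
  ContinuousOn u S ∧ ∃ C : ℝ, ∀ x ∈ S, ∀ y ∈ S, dist (u x) (u y) ≤ C * dist x y ^ α

/-- The `C^α` norm on `S`. -/
def holderNorm [Fintype ι] [Fintype κ] (α : ℝ) (S : Set (ι → ℝ)) (u : (ι → ℝ) → κ → ℝ) : ℝ :=
  sSup ((fun x => ‖u x‖) '' S) +
    sSup {r : ℝ | ∃ x ∈ S, ∃ y ∈ S, x ≠ y ∧ r = dist (u x) (u y) / dist x y ^ α}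

/-- `K` can be reduced to `K'` in weak `L^p`, with constant `M`. -/
def ReducesWith [Fintype ι] [DecidableEq ι] [Fintype κ] (M : ℝ)
    (K K' : Set (Matrix κ ι ℝ)) (p : ℝ) : Prop :=
  ∀ A ∈ K, ∀ b : κ → ℝ, ∀ ε ∈ Set.Ioo (0:ℝ) 1, ∀ α ∈ Set.Ioo (0:ℝ) 1, ∀ s ∈ Set.Ioi (1:ℝ),
    ∀ Ω : Set (ι → ℝ), IsRegularDomain Ω →
      ∃ (u : (ι → ℝ) → κ → ℝ) (G : (ι → ℝ) → Matrix κ ι ℝ),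
        IsPiecewiseAffineOn u Ω ∧ HasWeakGradientOn u G Ω ∧ MemHolder α (closure Ω) u ∧
        (∀ x ∈ frontier Ω, u x = lmap A b x) ∧
        (∫ x in {x ∈ Ω | G x ∉ K'}, (1 + frobNorm (G x)) ^ s) < ε * (volume Ω).toReal ∧
        ∀ t : ℝ, 0 < t →
          volume {x ∈ Ω | t < frobNorm (G x)}
            ≤ ENNReal.ofReal (M ^ p * (1 + frobNorm A ^ p) * t ^ (-p)) * volume Ω

/-- `K` can be reduced to `K'` in weak `L^p`. -/
def ReducedTo [Fintype ι] [DecidableEq ι] [Fintype κ]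
    (K K' : Set (Matrix κ ι ℝ)) (p : ℝ) : Prop :=
  ∃ M : ℝ, 1 ≤ M ∧ ReducesWith M K K' p


open scoped Function

/-- The measure of a set pulled back by the inverse homothety `y ↦ r⁻¹ • (y - x)`. -/
theorem measure_preimage_inv_smul_sub {E : Type*} [NormedAddCommGroup E] [NormedSpace ℝ E]
    [FiniteDimensional ℝ E] [MeasurableSpace E] [BorelSpace E] (μ : Measure E)
    [μ.IsAddHaarMeasure] {r : ℝ} (hr : r ≠ 0) (x : E) (S : Set E) :
    μ ((fun y => r⁻¹ • (y - x)) ⁻¹' S) =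
      ENNReal.ofReal |((r⁻¹) ^ Module.finrank ℝ E)⁻¹| * μ S := by
  rw [← Measure.addHaar_preimage_smul μ (inv_ne_zero hr) S]
  have : (fun y => r⁻¹ • (y - x)) ⁻¹' S = (fun y => y - x) ⁻¹' ((r⁻¹ • ·) ⁻¹' S) := rfl
  rw [this]
  simp_rw [sub_eq_add_neg]
  exact measure_preimage_add_right μ (-x) _

/-- The pointwise supremum of functions with pairwise disjoint closed supports. -/
theorem iSup_eq_of_pairwiseDisjoint {X I : Type*} {B : I → Set X} (hB : Pairwise (Disjoint on B))
    {f : I → X → ℝ} (hf : ∀ i x, 0 ≤ f i x) (hfB : ∀ i, ∀ x ∉ B i, f i x = 0) :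
    (∀ x, BddAbove (range fun i => f i x)) ∧
      (∀ i, ∀ x ∈ B i, ⨆ i', f i' x = f i x) ∧ ∀ x, (∀ i, x ∉ B i) → ⨆ i, f i x = 0 := by
  have hle : ∀ i, ∀ x ∈ B i, ∀ i', f i' x ≤ f i x := by
    intro i x hx i'
    by_cases h : i' = i
    · rw [h]
    · rw [hfB i' x fun hx' => (hB h).le_bot ⟨hx', hx⟩]
      exact hf i x
  have hbdd : ∀ x, BddAbove (range fun i => f i x) := by
    intro x
    by_cases h : ∃ i, x ∈ B i
    · obtain ⟨i, hi⟩ := h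
      exact ⟨f i x, by rintro _ ⟨i', rfl⟩; exact hle i x hi i'⟩
    · push Not at h
      exact ⟨0, by rintro _ ⟨i', rfl⟩; exact (hfB i' x (h i')).le⟩
  refine ⟨hbdd, fun i x hx => ?_, fun x hx => ?_⟩
  · have : Nonempty I := ⟨i⟩
    exact le_antisymm (ciSup_le (hle i x hx)) (le_ciSup (hbdd x) i)
  · simp [fun i => hfB i x (hx i)]

theorem lipschitzWith_iSup {X I : Type*} [PseudoMetricSpace X] {f : I → X → ℝ} {C : NNReal}
    (hf : ∀ i, LipschitzWith C (f i)) (hbdd : ∀ x, BddAbove (range fun i => f i x)) :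
    LipschitzWith C fun x => ⨆ i, f i x := by
  refine LipschitzWith.of_le_add_mul C fun x y => ?_
  cases isEmpty_or_nonempty I
  · simp only [Real.iSup_of_isEmpty]; positivity
  · exact ciSup_le fun i => ((hf i).le_add_mul x y).trans (by gcongr; exact le_ciSup (hbdd y) i)

theorem exists_rescaled_tiling {E : Type*} [NormedAddCommGroup E] [NormedSpace ℝ E]
    [FiniteDimensional ℝ E] [MeasurableSpace E] [BorelSpace E] (μ : Measure E)
    [μ.IsAddHaarMeasure] {P Ω : Set E} (hPc : IsClosed P) (hPb : Bornology.IsBounded P)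
    (hP : (interior P).Nonempty) (hΩ : IsOpen Ω) :
    ∃ I : Set (E × ℝ), I.Countable ∧
      (∀ i ∈ I, 0 < i.2 ∧ (fun y => i.2⁻¹ • (y - i.1)) ⁻¹' P ⊆ Ω) ∧
      I.PairwiseDisjoint (fun i => (fun y => i.2⁻¹ • (y - i.1)) ⁻¹' P) ∧
      μ (Ω \ ⋃ i ∈ I, (fun y => i.2⁻¹ • (y - i.1)) ⁻¹' P) = 0 := by
  obtain ⟨R, hR0, hR⟩ := hPb.subset_closedBall_lt 0 0
  have hmem : ∀ (x : E) (r ρ : ℝ), 0 < r → ∀ y,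
      r⁻¹ • (y - x) ∈ Metric.closedBall (0 : E) ρ ↔ y ∈ Metric.closedBall x (r * ρ) := by
    intro x r ρ hr y
    rw [mem_closedBall_zero_iff, norm_smul, mem_closedBall_iff_norm, norm_inv,
      Real.norm_of_nonneg hr.le, inv_mul_le_iff₀ hr]
  have hμP : μ P ≠ 0 := ((isOpen_interior.measure_pos μ hP).trans_le
    (measure_mono interior_subset)).ne'
  have hμB : μ (Metric.closedBall (0 : E) (3 * R)) ≠ ⊤ := measure_closedBall_lt_top.ne
  let T : Set (E × ℝ) := {i | 0 < i.2 ∧ (fun y => i.2⁻¹ • (y - i.1)) ⁻¹' P ⊆ Ω}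
  have hdoubling : ∀ i ∈ T, μ (Metric.closedBall i.1 (3 * (i.2 * R))) ≤
      (μ (Metric.closedBall (0 : E) (3 * R)) / μ P).toNNReal *
        μ ((fun y => i.2⁻¹ • (y - i.1)) ⁻¹' P) := by
    intro i hi
    have : Metric.closedBall i.1 (3 * (i.2 * R)) =
        (fun y => i.2⁻¹ • (y - i.1)) ⁻¹' Metric.closedBall 0 (3 * R) := by
      ext y
      rw [mem_preimage, hmem i.1 i.2 _ hi.1, mul_left_comm]
    rw [this, measure_preimage_inv_smul_sub μ hi.1.ne', measure_preimage_inv_smul_sub μ hi.1.ne',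
      ENNReal.coe_toNNReal (ENNReal.div_ne_top hμB hμP), mul_left_comm,
      ENNReal.div_mul_cancel hμP (hPb.measure_lt_top).ne]
  have hinterior : ∀ i ∈ T, (interior ((fun y => i.2⁻¹ • (y - i.1)) ⁻¹' P)).Nonempty := by
    intro i hi
    have hc : Continuous fun y => i.2⁻¹ • (y - i.1) := by fun_prop
    obtain ⟨z, hz⟩ := hP
    refine ⟨i.1 + i.2 • z, preimage_interior_subset_interior_preimage hc ?_⟩
    simpa [smul_smul, inv_mul_cancel₀ hi.1.ne'] using hz
  have hfine : ∀ x ∈ Ω, ∀ ε > (0 : ℝ), ∃ i ∈ T, i.2 * R ≤ ε ∧ i.1 = x := by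
    intro x hx ε hε
    obtain ⟨η, hη, hηΩ⟩ := Metric.isOpen_iff.1 hΩ x hx
    have hpos : 0 < min ε (η / 2) := by positivity
    refine ⟨(x, min ε (η / 2) / R), ⟨by positivity, fun y hy => hηΩ ?_⟩, ?_, rfl⟩
    · have := (hmem x _ R (by positivity) y).1 (hR hy)
      rw [div_mul_cancel₀ _ hR0.ne'] at this
      refine Metric.closedBall_subset_ball ?_ this
      exact (min_le_right _ _).trans_lt (by linarith)
    · simp only [div_mul_cancel₀ _ hR0.ne']
      exact min_le_left _ _
  obtain ⟨I, hIT, hIc, hId, hI⟩ := Vitali.exists_disjoint_covering_ae μ Ω T _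
    (fun i => i.2 * R) Prod.fst (fun i => (fun y => i.2⁻¹ • (y - i.1)) ⁻¹' P)
    (fun i hi y hy => (hmem i.1 i.2 R hi.1 y).1 (hR hy)) hdoubling hinterior
    (fun i _ => hPc.preimage (by fun_prop)) hfine
  exact ⟨I, hIc, fun i hi => hIT hi, hId, hI⟩

/-- Rescaled disjoint copies of a piecewise affine function supported in `P` fill the open set
`Ω`, and the proportions of the volume occupied by each affine piece are preserved. -/
theorem exists_lipschitz_tiling {E J : Type*} [NormedAddCommGroup E] [NormedSpace ℝ E]
    [FiniteDimensional ℝ E] [MeasurableSpace E] [BorelSpace E] (μ : Measure E)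
    [μ.IsAddHaarMeasure] [Countable J] {P Ω : Set E} (hPc : IsClosed P)
    (hPb : Bornology.IsBounded P) (hP : (interior P).Nonempty) {W : E → ℝ} {C : NNReal}
    (hW : LipschitzWith C W) (hW0 : ∀ x, 0 ≤ W x) (hWP : ∀ x ∉ P, W x = 0)
    {V : J → Set E} (hVo : ∀ j, IsOpen (V j)) (hVc : ∀ j, Convex ℝ (V j))
    (hVd : Pairwise (Disjoint on V)) (hVP : ∀ j, V j ⊆ P) (hV : μ (P \ ⋃ j, V j) = 0)
    {p : J → E →L[ℝ] ℝ} {k : J → ℝ} (haff : ∀ j, ∀ x ∈ V j, W x = p j x + k j)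
    (hΩ : IsOpen Ω) :
    ∃ (w : E → ℝ) (I : Set (E × ℝ)) (U : I × J → Set E) (c : I × J → ℝ), I.Countable ∧
      LipschitzWith C w ∧ (∀ x ∉ Ω, w x = 0) ∧
      (∀ i, IsOpen (U i) ∧ Convex ℝ (U i) ∧ Bornology.IsBounded (U i) ∧ U i ⊆ Ω) ∧
      Pairwise (Disjoint on U) ∧ μ (Ω \ ⋃ i, U i) = 0 ∧
      (∀ i, ∀ x ∈ U i, w x = p i.2 x + c i) ∧
      ∀ j, μ (V j) * μ Ω ≤ μ P * μ (⋃ i, U (i, j)) := by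
  obtain ⟨I, hIc, hIΩ, hId, hI⟩ := exists_rescaled_tiling μ hPc hPb hP hΩ
  have : Countable I := hIc
  let φ : I → E → E := fun i y => i.1.2⁻¹ • (y - i.1.1)
  have hφ : ∀ i, Continuous (φ i) := fun i => by fun_prop
  have hr : ∀ i : I, 0 < i.1.2 := fun i => (hIΩ i i.2).1
  let B : I → Set E := fun i => φ i ⁻¹' P
  have hB : Pairwise (Disjoint on B) := fun i j hij =>
    hId i.2 j.2 (fun h => hij (Subtype.ext h))
  let f : I → E → ℝ := fun i y => i.1.2 * W (φ i y)
  have hf0 : ∀ i x, 0 ≤ f i x := fun i x => mul_nonneg (hr i).le (hW0 _)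
  have hfB : ∀ i, ∀ x ∉ B i, f i x = 0 := fun i x hx => by
    simp only [f, hWP _ hx, mul_zero]
  have hfL : ∀ i, LipschitzWith C (f i) := by
    intro i
    refine LipschitzWith.of_le_add_mul C fun x y => ?_
    have h := hW.le_add_mul (φ i x) (φ i y)
    have hd : dist (φ i x) (φ i y) = i.1.2⁻¹ * dist x y := by
      simp only [φ, dist_smul₀, dist_sub_right, norm_inv, Real.norm_of_nonneg (hr i).le]
    rw [hd] at h
    calc i.1.2 * W (φ i x) ≤ i.1.2 * (W (φ i y) + C * (i.1.2⁻¹ * dist x y)) :=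
          mul_le_mul_of_nonneg_left h (hr i).le
      _ = f i y + C * dist x y := by
          have := (hr i).ne'
          simp only [f]; field_simp
  obtain ⟨hbdd, hsup, hsup0⟩ := iSup_eq_of_pairwiseDisjoint hB hf0 hfB
  have hUB : ∀ i : I × J, φ i.1 ⁻¹' V i.2 ⊆ B i.1 := fun i => preimage_mono (hVP i.2)
  refine ⟨fun x => ⨆ i, f i x, I, fun i => φ i.1 ⁻¹' V i.2,
    fun i => i.1.1.2 * k i.2 - p i.2 i.1.1.1, hIc, lipschitzWith_iSup hfL hbdd,
    fun x hx => hsup0 x fun i hi => hx ((hIΩ i i.2).2 hi), fun i => ⟨(hVo _).preimage (hφ _),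
      ?_, ?_, (hUB i).trans (hIΩ i.1 i.1.2).2⟩, ?_, ?_, ?_, ?_⟩
  · have h2 : φ i.1 ⁻¹' V i.2 = (fun y => -i.1.1.1 + y) ⁻¹'
        ((i.1.1.2⁻¹ • LinearMap.id : E →ₗ[ℝ] E) ⁻¹' V i.2) := by
      ext y; simp [φ, sub_eq_neg_add]
    beta_reduce
    rw [h2]
    exact ((hVc i.2).linear_preimage _).translate_preimage_right _
  · have h2 : φ i.1 ⁻¹' V i.2 ⊆ (fun z => i.1.1.1 + i.1.1.2 • z) '' P := by
      intro y hy
      refine ⟨_, hVP _ hy, ?_⟩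
      simp [φ, smul_smul, mul_inv_cancel₀ (hr i.1).ne']
    refine Bornology.IsBounded.subset ?_ h2
    have hL : LipschitzWith ‖i.1.1.2‖₊ fun z : E => i.1.1.1 + i.1.1.2 • z := by
      refine LipschitzWith.of_dist_le_mul fun x y => ?_
      simp [dist_smul₀]
    exact hL.isBounded_image hPb
  · rintro ⟨i, j⟩ ⟨i', j'⟩ h
    by_cases hi : i = i'
    · subst hi
      have hj : j ≠ j' := fun hj => h (by rw [hj])
      exact (hVd hj).preimage _
    · exact (hB hi).mono (hUB (i, j)) (hUB (i', j'))
  · have hsub : Ω \ ⋃ i : I × J, φ i.1 ⁻¹' V i.2 ⊆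
        (Ω \ ⋃ i ∈ I, (fun y => i.2⁻¹ • (y - i.1)) ⁻¹' P) ∪
          ⋃ i : I, φ i ⁻¹' (P \ ⋃ j, V j) := by
      rintro x ⟨hx, hxU⟩
      by_cases h : ∃ i : I, x ∈ B i
      · obtain ⟨i, hi⟩ := h
        refine Or.inr (mem_iUnion.2 ⟨i, hi, fun hj => hxU ?_⟩)
        obtain ⟨j, hj⟩ := mem_iUnion.1 hj
        exact mem_iUnion.2 ⟨(i, j), hj⟩
      · refine Or.inl ⟨hx, fun hx' => h ?_⟩
        obtain ⟨i, hi, hx'⟩ := mem_iUnion₂.1 hx'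
        exact ⟨⟨i, hi⟩, hx'⟩
    refine measure_mono_null hsub (measure_union_null hI (measure_iUnion_null fun i => ?_))
    rw [measure_preimage_inv_smul_sub μ (hr i).ne', hV, mul_zero]
  · rintro ⟨i, j⟩ x hx
    change ⨆ i', f i' x = _
    rw [hsup i x (hUB (i, j) hx)]
    simp only [f, haff j _ hx]
    have := (hr i).ne'
    simp only [φ, map_smul, map_sub, smul_eq_mul]
    field_simp
    ring
  · intro j
    have hU : μ (⋃ i, φ i ⁻¹' V j) = ∑' i, μ (φ i ⁻¹' V j) :=
      measure_iUnion (fun i i' h => (hB h).mono (hUB (i, j)) (hUB (i', j)))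
        fun i => ((hVo j).preimage (hφ i)).measurableSet
    have hΩle : μ Ω ≤ ∑' i, μ (B i) := by
      refine le_trans ?_ (measure_iUnion_le B)
      refine measure_mono_ae ?_
      rw [ae_le_set]
      simpa only [B, φ, biUnion_eq_iUnion] using hI
    change _ ≤ μ P * μ (⋃ i, φ i ⁻¹' V j)
    rw [hU]
    calc μ (V j) * μ Ω ≤ μ (V j) * ∑' i, μ (B i) := by gcongr
      _ = μ P * ∑' i, μ (φ i ⁻¹' V j) := by
        rw [← ENNReal.tsum_mul_left, ← ENNReal.tsum_mul_left]
        congr 1 with i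
        simp only [B, φ]
        rw [measure_preimage_inv_smul_sub μ (hr i).ne', measure_preimage_inv_smul_sub μ (hr i).ne']
        ring

theorem measure_setOf_apply_eq {E : Type*} [NormedAddCommGroup E] [NormedSpace ℝ E]
    [FiniteDimensional ℝ E] [MeasurableSpace E] [BorelSpace E] (μ : Measure E)
    [μ.IsAddHaarMeasure] {q : E →L[ℝ] ℝ} (hq : q ≠ 0) (c : ℝ) : μ {x | q x = c} = 0 := by
  obtain ⟨v, hv⟩ : ∃ v, q v ≠ 0 := by
    by_contra! h
    exact hq (ContinuousLinearMap.ext h)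
  have hker : μ (LinearMap.ker (q : E →ₗ[ℝ] ℝ) : Set E) = 0 := by
    refine Measure.addHaar_submodule μ _ fun h => hv ?_
    have : v ∈ LinearMap.ker (q : E →ₗ[ℝ] ℝ) := h ▸ Submodule.mem_top
    simpa using this
  have : {x | q x = c} = (fun x => x + (-(c / q v)) • v) ⁻¹'
      (LinearMap.ker (q : E →ₗ[ℝ] ℝ) : Set E) := by
    ext x
    simp [hv, add_neg_eq_zero]
  rw [this, measure_preimage_add_right, hker]

/-- The polyhedron on which all the affine functions `p j + k j` are nonnegative. -/
def tentBase {E J : Type*} [NormedAddCommGroup E] [NormedSpace ℝ E]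
    (p : J → E →L[ℝ] ℝ) (k : J → ℝ) : Set E :=
  {x | ∀ j, 0 ≤ p j x + k j}

/-- The part of the tent where `p j + k j` is positive and is the strict minimum of the family. -/
def tentPiece {E J : Type*} [NormedAddCommGroup E] [NormedSpace ℝ E]
    (p : J → E →L[ℝ] ℝ) (k : J → ℝ) (j : J) : Set E :=
  {x | 0 < p j x + k j ∧ ∀ j', j' ≠ j → p j x + k j < p j' x + k j'}

/-- The positive part of the minimum of the affine functions `p j + k j`. -/
def tent {E J : Type*} [NormedAddCommGroup E] [NormedSpace ℝ E]
    (p : J → E →L[ℝ] ℝ) (k : J → ℝ) (x : E) : ℝ :=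
  ⨅ j, max 0 (p j x + k j)

section Tent

variable {E J : Type*} [NormedAddCommGroup E] [NormedSpace ℝ E]
  (p : J → E →L[ℝ] ℝ) (k : J → ℝ)

theorem isClosed_tentBase : IsClosed (tentBase p k) := by
  simp only [tentBase, ofPred_forall]
  exact isClosed_iInter fun j => isClosed_le continuous_const (by fun_prop)

theorem tent_nonneg (x : E) : 0 ≤ tent p k x :=
  Real.iInf_nonneg fun _ => le_max_left _ _

theorem bddBelow_range_tent (x : E) : BddBelow (range fun j => max 0 (p j x + k j)) :=
  ⟨0, by rintro _ ⟨j, rfl⟩; exact le_max_left _ _⟩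

theorem tent_eq_zero_of_notMem {x : E} (hx : x ∉ tentBase p k) : tent p k x = 0 := by
  simp only [tentBase, mem_ofPred_eq, not_forall, not_le] at hx
  obtain ⟨j, hj⟩ := hx
  refine le_antisymm ?_ (tent_nonneg p k x)
  exact (ciInf_le (bddBelow_range_tent p k x) j).trans (max_le le_rfl hj.le)

theorem tentPiece_subset (j : J) : tentPiece p k j ⊆ tentBase p k := by
  intro x hx j'
  by_cases h : j' = j
  · rw [h]; exact hx.1.le
  · exact (hx.1.trans (hx.2 j' h)).le

theorem tent_eq_of_mem {j : J} {x : E} (hx : x ∈ tentPiece p k j) :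
    tent p k x = p j x + k j := by
  have : Nonempty J := ⟨j⟩
  refine le_antisymm ?_ (le_ciInf fun j' => ?_)
  · exact (ciInf_le (bddBelow_range_tent p k x) j).trans (max_le hx.1.le le_rfl)
  · refine le_trans ?_ (le_max_right _ _)
    by_cases h : j' = j
    · rw [h]
    · exact (hx.2 j' h).le

theorem pairwise_disjoint_tentPiece : Pairwise (Disjoint on tentPiece p k) := by
  intro j j' h
  refine Set.disjoint_left.2 fun x hx hx' => ?_
  exact lt_asymm (hx.2 j' h.symm) (hx'.2 j h)

theorem convex_tentPiece (j : J) : Convex ℝ (tentPiece p k j) := by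
  have : tentPiece p k j = {x | -k j < p j x} ∩
      ⋂ j', ⋂ (_ : j' ≠ j), {x | (p j - p j') x < k j' - k j} := by
    ext x
    simp only [tentPiece, mem_ofPred_eq, mem_inter_iff, mem_iInter,
      _root_.sub_apply]
    refine and_congr (by constructor <;> intro h <;> linarith)
      (forall₂_congr fun j' _ => by constructor <;> intro h <;> linarith)
  rw [this]
  exact (convex_halfSpace_gt (p j).isLinear _).inter (convex_iInter₂ fun j' _ =>
    convex_halfSpace_lt (p j - p j').isLinear _)

variable [Finite J]

theorem isOpen_tentPiece (j : J) : IsOpen (tentPiece p k j) := by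
  simp only [tentPiece, ofPred_and, ofPred_forall]
  refine (isOpen_lt continuous_const (by fun_prop)).inter (isOpen_iInter_of_finite fun j' =>
    isOpen_iInter_of_finite fun _ => isOpen_lt (by fun_prop) (by fun_prop))

theorem interior_tentBase_nonempty (hk : ∀ j, 0 < k j) : (interior (tentBase p k)).Nonempty := by
  have ho : IsOpen {x : E | ∀ j, 0 < p j x + k j} := by
    simp only [ofPred_forall]
    exact isOpen_iInter_of_finite fun j => isOpen_lt continuous_const (by fun_prop)
  exact ⟨0, interior_maximal (fun x hx j => (hx j).le) ho (fun j => by simpa using hk j)⟩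

theorem exists_lipschitzWith_tent [Nonempty J] : ∃ C, LipschitzWith C (tent p k) := by
  cases nonempty_fintype J
  refine ⟨∑ j, ‖p j‖₊, LipschitzWith.of_le_add_mul _ fun x y => ?_⟩
  rw [tent, tent, ← sub_le_iff_le_add]
  refine le_ciInf fun j => ?_
  rw [sub_le_iff_le_add]
  refine (ciInf_le (bddBelow_range_tent p k x) j).trans ?_
  have h1 : p j x - p j y ≤ ‖p j‖ * dist x y := by
    rw [← map_sub, dist_eq_norm]
    exact (le_abs_self _).trans ((p j).le_opNorm _)
  have h2 : ‖p j‖ * dist x y ≤ ((∑ j, ‖p j‖₊ : NNReal) : ℝ) * dist x y := by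
    refine mul_le_mul_of_nonneg_right ?_ dist_nonneg
    exact_mod_cast Finset.single_le_sum (f := fun j => ‖p j‖₊) (fun _ _ => zero_le)
      (Finset.mem_univ j)
  have h3 : 0 ≤ ‖p j‖ * dist x y := by positivity
  refine max_le ?_ ?_
  · have := le_max_left 0 (p j y + k j)
    linarith
  · have := le_max_right 0 (p j y + k j)
    linarith

theorem measure_tentBase_diff [FiniteDimensional ℝ E] [MeasurableSpace E] [BorelSpace E]
    (μ : Measure E) [μ.IsAddHaarMeasure] [Nonempty J] (hp : Function.Injective p)
    (hp0 : ∀ j, p j ≠ 0) : μ (tentBase p k \ ⋃ j, tentPiece p k j) = 0 := by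
  have hsub : tentBase p k \ ⋃ j, tentPiece p k j ⊆ (⋃ j, {x | p j x = -k j}) ∪
      ⋃ j, ⋃ j', ⋃ (_ : j' ≠ j), {x | (p j' - p j) x = k j - k j'} := by
    rintro x ⟨hx, hxV⟩
    by_contra h
    simp only [mem_union, mem_iUnion, mem_ofPred_eq, not_or, not_exists,
      _root_.sub_apply] at h
    obtain ⟨j, hj⟩ := Finite.exists_min fun j => p j x + k j
    refine hxV (mem_iUnion.2 ⟨j, lt_of_le_of_ne (hx j) fun h0 => h.1 j (by linarith),
      fun j' hj' => lt_of_le_of_ne (hj j') fun h0 => h.2 j j' hj' (by linarith)⟩)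
  refine measure_mono_null hsub (measure_union_null (measure_iUnion_null fun j => ?_)
    (measure_iUnion_null fun j => measure_iUnion_null fun j' => measure_iUnion_null fun h => ?_))
  · exact measure_setOf_apply_eq μ (hp0 j) _
  · exact measure_setOf_apply_eq μ (sub_ne_zero.2 (hp.ne h)) _

end Tent

theorem prod_ite_eq_mul_pow {m : ℕ} (i₀ : Fin m) (s t : ℝ) :
    ∏ j, (if j = i₀ then s else t) = s * t ^ (m - 1) := by
  rw [← Finset.mul_prod_erase _ _ (Finset.mem_univ i₀), if_pos rfl,
    Finset.prod_congr rfl fun j hj => if_neg (Finset.ne_of_mem_erase hj)]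
  simp

theorem volume_box_ite {m : ℕ} (i₀ : Fin m) {lo hi : Fin m → ℝ} {s t : ℝ} (hs : 0 ≤ s)
    (ht : 0 ≤ t) (h : ∀ j, hi j - lo j = if j = i₀ then s else t) :
    volume (Icc lo hi) = ENNReal.ofReal (s * t ^ (m - 1)) ∧
      volume (Set.pi univ fun j => Ioo (lo j) (hi j)) = ENNReal.ofReal (s * t ^ (m - 1)) := by
  rw [Real.volume_Icc_pi, Real.volume_pi_Ioo, and_self]
  simp_rw [h]
  rw [← ENNReal.ofReal_prod_of_nonneg, prod_ite_eq_mul_pow]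
  intro j _
  split_ifs <;> assumption

/-- Slopes of the roof over a box: `s` and `-t` in the coordinate `i₀`, and `±δ` otherwise. -/
def roofSlope {m : ℕ} (i₀ : Fin m) (s t δ : ℝ) (j : Fin m × Bool) : ℝ :=
  if j.1 = i₀ then (if j.2 then s else -t) else (if j.2 then δ else -δ)

/-- The coordinate functionals, the one of index `i₀` being replaced by the functional `q`. -/
def roofCoord {m : ℕ} (i₀ : Fin m) (q : (Fin m → ℝ) →L[ℝ] ℝ) (j : Fin m) :
    (Fin m → ℝ) →L[ℝ] ℝ :=
  if j = i₀ then q else ContinuousLinearMap.proj j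

theorem injective_pi_roofCoord {m : ℕ} (i₀ : Fin m) {q : (Fin m → ℝ) →L[ℝ] ℝ}
    (hq : q (Pi.single i₀ 1) ≠ 0) :
    Function.Injective (ContinuousLinearMap.pi (roofCoord i₀ q)) := by
  refine (injective_iff_map_eq_zero _).2 fun x hx => ?_
  have hj : ∀ j, roofCoord i₀ q j x = 0 := fun j => congrFun hx j
  have hx0 : ∀ j, j ≠ i₀ → x j = 0 := fun j h => by simpa [roofCoord, h] using hj j
  have hxs : x = x i₀ • Pi.single i₀ 1 := by
    ext j
    by_cases h : j = i₀
    · subst h; simp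
    · simp [h, hx0 j h]
  have hq0 : q x = 0 := by simpa [roofCoord] using hj i₀
  rw [hxs, map_smul, smul_eq_mul, mul_eq_zero, or_iff_left hq] at hq0
  rw [hxs, hq0, zero_smul]

theorem exists_roof {m : ℕ} (i₀ : Fin m) {q : (Fin m → ℝ) →L[ℝ] ℝ}
    (hq : q (Pi.single i₀ 1) ≠ 0) {s t δ ε : ℝ} (hs : 0 < s) (ht : 0 < t) (hst : s + t = 1)
    (hδ : 0 < δ) (hε : 0 < ε) :
    ∃ (p : Fin m × Bool → (Fin m → ℝ) →L[ℝ] ℝ) (k : Fin m × Bool → ℝ),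
      (∀ j, p j = roofSlope i₀ s t δ j • roofCoord i₀ q j.1) ∧
      Function.Injective p ∧ (∀ j, p j ≠ 0) ∧ (∀ j, 0 < k j) ∧
      Bornology.IsBounded (tentBase p k) ∧
      ENNReal.ofReal ((1 - ε) * t) * volume (tentBase p k) ≤ volume (tentPiece p k (i₀, true)) ∧
      ENNReal.ofReal ((1 - ε) * s) * volume (tentBase p k) ≤
        volume (tentPiece p k (i₀, false)) := by
  have hm : 0 < (m : ℝ) := by exact_mod_cast i₀.pos
  obtain ⟨η, hη, hη1, hηε⟩ : ∃ η : ℝ, 0 < η ∧ η < 1 ∧ m * η ≤ ε := by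
    refine ⟨min (1 / 2) (ε / m), by positivity, (min_le_left _ _).trans_lt (by norm_num), ?_⟩
    calc m * min (1 / 2) (ε / m) ≤ m * (ε / m) := by gcongr; exact min_le_right _ _
      _ = ε := by field_simp
  have hbern : 1 - ε ≤ (1 - η) ^ (m - 1) := by
    have h := one_add_mul_le_pow (a := -η) (by linarith) (m - 1)
    have h2 : ((m - 1 : ℕ) : ℝ) * η ≤ m * η := by
      gcongr; exact Nat.sub_le _ _
    rw [← sub_eq_add_neg] at h
    linarith
  set k : Fin m × Bool → ℝ := fun j => if j.1 = i₀ then 1 else 1 / η with hk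
  set p : Fin m × Bool → (Fin m → ℝ) →L[ℝ] ℝ :=
    fun j => roofSlope i₀ s t δ j • roofCoord i₀ q j.1
  set L := ContinuousLinearMap.pi (roofCoord i₀ q)
  have hLinj : Function.Injective L := injective_pi_roofCoord i₀ hq
  have happ : ∀ j x, p j x + k j = roofSlope i₀ s t δ j * L x j.1 + k j := fun j x => rfl
  let e := LinearEquiv.ofInjectiveEndo (L : (Fin m → ℝ) →ₗ[ℝ] (Fin m → ℝ)) hLinj
  have hdet : LinearMap.det (L : (Fin m → ℝ) →ₗ[ℝ] (Fin m → ℝ)) ≠ 0 := by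
    have := e.isUnit_det'.ne_zero
    exact this
  have hLvol : ∀ S : Set (Fin m → ℝ), volume (L ⁻¹' S) = ENNReal.ofReal
      |(LinearMap.det (L : (Fin m → ℝ) →ₗ[ℝ] (Fin m → ℝ)))⁻¹| * volume S :=
    fun S => Measure.addHaar_preimage_linearMap volume hdet S
  have hslope : ∀ j, roofSlope i₀ s t δ j ≠ 0 := by
    rintro ⟨j, b⟩
    unfold roofSlope
    cases b <;> split_ifs <;> simp_all [ne_of_gt]
  have hcoord : ∀ j, ∃ x, L x = Pi.single j 1 := fun j => e.surjective _
  have hpsingle : ∀ j b j' x, L x = Pi.single j' 1 →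
      p (j, b) x = if j = j' then roofSlope i₀ s t δ (j, b) else 0 := by
    intro j b j' x hx
    change roofSlope i₀ s t δ (j, b) * L x j = _
    rw [hx, Pi.single_apply]
    split_ifs <;> simp
  have hlower : ∀ a c z : ℝ, 0 < a → (0 ≤ a * z + c ↔ -(c / a) ≤ z) := fun a c z ha => by
    rw [neg_le, le_div_iff₀' ha]
    constructor <;> intro h <;> linarith
  have hupper : ∀ a c z : ℝ, 0 < a → (0 ≤ -a * z + c ↔ z ≤ c / a) := fun a c z ha => by
    rw [le_div_iff₀' ha]
    constructor <;> intro h <;> linarith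
  have hP : tentBase p k = L ⁻¹' Icc (fun j => if j = i₀ then -(1 / s) else -(1 / η / δ))
      (fun j => if j = i₀ then 1 / t else 1 / η / δ) := by
    ext x
    simp only [tentBase, mem_ofPred_eq, happ, mem_preimage, mem_Icc, Pi.le_def, ← forall_and,
      Prod.forall, Bool.forall_bool]
    refine forall_congr' fun j => ?_
    by_cases h : j = i₀
    · simp only [h, roofSlope, hk, if_true, Bool.false_eq_true, if_false]
      rw [hlower _ _ _ hs, hupper _ _ _ ht, and_comm]
    · simp only [h, roofSlope, hk, if_true, Bool.false_eq_true, if_false]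
      rw [hlower _ _ _ hδ, hupper _ _ _ hδ, and_comm]
  have hpiece : ∀ b x, 0 < roofSlope i₀ s t δ (i₀, b) * L x i₀ + 1 →
      roofSlope i₀ s t δ (i₀, b) * L x i₀ < 0 →
      (∀ j, j ≠ i₀ → -((1 / η - 1) / δ) < L x j ∧ L x j < (1 / η - 1) / δ) →
      x ∈ tentPiece p k (i₀, b) := by
    intro b x h0 h1 h2
    refine ⟨?_, ?_⟩
    · rw [happ]
      simpa only [hk, if_true] using h0
    rintro ⟨j, b'⟩ hj
    rw [happ, happ]
    simp only [hk, if_true]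
    by_cases h : j = i₀
    · subst h
      have hz : b' = !b := by
        cases b <;> cases b' <;> simp_all
      subst hz
      cases b <;> simp only [roofSlope, Bool.not_true, Bool.not_false, if_true,
        Bool.false_eq_true, if_false] at h1 ⊢ <;> nlinarith
    · obtain ⟨h3, h4⟩ := h2 j h
      rw [lt_div_iff₀' hδ] at h4
      rw [neg_lt, lt_div_iff₀' hδ] at h3
      have h5 : roofSlope i₀ s t δ (j, b') = if b' then δ else -δ := if_neg h
      rw [if_neg h, h5]
      cases b' <;> simp only [if_true, Bool.false_eq_true, if_false] <;> linarith
  have hVP : volume (tentBase p k) = ENNReal.ofReal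
      |(LinearMap.det (L : (Fin m → ℝ) →ₗ[ℝ] (Fin m → ℝ)))⁻¹| *
        ENNReal.ofReal ((1 / t + 1 / s) * (2 * (1 / η / δ)) ^ (m - 1)) := by
    rw [hP, hLvol, (volume_box_ite (s := 1 / t + 1 / s) (t := 2 * (1 / η / δ)) i₀ (by positivity)
      (by positivity) _).1]
    intro j
    split_ifs <;> ring
  have hη' : 0 < 1 / η - 1 := by
    rw [sub_pos, lt_div_iff₀ hη]; linarith
  have hvol : ∀ (b : Bool) (lo hi a : ℝ), 0 < a → a * (1 / t + 1 / s) = hi - lo →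
      (∀ z, lo < z → z < hi → 0 < roofSlope i₀ s t δ (i₀, b) * z + 1 ∧
        roofSlope i₀ s t δ (i₀, b) * z < 0) →
      ENNReal.ofReal ((1 - ε) * a) * volume (tentBase p k) ≤
        volume (tentPiece p k (i₀, b)) := by
    intro b lo hi a ha hw hz
    have hsub : L ⁻¹' (Set.pi univ fun j =>
        Ioo (if j = i₀ then lo else -((1 / η - 1) / δ))
          (if j = i₀ then hi else (1 / η - 1) / δ)) ⊆ tentPiece p k (i₀, b) := by
      intro x hx
      simp only [mem_preimage, Set.mem_pi, mem_univ, true_implies, mem_Ioo] at hx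
      have h0 := hx i₀
      simp only [if_true] at h0
      refine hpiece b x (hz _ h0.1 h0.2).1 (hz _ h0.1 h0.2).2 fun j hj => ?_
      simpa only [hj, if_false] using hx j
    refine le_trans ?_ (measure_mono hsub)
    have hw0 : 0 ≤ hi - lo := by rw [← hw]; positivity
    rw [hLvol, (volume_box_ite (s := hi - lo) (t := 2 * ((1 / η - 1) / δ)) i₀ hw0
      (by positivity) _).2, hVP, mul_left_comm]
    · gcongr
      rw [← ENNReal.ofReal_mul' (by positivity)]
      refine ENNReal.ofReal_le_ofReal ?_
      have h2 : 2 * ((1 / η - 1) / δ) = (1 - η) * (2 * (1 / η / δ)) := by field_simp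
      rw [h2, mul_pow (1 - η), ← hw]
      calc (1 - ε) * a * ((1 / t + 1 / s) * (2 * (1 / η / δ)) ^ (m - 1))
          = (1 - ε) * (a * (1 / t + 1 / s) * (2 * (1 / η / δ)) ^ (m - 1)) := by ring
        _ ≤ (1 - η) ^ (m - 1) * (a * (1 / t + 1 / s) * (2 * (1 / η / δ)) ^ (m - 1)) := by
          gcongr
        _ = _ := by ring
    · intro j
      split_ifs <;> ring
  have hsign : ∀ j, 0 < roofSlope i₀ s t δ (j, true) ∧ roofSlope i₀ s t δ (j, false) < 0 := by
    intro j
    simp only [roofSlope, if_true, Bool.false_eq_true, if_false]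
    split_ifs <;> constructor <;> linarith
  refine ⟨p, k, fun j => rfl, ?_, ?_, ?_, ?_, ?_, ?_⟩
  · rintro ⟨j, b⟩ ⟨j', b'⟩ h
    obtain ⟨x, hx⟩ := hcoord j
    have h2 := congrArg (fun f => f x) h
    simp only [hpsingle _ _ _ _ hx, if_true] at h2
    split_ifs at h2 with h3
    · subst h3
      have := hsign j'
      cases b <;> cases b' <;> first | rfl | (exfalso; linarith)
    · exact absurd h2 (hslope _)
  · rintro ⟨j, b⟩ h
    obtain ⟨x, hx⟩ := hcoord j
    have h2 := hpsingle j b j x hx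
    rw [h, if_pos rfl] at h2
    exact hslope _ h2.symm
  · intro j
    simp only [hk]
    split_ifs <;> positivity
  · rw [hP]
    exact (e.toContinuousLinearEquiv.toHomeomorph.isCompact_preimage.2 isCompact_Icc).isBounded
  · refine hvol true (-(1 / s)) 0 t ht ?_ fun z hz1 hz2 => ?_
    · field_simp
      linarith
    · simp only [roofSlope, if_true]
      rw [neg_lt, lt_div_iff₀' hs] at hz1
      exact ⟨by linarith, mul_neg_of_pos_of_neg hs hz2⟩
  · refine hvol false 0 (1 / t) s hs ?_ fun z hz1 hz2 => ?_
    · field_simp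
      linarith
    · simp only [roofSlope, if_true, Bool.false_eq_true, if_false]
      rw [lt_div_iff₀' ht] at hz2
      exact ⟨by linarith, by nlinarith⟩
theorem lmap_eq_mulVec_add {m d : ℕ} (A : Matrix (Fin d) (Fin m) ℝ) (b : Fin d → ℝ)
    (x : Fin m → ℝ) : lmap A b x = A.mulVec x + b := rfl

theorem exists_lipschitzWith_lmap {m d : ℕ} (A : Matrix (Fin d) (Fin m) ℝ) (b : Fin d → ℝ) :
    ∃ C, LipschitzWith C (lmap A b) := by
  refine ⟨‖A.mulVecLin.toContinuousLinearMap‖₊, LipschitzWith.of_dist_le_mul fun x y => ?_⟩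
  have := A.mulVecLin.toContinuousLinearMap.lipschitz.dist_le_mul x y
  simpa [lmap_eq_mulVec_add] using this

theorem lineDeriv_lmap {m d : ℕ} (B : Matrix (Fin d) (Fin m) ℝ) (c : Fin d → ℝ)
    (x : Fin m → ℝ) (k : Fin d) (i : Fin m) :
    lineDeriv ℝ (fun y => lmap B c y k) x (Pi.single i 1) = B k i := by
  have : (fun t : ℝ => lmap B c (x + t • Pi.single i 1) k) =
      fun t => t * B k i + lmap B c x k := by
    ext t
    simp only [lmap_eq_mulVec_add, Matrix.mulVec_add, Matrix.mulVec_smul, Pi.add_apply,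
      Pi.smul_apply, Matrix.mulVec_single_one, Matrix.col_apply, smul_eq_mul]
    ring
  rw [lineDeriv, this]
  simp

/-- The matrix of the partial derivatives of `u` at `x`. -/
def gradMatrix {m d : ℕ} (u : (Fin m → ℝ) → Fin d → ℝ) (x : Fin m → ℝ) :
    Matrix (Fin d) (Fin m) ℝ :=
  Matrix.of fun k i => lineDeriv ℝ (fun y => u y k) x (Pi.single i 1)

theorem gradMatrix_eq_of_eqOn_lmap {m d : ℕ} {u : (Fin m → ℝ) → Fin d → ℝ}
    {V : Set (Fin m → ℝ)} (hV : IsOpen V) {B : Matrix (Fin d) (Fin m) ℝ} {c : Fin d → ℝ}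
    (h : ∀ x ∈ V, u x = lmap B c x) {x : Fin m → ℝ} (hx : x ∈ V) : gradMatrix u x = B := by
  ext k i
  rw [gradMatrix, Matrix.of_apply, ← lineDeriv_lmap B c x k i]
  refine Filter.EventuallyEq.lineDeriv_eq ?_
  filter_upwards [hV.mem_nhds hx] with y hy using by rw [h y hy]

theorem measurable_gradMatrix_apply {m d : ℕ} {u : (Fin m → ℝ) → Fin d → ℝ}
    (hu : Continuous u) (k : Fin d) (i : Fin m) : Measurable fun x => gradMatrix u x k i :=
  measurable_lineDeriv ((continuous_apply k).comp hu)

theorem measurableSet_gradMatrix_eq {m d : ℕ} {u : (Fin m → ℝ) → Fin d → ℝ}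
    (hu : Continuous u) (B : Matrix (Fin d) (Fin m) ℝ) :
    MeasurableSet {x | gradMatrix u x = B} := by
  simp only [← Matrix.ext_iff, Set.ofPred_forall]
  exact MeasurableSet.iInter fun k => MeasurableSet.iInter fun i =>
    measurable_gradMatrix_apply hu k i (measurableSet_singleton _)

theorem _root_.LipschitzWith.hasWeakGradientOn {m d : ℕ} {u : (Fin m → ℝ) → Fin d → ℝ}
    {C : NNReal} (hu : LipschitzWith C u) {Ω : Set (Fin m → ℝ)} (hb : Bornology.IsBounded Ω) :
    HasWeakGradientOn u (gradMatrix u) Ω := by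
  have huk : ∀ k, LipschitzWith (1 * C) fun y => u y k := fun k =>
    (LipschitzWith.eval k).comp hu
  refine ⟨?_, fun k i => ?_, fun φ hφ hφc hφΩ k i => ?_⟩
  · exact (hu.continuous.continuousOn.integrableOn_compact hb.isCompact_closure).mono_set
      subset_closure
  · exact Measure.integrableOn_of_bounded hb.measure_lt_top.ne
      (measurable_gradMatrix_apply hu.continuous k i).aestronglyMeasurable
      (Eventually.of_forall fun x => norm_lineDeriv_le_of_lipschitz ℝ (huk k))
  · have hφ1 : ContDiff ℝ 1 φ := by exact_mod_cast hφ 1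
    obtain ⟨D, hD⟩ := hφ1.lipschitzWith_of_hasCompactSupport hφc one_ne_zero
    have hφ0 : ∀ x ∉ Ω, φ x = 0 := fun x hx =>
      image_eq_zero_of_notMem_tsupport fun h => hx (hφΩ h)
    have hφ'0 : ∀ x ∉ Ω, fderiv ℝ φ x = 0 := fun x hx => by
      by_contra h
      exact hx (hφΩ (support_fderiv_subset ℝ h))
    rw [setIntegral_eq_integral_of_forall_compl_eq_zero fun x hx => by simp [hφ'0 x hx],
      setIntegral_eq_integral_of_forall_compl_eq_zero fun x hx => by simp [hφ0 x hx]]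
    have := LipschitzWith.integral_lineDeriv_mul_eq (μ := volume) (huk k) hD hφc (Pi.single i 1)
    simp only [gradMatrix, Matrix.of_apply]
    rw [this, ← integral_neg]
    congr 1 with x
    rw [((hφ1.differentiable one_ne_zero) x).lineDeriv_eq_fderiv, map_neg]
    ring

theorem exists_eq_mul_of_rank_eq_one {m d : ℕ} {D : Matrix (Fin d) (Fin m) ℝ}
    (hD : D.rank = 1) : ∃ (a : Fin d → ℝ) (n : Fin m → ℝ) (i₀ : Fin m), n i₀ ≠ 0 ∧
      ∀ k i, D k i = a k * n i := by
  obtain ⟨v, -, hv⟩ := finrank_eq_one_iff'.1 hD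
  choose n hn using fun i => hv ⟨D.mulVecLin (Pi.single i 1), LinearMap.mem_range_self _ _⟩
  have hDn : ∀ k i, D k i = (v : Fin d → ℝ) k * n i := by
    intro k i
    have := congrFun (congrArg Subtype.val (hn i)) k
    simpa [mul_comm] using this.symm
  have hn0 : ∃ i₀, n i₀ ≠ 0 := by
    by_contra! h
    have : D = 0 := by
      ext k i
      simp [hDn, h]
    simp [this] at hD
  obtain ⟨i₀, hi₀⟩ := hn0
  exact ⟨v, n, i₀, hi₀, hDn⟩

theorem frobNorm_convex_comb_lt_max {m d : ℕ} {A₁ A₂ : Matrix (Fin d) (Fin m) ℝ} (hne : A₁ ≠ A₂)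
    {s t : ℝ} (hs : 0 < s) (ht : 0 < t) (hst : s + t = 1) :
    frobNorm (s • A₁ + t • A₂) < max (frobNorm A₁) (frobNorm A₂) := by
  by_contra! h
  obtain ⟨h₁, h₂⟩ := max_le_iff.1 h
  have hnonneg : ∀ X : Matrix (Fin d) (Fin m) ℝ, 0 ≤ ∑ k, ∑ i, X k i ^ 2 := fun X =>
    Finset.sum_nonneg fun _ _ => Finset.sum_nonneg fun _ _ => sq_nonneg _
  unfold frobNorm at h₁ h₂
  rw [Real.sqrt_le_sqrt_iff (hnonneg _)] at h₁ h₂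
  have hid : ∑ k, ∑ i, (s • A₁ + t • A₂) k i ^ 2 = s * ∑ k, ∑ i, A₁ k i ^ 2 +
      t * ∑ k, ∑ i, A₂ k i ^ 2 - s * t * ∑ k, ∑ i, (A₁ - A₂) k i ^ 2 := by
    simp only [Finset.mul_sum, ← Finset.sum_add_distrib, ← Finset.sum_sub_distrib,
      Matrix.add_apply, Matrix.smul_apply, Matrix.sub_apply, smul_eq_mul]
    refine Finset.sum_congr rfl fun k _ => Finset.sum_congr rfl fun i _ => ?_
    obtain rfl : t = 1 - s := by linarith
    ring
  have hpos : 0 < ∑ k, ∑ i, (A₁ - A₂) k i ^ 2 := by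
    refine lt_of_le_of_ne (hnonneg _) fun h0 => hne ?_
    ext k i
    have h1 := (Finset.sum_eq_zero_iff_of_nonneg fun k _ => Finset.sum_nonneg
      fun i _ => sq_nonneg ((A₁ - A₂) k i)).1 h0.symm k (Finset.mem_univ k)
    have h2 := (Finset.sum_eq_zero_iff_of_nonneg fun i _ => sq_nonneg ((A₁ - A₂) k i)).1 h1 i
      (Finset.mem_univ i)
    exact sub_eq_zero.1 (pow_eq_zero_iff two_ne_zero |>.1 h2)
  have := mul_pos (mul_pos hs ht) hpos
  have h₁' := mul_le_mul_of_nonneg_left h₁ hs.le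
  have h₂' := mul_le_mul_of_nonneg_left h₂ ht.le
  have hS : s * ∑ k, ∑ i, (s • A₁ + t • A₂) k i ^ 2 + t * ∑ k, ∑ i, (s • A₁ + t • A₂) k i ^ 2 =
      ∑ k, ∑ i, (s • A₁ + t • A₂) k i ^ 2 := by
    rw [← add_mul, hst, one_mul]
  linarith

theorem exists_pos_forall_frobNorm_le {m d : ℕ} {A : Matrix (Fin d) (Fin m) ℝ} {R : ℝ}
    (hA : frobNorm A < R) (a : Fin d → ℝ) : ∃ δ > 0, ∀ τ : ℝ, |τ| ≤ δ → ∀ j : Fin m,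
      frobNorm (A + Matrix.of fun k i => a k * (τ * (Pi.single i 1 : Fin m → ℝ) j)) ≤ R := by
  have hev : ∀ᶠ τ in 𝓝 (0 : ℝ), ∀ j : Fin m,
      frobNorm (A + Matrix.of fun k i => a k * (τ * (Pi.single i 1 : Fin m → ℝ) j)) < R := by
    refine eventually_all.2 fun j => ?_
    have hc : Continuous fun τ : ℝ =>
        frobNorm (A + Matrix.of fun k i => a k * (τ * (Pi.single i 1 : Fin m → ℝ) j)) := by
      simp only [frobNorm, Matrix.add_apply, Matrix.of_apply]
      fun_prop
    refine hc.tendsto 0 |>.eventually_lt_const ?_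
    simpa [frobNorm] using hA
  obtain ⟨δ, hδ, h⟩ := Metric.eventually_nhds_iff.1 hev
  refine ⟨δ / 2, by positivity, fun τ hτ j => (h (y := τ) ?_ j).le⟩
  rw [Real.dist_eq, sub_zero]
  linarith

theorem le_ofReal_mul_of_add_le {V a b : ENNReal} (hV : V ≠ ⊤) (hab : a + b ≤ V) {s t ε ε' : ℝ}
    (hs : 0 < s) (ht : 0 < t) (hst : s + t = 1) (hε' : ε' ≤ 1) (hε'0 : 0 < ε') (h : ε' ≤ ε * s)
    (hb : ENNReal.ofReal ((1 - ε') * t) * V ≤ b) : a ≤ ENNReal.ofReal ((1 + ε) * s) * V := by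
  have hc : 0 ≤ (1 - ε') * t := mul_nonneg (by linarith) ht.le
  have hfin : ENNReal.ofReal ((1 - ε') * t) * V ≠ ⊤ := ENNReal.mul_ne_top ENNReal.ofReal_ne_top hV
  refine (ENNReal.add_le_add_iff_right hfin).1 ?_
  calc a + ENNReal.ofReal ((1 - ε') * t) * V ≤ a + b := by gcongr
    _ ≤ V := hab
    _ ≤ ENNReal.ofReal ((1 + ε) * s + (1 - ε') * t) * V := by
      refine le_mul_of_one_le_left' (ENNReal.one_le_ofReal.2 ?_)
      nlinarith
    _ = _ := by
      rw [ENNReal.ofReal_add (by nlinarith) hc, add_mul]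

theorem clm_apply_eq_sum_single {m : ℕ} (f : (Fin m → ℝ) →L[ℝ] ℝ)
    (x : Fin m → ℝ) : f x = ∑ i, f (Pi.single i 1) * x i := by
  conv_lhs => rw [pi_eq_sum_univ' x]
  simp [mul_comm]

theorem lmap_add_mul {m d : ℕ} (A : Matrix (Fin d) (Fin m) ℝ) (a b : Fin d → ℝ)
    (f : (Fin m → ℝ) →L[ℝ] ℝ) (c : ℝ) (x : Fin m → ℝ) :
    lmap A b x + (f x + c) • a =
      lmap (A + Matrix.of fun k i => a k * f (Pi.single i 1)) (b + c • a) x := by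
  ext k
  simp only [lmap, Pi.add_apply, Pi.smul_apply, smul_eq_mul, Matrix.add_apply, Matrix.of_apply,
    add_mul, Finset.sum_add_distrib, mul_assoc, ← Finset.mul_sum]
  rw [clm_apply_eq_sum_single f x]
  ring

theorem isPiecewiseAffineOn_of_convex {m d : ℕ} {u : (Fin m → ℝ) → Fin d → ℝ}
    {Ω : Set (Fin m → ℝ)} {I : Type*} [Countable I] {U : I → Set (Fin m → ℝ)}
    (hU : ∀ i, IsOpen (U i) ∧ Convex ℝ (U i) ∧ Bornology.IsBounded (U i) ∧ U i ⊆ Ω)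
    (hd : Pairwise (Disjoint on U)) (hnull : volume (Ω \ ⋃ i, U i) = 0)
    (haff : ∀ i, IsAffineOn u (U i)) : IsPiecewiseAffineOn u Ω := by
  refine ⟨{V | V.Nonempty ∧ ∃ i, U i = V}, (countable_range U).mono fun V hV => hV.2, ?_, ?_, ?_⟩
  · rintro _ ⟨hne, i, rfl⟩
    obtain ⟨ho, hc, hb, hs⟩ := hU i
    exact ⟨⟨ho, hb, hc.isConnected hne, hc.addHaar_frontier volume⟩, hs, haff i⟩
  · rintro _ ⟨-, i, rfl⟩ _ ⟨-, j, rfl⟩ h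
    exact hd fun hij => h (by rw [hij])
  · refine measure_mono_null (Set.sdiff_subset_sdiff_right ?_) hnull
    refine iUnion_subset fun i x hx => mem_sUnion.2 ⟨U i, ⟨⟨x, hx⟩, i, rfl⟩, hx⟩

/-- Lemma (basic roof construction for a rank-one splitting). -/
theorem roof_construction {d m : ℕ}
    (A A₁ A₂ : Matrix (Fin d) (Fin m) ℝ) (lam₁ lam₂ : ℝ)
    (h1 : 0 < lam₁) (h2 : 0 < lam₂) (hsum : lam₁ + lam₂ = 1)
    (hrank : (A₁ - A₂).rank = 1) (hA : A = lam₁ • A₁ + lam₂ • A₂) :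
    ∀ b : Fin d → ℝ, ∀ ε : ℝ, 0 < ε → ∀ Ω : Set (Fin m → ℝ), IsRegularDomain Ω →
    ∃ (u : (Fin m → ℝ) → Fin d → ℝ) (G : (Fin m → ℝ) → Matrix (Fin d) (Fin m) ℝ),
      (∃ C : NNReal, LipschitzOnWith C u Ω) ∧
      IsPiecewiseAffineOn u Ω ∧ HasWeakGradientOn u G Ω ∧ ContinuousOn u (closure Ω) ∧
      (∀ x ∈ frontier Ω, u x = lmap A b x) ∧
      (∀ᵐ x ∂(volume.restrict Ω), frobNorm (G x) ≤ max (frobNorm A₁) (frobNorm A₂)) ∧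
      (ENNReal.ofReal ((1 - ε) * lam₁) * volume Ω ≤ volume {x ∈ Ω | G x = A₁} ∧
        volume {x ∈ Ω | G x = A₁} ≤ ENNReal.ofReal ((1 + ε) * lam₁) * volume Ω) ∧
      (ENNReal.ofReal ((1 - ε) * lam₂) * volume Ω ≤ volume {x ∈ Ω | G x = A₂} ∧
        volume {x ∈ Ω | G x = A₂} ≤ ENNReal.ofReal ((1 + ε) * lam₂) * volume Ω) := by
  rintro b ε hε Ω ⟨hΩo, hΩb, -, -⟩
  have hΩtop : volume Ω ≠ ⊤ := hΩb.measure_lt_top.ne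
  have hne : A₁ ≠ A₂ := by
    rintro rfl
    simp at hrank
  obtain ⟨a, n, i₀, hn, hD⟩ := exists_eq_mul_of_rank_eq_one hrank
  simp only [Matrix.sub_apply] at hD
  obtain ⟨δ, hδ, hsmall⟩ :=
    exists_pos_forall_frobNorm_le (hA ▸ frobNorm_convex_comb_lt_max hne h1 h2 hsum) a
  obtain ⟨ε', hε'0, hε'1, hε'₁, hε'₂⟩ : ∃ ε' : ℝ, 0 < ε' ∧ ε' ≤ 1 ∧ ε' ≤ ε * lam₁ ∧
      ε' ≤ ε * lam₂ :=
    ⟨min 1 (min (ε * lam₁) (ε * lam₂)), by positivity, min_le_left _ _,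
      (min_le_right _ _).trans (min_le_left _ _), (min_le_right _ _).trans (min_le_right _ _)⟩
  have hε'ε : ε' ≤ ε := by nlinarith
  let q : (Fin m → ℝ) →L[ℝ] ℝ := ∑ i, n i • ContinuousLinearMap.proj i
  have hq : ∀ i, q (Pi.single i 1) = n i := fun i => by
    simp [q, Pi.single_apply]
  obtain ⟨p, k, hpk, hpinj, hp0, hk, hPb, hvol₁, hvol₂⟩ :=
    exists_roof i₀ (q := q) (by rwa [hq]) h2 h1 (by linarith) hδ hε'0
  have : Nonempty (Fin m × Bool) := ⟨(i₀, true)⟩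
  obtain ⟨C, hC⟩ := exists_lipschitzWith_tent p k
  have hPint := interior_tentBase_nonempty p k hk
  obtain ⟨w, I, U, c, hI, hwL, hw0, hU, hUd, hUnull, hUaff, hUvol⟩ :=
    exists_lipschitz_tiling volume (isClosed_tentBase p k) hPb hPint hC (tent_nonneg p k)
      (fun x hx => tent_eq_zero_of_notMem p k hx) (isOpen_tentPiece p k) (convex_tentPiece p k)
      (pairwise_disjoint_tentPiece p k) (tentPiece_subset p k)
      (measure_tentBase_diff p k volume hpinj hp0) (fun j x hx => tent_eq_of_mem p k hx) hΩo
  have : Countable I := hI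
  let u : (Fin m → ℝ) → Fin d → ℝ := fun x => lmap A b x + w x • a
  let B : Fin m × Bool → Matrix (Fin d) (Fin m) ℝ := fun j =>
    A + Matrix.of fun k i => a k * p j (Pi.single i 1)
  have hu : ∀ i, ∀ x ∈ U i, u x = lmap (B i.2) (b + c i • a) x := fun i x hx => by
    simp only [u, B, hUaff i x hx, lmap_add_mul]
  obtain ⟨K, hK⟩ := exists_lipschitzWith_lmap A b
  have hsmul : LipschitzWith ‖ContinuousLinearMap.toSpanSingleton ℝ a‖₊ fun t : ℝ => t • a :=
    (ContinuousLinearMap.toSpanSingleton ℝ a).lipschitz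
  have huL := hK.add (hsmul.comp hwL)
  have hgrad : ∀ i, ∀ x ∈ U i, gradMatrix u x = B i.2 := fun i x hx =>
    gradMatrix_eq_of_eqOn_lmap (hU i).1 (hu i) hx
  have hB₁ : B (i₀, true) = A₁ := by
    ext k i
    simp only [B, hpk, roofSlope, roofCoord, if_true, Matrix.add_apply, Matrix.of_apply,
      _root_.smul_apply, hq, smul_eq_mul, hA, Matrix.smul_apply]
    linear_combination (-lam₂) * hD k i + A₁ k i * hsum
  have hB₂ : B (i₀, false) = A₂ := by
    ext k i
    simp only [B, hpk, roofSlope, roofCoord, if_true, Bool.false_eq_true, if_false,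
      Matrix.add_apply, Matrix.of_apply, _root_.smul_apply, hq, smul_eq_mul, hA,
      Matrix.smul_apply]
    linear_combination lam₁ * hD k i + A₂ k i * hsum
  have hBle : ∀ j, frobNorm (B j) ≤ max (frobNorm A₁) (frobNorm A₂) := by
    rintro ⟨j, e⟩
    by_cases hj : j = i₀
    · subst hj
      cases e
      · rw [hB₂]; exact le_max_right _ _
      · rw [hB₁]; exact le_max_left _ _
    · have := hsmall (if e then δ else -δ) (by split_ifs <;> simp [abs_of_pos hδ]) j
      simpa only [B, hpk, roofSlope, roofCoord, hj, if_false, _root_.smul_apply, smul_eq_mul,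
        ContinuousLinearMap.proj_apply] using this
  have hlow : ∀ (j : Fin m × Bool) (l : ℝ), ENNReal.ofReal l * volume (tentBase p k) ≤
      volume (tentPiece p k j) →
      ENNReal.ofReal l * volume Ω ≤ volume {x ∈ Ω | gradMatrix u x = B j} := by
    intro j l hl
    have hsub : (⋃ i, U (i, j)) ⊆ {x ∈ Ω | gradMatrix u x = B j} :=
      iUnion_subset fun i x hx => ⟨(hU (i, j)).2.2.2 hx, hgrad (i, j) x hx⟩
    refine le_trans ?_ (measure_mono hsub)
    have hPpos : volume (tentBase p k) ≠ 0 :=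
      ((isOpen_interior.measure_pos volume hPint).trans_le (measure_mono interior_subset)).ne'
    refine (ENNReal.mul_le_mul_iff_right hPpos hPb.measure_lt_top.ne).1 ?_
    calc volume (tentBase p k) * (ENNReal.ofReal l * volume Ω)
        = ENNReal.ofReal l * volume (tentBase p k) * volume Ω := by ring
      _ ≤ volume (tentPiece p k j) * volume Ω := by gcongr
      _ ≤ _ := hUvol j
  have hlow₁ := hlow _ _ hvol₁
  have hlow₂ := hlow _ _ hvol₂
  rw [hB₁] at hlow₁
  rw [hB₂] at hlow₂
  have hadd : volume {x ∈ Ω | gradMatrix u x = A₁} + volume {x ∈ Ω | gradMatrix u x = A₂} ≤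
      volume Ω := by
    rw [← measure_union]
    · exact measure_mono (union_subset (fun x hx => hx.1) fun x hx => hx.1)
    · exact Set.disjoint_left.2 fun x hx hx' => hne (hx.2.symm.trans hx'.2)
    · exact hΩo.measurableSet.inter (measurableSet_gradMatrix_eq huL.continuous A₂)
  refine ⟨u, gradMatrix u, ⟨_, huL.lipschitzOnWith⟩,
    isPiecewiseAffineOn_of_convex hU hUd hUnull fun i => ⟨_, _, hu i⟩,
    huL.hasWeakGradientOn hΩb, huL.continuous.continuousOn, fun x hx => ?_, ?_, ⟨?_, ?_⟩, ?_, ?_⟩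
  · have hxΩ : x ∉ Ω := by
      rw [hΩo.frontier_eq] at hx
      exact hx.2
    simp [u, hw0 x hxΩ]
  · rw [ae_restrict_iff' hΩo.measurableSet]
    filter_upwards [measure_eq_zero_iff_ae_notMem.1 hUnull] with x hx hxΩ
    obtain ⟨i, hi⟩ : ∃ i, x ∈ U i := by
      by_contra h
      exact hx ⟨hxΩ, by simpa using h⟩
    rw [hgrad i x hi]
    exact hBle i.2
  · exact le_trans (by gcongr) hlow₁
  · exact le_ofReal_mul_of_add_le hΩtop hadd h1 h2 hsum hε'1 hε'0 hε'₁ hlow₂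
  · exact le_trans (by gcongr) hlow₂
  · exact le_ofReal_mul_of_add_le hΩtop (by rwa [add_comm]) h2 h1 (by linarith) hε'1 hε'0 hε'₂
      hlow₁

end Paper
end
end

section
/- Let ν = Σ_{j=1}^J λ_j δ_{A_j} be a laminate of finite order on ℝ^{d×m} with barycenter A, where λ_j > 0 and A_j ≠ A_k for j ≠ k. Then for any b ∈ ℝ^d, any ε > 0 and any regular domain Ω ⊂ ℝ^m there exists a piecewise affine Lipschitz map u : Ω → ℝ^d with u = l_{A,b} on ∂Ω and ‖∇u‖_{L^∞(Ω)} ≤ max_j |A_j|, such that for each j = 1, …, J: (1−ε)λ_j|Ω| ≤ |{x ∈ Ω : ∇u(x) = A_j}| ≤ (1+ε)λ_j|Ω|. In particular |{x ∈ Ω : ∇u(x) ∉ supp ν}| ≤ ε|Ω|. -/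
open MeasureTheory Set Filter Topology

noncomputable section

namespace Paper

variable {ι κ : Type*}

instance : MeasurableSpace (Matrix κ ι ℝ) :=
  inferInstanceAs (MeasurableSpace (κ → ι → ℝ))

/-- Laminates of finite order: the smallest family of (probability) measures on matrix space
containing Dirac masses and closed under elementary splitting. -/
inductive IsLaminate [Fintype ι] [Fintype κ] : Measure (Matrix κ ι ℝ) → Prop
  | dirac (A : Matrix κ ι ℝ) : IsLaminate (Measure.dirac A)
  | split (lam lam' : ℝ) (A B B' : Matrix κ ι ℝ) (ν' : Measure (Matrix κ ι ℝ))
      (hlam : lam ∈ Set.Ioc (0:ℝ) 1) (hlam' : lam' ∈ Set.Ioo (0:ℝ) 1)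
      (hprob : IsProbabilityMeasure ν') (hrank : (B' - B).rank = 1)
      (hA : A = lam' • B + (1 - lam') • B')
      (hν : IsLaminate (ENNReal.ofReal lam • Measure.dirac A + ENNReal.ofReal (1 - lam) • ν')) :
      IsLaminate (ENNReal.ofReal lam •
          (ENNReal.ofReal lam' • Measure.dirac B + ENNReal.ofReal (1 - lam') • Measure.dirac B')
        + ENNReal.ofReal (1 - lam) • ν')

/-- Barycenter (center of mass) of a measure on matrix space, defined entrywise. -/
def barycenter [Fintype ι] [Fintype κ] (ν : Measure (Matrix κ ι ℝ)) : Matrix κ ι ℝ :=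
  Matrix.of fun k i => ∫ X, X k i ∂ν

/-- Staircase-laminate data for `K` with base `A`. -/
structure StaircaseData [Fintype ι] [Fintype κ]
    (K : Set (Matrix κ ι ℝ)) (A : Matrix κ ι ℝ) : Type _ where
  Aseq : ℕ → Matrix κ ι ℝ
  μseq : ℕ → Measure (Matrix κ ι ℝ)
  γseq : ℕ → ℝ
  base : Aseq 0 = A
  notMem : ∀ n, Aseq n ∉ K
  prob : ∀ n, 1 ≤ n → IsProbabilityMeasure (μseq n)
  suppK : ∀ n, 1 ≤ n → μseq n Kᶜ = 0
  γmem : ∀ n, 1 ≤ n → γseq n ∈ Set.Ioo (0:ℝ) 1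
  mono : Monotone fun n => frobNorm (Aseq n)
  norm_tendsto : Tendsto (fun n => frobNorm (Aseq n)) atTop atTop
  beta_tendsto : Tendsto (fun n => ∏ k ∈ Finset.range n, γseq (k + 1)) atTop (nhds 0)
  laminate : ∀ n, 1 ≤ n →
    IsLaminate (ENNReal.ofReal (1 - γseq n) • μseq n
      + ENNReal.ofReal (γseq n) • Measure.dirac (Aseq n))
  bary : ∀ n, 1 ≤ n →
    barycenter (ENNReal.ofReal (1 - γseq n) • μseq n
      + ENNReal.ofReal (γseq n) • Measure.dirac (Aseq n)) = Aseq (n - 1)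

variable [Fintype ι] [Fintype κ]

/-- `β_n = γ_1 ⋯ γ_n`. -/
def beta {K : Set (Matrix κ ι ℝ)} {A : Matrix κ ι ℝ} (D : StaircaseData K A) (n : ℕ) : ℝ :=
  ∏ k ∈ Finset.range n, D.γseq (k + 1)

/-- The finite-stage laminates `ν^N`. -/
def nuN {K : Set (Matrix κ ι ℝ)} {A : Matrix κ ι ℝ} (D : StaircaseData K A) (N : ℕ) :
    Measure (Matrix κ ι ℝ) :=
  (∑ n ∈ Finset.range N, ENNReal.ofReal (beta D n * (1 - D.γseq (n + 1))) • D.μseq (n + 1))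
    + ENNReal.ofReal (beta D N) • Measure.dirac (D.Aseq N)

/-- The associated staircase laminate `ν^∞`. -/
def nuInf {K : Set (Matrix κ ι ℝ)} {A : Matrix κ ι ℝ} (D : StaircaseData K A) :
    Measure (Matrix κ ι ℝ) :=
  Measure.sum fun n => ENNReal.ofReal (beta D n * (1 - D.γseq (n + 1))) • D.μseq (n + 1)

/-- A function that is affine, with slope in `K`, on each cell of a countable convex partition. -/
def HasAffinePieces (K : Set (ι → ℝ)) (w : (ι → ℝ) → ℝ) : Prop :=
  ∃ (σ : Type) (_ : Countable σ) (φ : (ι → ℝ) → σ), ∀ s, Convex ℝ (φ ⁻¹' {s}) ∧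
    ∃ (g : ι → ℝ) (c : ℝ), g ∈ K ∧ ∀ x ∈ φ ⁻¹' {s}, w x = g ⬝ᵥ x + c

/-- A countable family of disjoint regular domains filling `Ω` up to a null set. -/
def Tiles (𝒮 : Set (Set (ι → ℝ))) (Ω : Set (ι → ℝ)) : Prop :=
  𝒮.Countable ∧ (∀ V ∈ 𝒮, IsRegularDomain V ∧ V ⊆ Ω) ∧
    𝒮.PairwiseDisjoint id ∧ volume (Ω \ ⋃₀ 𝒮) = 0

theorem HasAffinePieces.of_affine {K : Set (ι → ℝ)} {g : ι → ℝ} (hg : g ∈ K) (c : ℝ) :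
    HasAffinePieces K fun x => g ⬝ᵥ x + c := by
  refine ⟨Unit, inferInstance, fun _ => (), fun s => ⟨?_, g, c, hg, fun x _ => rfl⟩⟩
  convert convex_univ (𝕜 := ℝ) (E := ι → ℝ)
  ext
  simp

theorem convex_setOf_dotProduct_add_le (g g' : ι → ℝ) (c c' : ℝ) :
    Convex ℝ {x : ι → ℝ | g ⬝ᵥ x + c ≤ g' ⬝ᵥ x + c'} := by
  intro x hx y hy a b ha hb hab
  simp only [mem_ofPred_eq, dotProduct_add, dotProduct_smul, smul_eq_mul] at *
  have hb' : b = 1 - a := by linarith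
  subst hb'
  nlinarith [mul_le_mul_of_nonneg_left hx ha, mul_le_mul_of_nonneg_left hy hb]

theorem convex_setOf_dotProduct_add_lt (g g' : ι → ℝ) (c c' : ℝ) :
    Convex ℝ {x : ι → ℝ | g ⬝ᵥ x + c < g' ⬝ᵥ x + c'} := by
  intro x hx y hy a b ha hb hab
  simp only [mem_ofPred_eq, dotProduct_add, dotProduct_smul, smul_eq_mul] at *
  have hb' : b = 1 - a := by linarith
  subst hb'
  rcases ha.eq_or_lt with rfl | ha
  · linarith
  · nlinarith [mul_lt_mul_of_pos_left hx ha, mul_le_mul_of_nonneg_left hy.le hb]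

theorem HasAffinePieces.ite_le {K : Set (ι → ℝ)} {w₁ w₂ w : (ι → ℝ) → ℝ}
    (h₁ : HasAffinePieces K w₁) (h₂ : HasAffinePieces K w₂)
    (h : (∀ x, w₁ x ≤ w₂ x → w x = w₁ x) ∧ (∀ x, ¬ w₁ x ≤ w₂ x → w x = w₂ x) ∨
      (∀ x, w₁ x ≤ w₂ x → w x = w₂ x) ∧ (∀ x, ¬ w₁ x ≤ w₂ x → w x = w₁ x)) :
    HasAffinePieces K w := by
  obtain ⟨σ₁, _, φ₁, H₁⟩ := h₁
  obtain ⟨σ₂, _, φ₂, H₂⟩ := h₂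
  refine ⟨σ₁ × σ₂ × Prop, inferInstance, fun x => (φ₁ x, φ₂ x, w₁ x ≤ w₂ x), ?_⟩
  rintro ⟨s₁, s₂, p⟩
  obtain ⟨hc₁, g₁, c₁, hg₁, e₁⟩ := H₁ s₁
  obtain ⟨hc₂, g₂, c₂, hg₂, e₂⟩ := H₂ s₂
  by_cases hp : p
  · have hset : (fun x => (φ₁ x, φ₂ x, w₁ x ≤ w₂ x)) ⁻¹' {(s₁, s₂, p)} =
        (φ₁ ⁻¹' {s₁} ∩ φ₂ ⁻¹' {s₂}) ∩ {x | g₁ ⬝ᵥ x + c₁ ≤ g₂ ⬝ᵥ x + c₂} := by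
      ext x
      simp only [mem_preimage, mem_singleton_iff, Prod.mk.injEq, mem_inter_iff, mem_ofPred_eq, hp,
        eq_iff_iff, iff_true, and_assoc]
      refine and_congr_right fun a => and_congr_right fun b => ?_
      rw [e₁ x a, e₂ x b]
    rw [hset]
    refine ⟨(hc₁.inter hc₂).inter (convex_setOf_dotProduct_add_le ..), ?_⟩
    rcases h with h | h
    · refine ⟨g₁, c₁, hg₁, fun x hx => ?_⟩
      rw [h.1 x (by rw [e₁ x hx.1.1, e₂ x hx.1.2]; exact hx.2), e₁ x hx.1.1]
    · refine ⟨g₂, c₂, hg₂, fun x hx => ?_⟩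
      rw [h.1 x (by rw [e₁ x hx.1.1, e₂ x hx.1.2]; exact hx.2), e₂ x hx.1.2]
  · have hset : (fun x => (φ₁ x, φ₂ x, w₁ x ≤ w₂ x)) ⁻¹' {(s₁, s₂, p)} =
        (φ₁ ⁻¹' {s₁} ∩ φ₂ ⁻¹' {s₂}) ∩ {x | g₂ ⬝ᵥ x + c₂ < g₁ ⬝ᵥ x + c₁} := by
      ext x
      simp only [mem_preimage, mem_singleton_iff, Prod.mk.injEq, mem_inter_iff, mem_ofPred_eq, hp,
        eq_iff_iff, iff_false, and_assoc, not_le]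
      refine and_congr_right fun a => and_congr_right fun b => ?_
      rw [e₁ x a, e₂ x b]
    rw [hset]
    refine ⟨(hc₁.inter hc₂).inter (convex_setOf_dotProduct_add_lt ..), ?_⟩
    rcases h with h | h
    · refine ⟨g₂, c₂, hg₂, fun x hx => ?_⟩
      rw [h.2 x (by rw [e₁ x hx.1.1, e₂ x hx.1.2]; exact not_le.2 hx.2), e₂ x hx.1.2]
    · refine ⟨g₁, c₁, hg₁, fun x hx => ?_⟩
      rw [h.2 x (by rw [e₁ x hx.1.1, e₂ x hx.1.2]; exact not_le.2 hx.2), e₁ x hx.1.1]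

theorem HasAffinePieces.sup {K : Set (ι → ℝ)} {w₁ w₂ : (ι → ℝ) → ℝ}
    (h₁ : HasAffinePieces K w₁) (h₂ : HasAffinePieces K w₂) : HasAffinePieces K (w₁ ⊔ w₂) :=
  h₁.ite_le h₂ <| .inr ⟨fun _ h => sup_of_le_right h, fun _ h => sup_of_le_left (not_le.1 h).le⟩

theorem HasAffinePieces.inf {K : Set (ι → ℝ)} {w₁ w₂ : (ι → ℝ) → ℝ}
    (h₁ : HasAffinePieces K w₁) (h₂ : HasAffinePieces K w₂) : HasAffinePieces K (w₁ ⊓ w₂) :=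
  h₁.ite_le h₂ <| .inl ⟨fun _ h => inf_of_le_left h, fun _ h => inf_of_le_right (not_le.1 h).le⟩

/-- Rescaled copy of `w`, with the same slopes. -/
def rescale (w : (ι → ℝ) → ℝ) (z : ι → ℝ) (r : ℝ) (x : ι → ℝ) : ℝ := r * w (r⁻¹ • (x - z))

theorem rescale_eq_of_affine {w : (ι → ℝ) → ℝ} {z x g : ι → ℝ} {r c : ℝ} (hr : 0 < r)
    (h : w (r⁻¹ • (x - z)) = g ⬝ᵥ (r⁻¹ • (x - z)) + c) :
    rescale w z r x = g ⬝ᵥ x + (r * c - g ⬝ᵥ z) := by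
  rw [rescale, h, dotProduct_smul, dotProduct_sub, smul_eq_mul]
  field_simp
  ring

theorem lipschitzWith_rescale {w : (ι → ℝ) → ℝ} {C : NNReal} (hw : LipschitzWith C w)
    (z : ι → ℝ) {r : ℝ} (hr : 0 < r) : LipschitzWith C (rescale w z r) := by
  refine LipschitzWith.of_dist_le_mul fun x y => ?_
  have h := hw.dist_le_mul (r⁻¹ • (x - z)) (r⁻¹ • (y - z))
  rw [dist_smul₀, dist_sub_right, Real.norm_of_nonneg (inv_pos.2 hr).le, Real.dist_eq] at h
  rw [Real.dist_eq, rescale, rescale, ← mul_sub, abs_mul, abs_of_pos hr]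
  calc r * |_| ≤ r * (C * (r⁻¹ * dist x y)) := by gcongr
    _ = C * dist x y := by field_simp

theorem HasAffinePieces.rescale {K : Set (ι → ℝ)} {w : (ι → ℝ) → ℝ} (h : HasAffinePieces K w)
    (z : ι → ℝ) {r : ℝ} (hr : 0 < r) : HasAffinePieces K (rescale w z r) := by
  obtain ⟨σ, _, φ, H⟩ := h
  refine ⟨σ, inferInstance, fun x => φ (r⁻¹ • (x - z)), fun s => ?_⟩
  obtain ⟨hc, g, c, hg, e⟩ := H s
  refine ⟨fun x hx y hy a b ha hb hab => ?_, g, _, hg, fun x hx => rescale_eq_of_affine hr (e _ hx)⟩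
  have := hc hx hy ha hb hab
  simp only [mem_preimage] at this ⊢
  convert this using 2
  obtain rfl : b = 1 - a := by linarith
  ext i
  simp only [Pi.smul_apply, Pi.sub_apply, Pi.add_apply, smul_eq_mul]
  ring

theorem isRegularDomain_of_convex {V : Set (ι → ℝ)} (ho : IsOpen V) (hc : Convex ℝ V)
    (hb : Bornology.IsBounded V) (hne : V.Nonempty) : IsRegularDomain V :=
  ⟨ho, hb, hc.isConnected hne, hc.addHaar_frontier _⟩

/-- On a bounded open convex set, a function with affine pieces admits a tiling by domains of
affinity. -/
theorem HasAffinePieces.exists_tiles {K : Set (ι → ℝ)} {w : (ι → ℝ) → ℝ}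
    (h : HasAffinePieces K w) {Q : Set (ι → ℝ)} (ho : IsOpen Q) (hc : Convex ℝ Q)
    (hb : Bornology.IsBounded Q) :
    ∃ 𝒯, Tiles 𝒯 Q ∧ ∀ T ∈ 𝒯, ∃ g ∈ K, ∃ c : ℝ, ∀ x ∈ T, w x = g ⬝ᵥ x + c := by
  obtain ⟨σ, _, φ, H⟩ := h
  refine ⟨{T | T.Nonempty ∧ T ∈ range fun s => Q ∩ interior (φ ⁻¹' {s})}, ⟨?_, ?_, ?_, ?_⟩, ?_⟩
  · exact (countable_range _).mono fun T hT => hT.2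
  · rintro _ ⟨hne, s, rfl⟩
    exact ⟨isRegularDomain_of_convex (ho.inter isOpen_interior) (hc.inter (H s).1.interior)
      (hb.subset inter_subset_left) hne, inter_subset_left⟩
  · rintro _ ⟨-, s, rfl⟩ _ ⟨-, s', rfl⟩ hne
    have hss : s ≠ s' := by rintro rfl; exact hne rfl
    refine Set.disjoint_left.2 fun x hx hx' => hss ?_
    have h1 : x ∈ φ ⁻¹' {s} := interior_subset hx.2
    have h2 : x ∈ φ ⁻¹' {s'} := interior_subset hx'.2
    exact (mem_singleton_iff.1 h1).symm.trans h2
  · refine measure_mono_null (t := ⋃ s, frontier (φ ⁻¹' {s})) ?_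
      (measure_iUnion_null fun s => (H s).1.addHaar_frontier _)
    rintro x ⟨hx, hx'⟩
    refine mem_iUnion.2 ⟨φ x, subset_closure rfl, fun hi => hx' ?_⟩
    exact ⟨Q ∩ interior (φ ⁻¹' {φ x}), ⟨⟨x, hx, hi⟩, φ x, rfl⟩, hx, hi⟩
  · rintro _ ⟨-, s, rfl⟩
    obtain ⟨-, g, c, hg, e⟩ := H s
    exact ⟨g, hg, c, fun x hx => e x (interior_subset hx.2)⟩

/-- Tilings of the tiles of a tiling make a tiling. -/
theorem Tiles.refine {𝒮 : Set (Set (ι → ℝ))} {Ω : Set (ι → ℝ)} (h : Tiles 𝒮 Ω)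
    {F : Set (ι → ℝ) → Set (Set (ι → ℝ))} (hF : ∀ V ∈ 𝒮, Tiles (F V) V) :
    Tiles (⋃ V ∈ 𝒮, F V) Ω := by
  obtain ⟨hc, hr, hd, hn⟩ := h
  refine ⟨hc.biUnion fun V hV => (hF V hV).1, ?_, ?_, ?_⟩
  · intro T hT
    obtain ⟨V, hV, hT⟩ := mem_iUnion₂.1 hT
    exact ⟨((hF V hV).2.1 T hT).1, ((hF V hV).2.1 T hT).2.trans (hr V hV).2⟩
  · intro T hT T' hT' hne
    obtain ⟨V, hV, hT⟩ := mem_iUnion₂.1 hT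
    obtain ⟨V', hV', hT'⟩ := mem_iUnion₂.1 hT'
    by_cases hVV : V = V'
    · subst hVV
      exact (hF V hV).2.2.1 hT hT' hne
    · exact (hd hV hV' hVV).mono ((hF V hV).2.1 T hT).2 ((hF V' hV').2.1 T' hT').2
  · refine measure_mono_null (t := (Ω \ ⋃₀ 𝒮) ∪ ⋃ V ∈ 𝒮, V \ ⋃₀ F V) ?_
      (measure_union_null hn ((measure_biUnion_null_iff hc).2 fun V hV => (hF V hV).2.2.2))
    rintro x ⟨hx, hx'⟩
    by_cases hxS : x ∈ ⋃₀ 𝒮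
    · obtain ⟨V, hV, hxV⟩ := hxS
      refine .inr (mem_iUnion₂.2 ⟨V, hV, hxV, ?_⟩)
      rintro ⟨T, hT, hxT⟩
      exact hx' ⟨T, mem_iUnion₂.2 ⟨V, hV, hT⟩, hxT⟩
    · exact .inl ⟨hx, hxS⟩

/-- The copy `z + r Q` of `Q`. -/
def scaled (Q : Set (ι → ℝ)) (a : (ι → ℝ) × ℝ) : Set (ι → ℝ) := {x | a.2⁻¹ • (x - a.1) ∈ Q}

theorem volume_scaled (Q : Set (ι → ℝ)) {a : (ι → ℝ) × ℝ} (ha : 0 < a.2) :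
    volume (scaled Q a) = ENNReal.ofReal (a.2 ^ Fintype.card ι) * volume Q := by
  have h : scaled Q a = (fun x => x - a.1) ⁻¹' ((fun x => a.2⁻¹ • x) ⁻¹' Q) := rfl
  simp only [sub_eq_add_neg] at h
  rw [h, measure_preimage_add_right, Measure.addHaar_preimage_smul _ (inv_pos.2 ha).ne']
  congr 2
  rw [Module.finrank_fintype_fun_eq_card, inv_pow, inv_inv, abs_of_pos (by positivity)]

omit [Fintype ι] in
theorem isOpen_scaled {Q : Set (ι → ℝ)} (hQ : IsOpen Q) (a : (ι → ℝ) × ℝ) :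
    IsOpen (scaled Q a) :=
  hQ.preimage (by fun_prop : Continuous fun x : ι → ℝ => a.2⁻¹ • (x - a.1))

omit [Fintype ι] in
theorem convex_scaled {Q : Set (ι → ℝ)} (hQ : Convex ℝ Q) (a : (ι → ℝ) × ℝ) :
    Convex ℝ (scaled Q a) := by
  intro x hx y hy s t hs ht hst
  have := hQ hx hy hs ht hst
  simp only [scaled, mem_ofPred_eq] at this ⊢
  convert this using 1
  obtain rfl : t = 1 - s := by linarith
  ext i
  simp only [Pi.smul_apply, Pi.sub_apply, Pi.add_apply, smul_eq_mul]
  ring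

theorem scaled_closedBall {a : (ι → ℝ) × ℝ} (ha : 0 < a.2) (R : ℝ) :
    scaled (Metric.closedBall 0 R) a = Metric.closedBall a.1 (a.2 * R) := by
  ext x
  simp only [scaled, mem_ofPred_eq, Metric.mem_closedBall, dist_eq_norm, sub_zero]
  rw [norm_smul, norm_inv, Real.norm_of_nonneg ha.le, inv_mul_le_iff₀ ha]

omit [Fintype ι] in
theorem scaled_mono {Q Q' : Set (ι → ℝ)} (h : Q ⊆ Q') (a : (ι → ℝ) × ℝ) :
    scaled Q a ⊆ scaled Q' a := fun _ hx => h hx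

/-- Almost every point of a union of open sets is covered by disjoint scaled copies of a given
convex body, each contained in one of the open sets. -/
theorem exists_scaled_covering {Q : Set (ι → ℝ)} (ho : IsOpen Q) (hc : Convex ℝ Q)
    (hb : Bornology.IsBounded Q) (hne : Q.Nonempty) {𝒮 : Set (Set (ι → ℝ))}
    (h𝒮 : ∀ V ∈ 𝒮, IsOpen V) :
    ∃ t : Set ((ι → ℝ) × ℝ), t.Countable ∧ (∀ a ∈ t, 0 < a.2 ∧ ∃ V ∈ 𝒮, scaled Q a ⊆ V) ∧
      t.PairwiseDisjoint (scaled Q) ∧ volume (⋃₀ 𝒮 \ ⋃ a ∈ t, scaled Q a) = 0 := by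
  obtain ⟨R, hR, hQR⟩ := hb.closure.subset_closedBall_lt 0 0
  have hQ0 : volume Q ≠ 0 := (ho.measure_pos volume hne).ne'
  have hQt : volume (closure Q) ≠ ⊤ := hb.closure.measure_lt_top.ne
  have hQc : volume (closure Q) ≠ 0 := fun h => hQ0 (measure_mono_null subset_closure h)
  let t₀ : Set ((ι → ℝ) × ℝ) := {a | 0 < a.2 ∧ ∃ V ∈ 𝒮, scaled (closure Q) a ⊆ V}
  have hball : volume (Metric.closedBall (0 : ι → ℝ) (3 * R)) ≠ ⊤ :=
    Metric.isBounded_closedBall.measure_lt_top.ne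
  have hcov : ∃ t ⊆ t₀, t.Countable ∧ t.PairwiseDisjoint (scaled (closure Q)) ∧
      volume (⋃₀ 𝒮 \ ⋃ a ∈ t, scaled (closure Q) a) = 0 := by
    refine Vitali.exists_disjoint_covering_ae volume (⋃₀ 𝒮) t₀
      (volume (Metric.closedBall (0 : ι → ℝ) (3 * R)) / volume (closure Q)).toNNReal
      (fun a => a.2 * R) Prod.fst (scaled (closure Q)) ?_ ?_ ?_ ?_ ?_
    · intro a ha
      rw [← scaled_closedBall ha.1]
      exact scaled_mono hQR a
    · intro a ha
      have h3 : 3 * (a.2 * R) = a.2 * (3 * R) := by ring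
      rw [h3, ← scaled_closedBall ha.1, volume_scaled _ ha.1, volume_scaled _ ha.1,
        ENNReal.coe_toNNReal (ENNReal.div_ne_top hball hQc), mul_left_comm,
        ENNReal.div_mul_cancel hQc hQt]
    · intro a ha
      obtain ⟨q, hq⟩ := hne
      refine ⟨a.1 + a.2 • q, interior_maximal (scaled_mono subset_closure a)
        (isOpen_scaled ho a) ?_⟩
      simp only [scaled, mem_ofPred_eq, add_sub_cancel_left]
      rwa [inv_smul_smul₀ ha.1.ne']
    · intro a _
      exact isClosed_closure.preimage (by fun_prop : Continuous fun x : ι → ℝ => a.2⁻¹ • (x - a.1))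
    · rintro x ⟨V, hV, hx⟩ ε hε
      obtain ⟨η, hη, hηV⟩ := Metric.nhds_basis_closedBall.mem_iff.1 ((h𝒮 V hV).mem_nhds hx)
      have hr : 0 < min (ε / R) (η / R) := by positivity
      refine ⟨(x, min (ε / R) (η / R)), ⟨hr, V, hV, ?_⟩, ?_, rfl⟩
      · refine (scaled_mono hQR _).trans ?_
        rw [scaled_closedBall hr]
        refine (Metric.closedBall_subset_closedBall ?_).trans hηV
        calc min (ε / R) (η / R) * R ≤ η / R * R := by gcongr; exact min_le_right _ _
          _ = η := by field_simp
      · calc min (ε / R) (η / R) * R ≤ ε / R * R := by gcongr; exact min_le_left _ _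
          _ = ε := by field_simp
  obtain ⟨t, htt, htc, htd, htn⟩ := hcov
  refine ⟨t, htc, fun a ha => ?_, ?_, ?_⟩
  · obtain ⟨h0, V, hV, hs⟩ := htt ha
    exact ⟨h0, V, hV, (scaled_mono subset_closure a).trans hs⟩
  · exact htd.mono fun a => scaled_mono subset_closure a
  · refine measure_mono_null (t := (⋃₀ 𝒮 \ ⋃ a ∈ t, scaled (closure Q) a) ∪
      ⋃ a ∈ t, scaled (frontier Q) a) ?_ (measure_union_null htn
        ((measure_biUnion_null_iff htc).2 fun a ha => ?_))
    · rintro x ⟨hx, hx'⟩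
      by_cases hxt : x ∈ ⋃ a ∈ t, scaled (closure Q) a
      · obtain ⟨a, ha, hxa⟩ := mem_iUnion₂.1 hxt
        refine .inr (mem_iUnion₂.2 ⟨a, ha, hxa, fun hi => hx' (mem_iUnion₂.2 ⟨a, ha, ?_⟩)⟩)
        rwa [ho.interior_eq] at hi
      · exact .inl ⟨hx, hxt⟩
    · rw [volume_scaled _ (htt ha).1, hc.addHaar_frontier volume, mul_zero]

/-- Uniformly Lipschitz functions with disjoint supports can be glued. -/
theorem exists_lipschitz_glue {α : Type*} {t : Set α} {B : α → Set (ι → ℝ)}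
    (hd : t.PairwiseDisjoint B) {f : α → (ι → ℝ) → ℝ} {C : NNReal}
    (hf : ∀ a ∈ t, LipschitzWith C (f a)) (hz : ∀ a ∈ t, ∀ x ∉ B a, f a x = 0) :
    ∃ h : (ι → ℝ) → ℝ, LipschitzWith (2 * C) h ∧ (∀ a ∈ t, ∀ x ∈ B a, h x = f a x) ∧
      ∀ x, x ∉ ⋃ a ∈ t, B a → h x = 0 := by
  have key : ∀ a ∈ t, ∀ x ∈ B a, (∑' b : t, f b x) = f a x := fun a ha x hx =>
    tsum_eq_single (⟨a, ha⟩ : t) fun b hb => hz b b.2 x fun hxb =>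
      Set.disjoint_left.1 (hd b.2 ha fun h => hb (Subtype.ext h)) hxb hx
  have key0 : ∀ x, x ∉ ⋃ a ∈ t, B a → (∑' b : t, f b x) = 0 := fun x hx => by
    convert tsum_zero with b
    exact hz b b.2 x fun hxb => hx (mem_iUnion₂.2 ⟨b, b.2, hxb⟩)
  have bound : ∀ a ∈ t, ∀ x y, y ∉ B a → |f a x| ≤ C * dist x y := fun a ha x y hy => by
    simpa [hz a ha y hy] using (hf a ha).dist_le_mul x y
  refine ⟨fun x => ∑' b : t, f b x, LipschitzWith.of_dist_le_mul fun x y => ?_, key, key0⟩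
  have hC : (C : ℝ) * dist x y ≤ 2 * C * dist x y := by
    nlinarith [mul_nonneg C.coe_nonneg (dist_nonneg (x := x) (y := y))]
  simp only [NNReal.coe_mul, NNReal.coe_ofNat]
  by_cases hx : x ∈ ⋃ a ∈ t, B a <;> by_cases hy : y ∈ ⋃ a ∈ t, B a
  · obtain ⟨a, ha, hxa⟩ := mem_iUnion₂.1 hx
    obtain ⟨b, hb, hyb⟩ := mem_iUnion₂.1 hy
    rw [key a ha x hxa, key b hb y hyb]
    by_cases hab : a = b
    · subst hab
      exact ((hf a ha).dist_le_mul x y).trans hC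
    · have h1 := bound a ha x y fun h => Set.disjoint_left.1 (hd ha hb hab) h hyb
      have h2 := bound b hb y x fun h => Set.disjoint_left.1 (hd ha hb hab) hxa h
      rw [dist_comm y x] at h2
      rw [Real.dist_eq]
      linarith [abs_sub (f a x) (f b y)]
  · obtain ⟨a, ha, hxa⟩ := mem_iUnion₂.1 hx
    rw [key a ha x hxa, key0 y hy, dist_zero_right]
    exact (bound a ha x y fun h => hy (mem_iUnion₂.2 ⟨a, ha, h⟩)).trans hC
  · obtain ⟨b, hb, hyb⟩ := mem_iUnion₂.1 hy
    rw [key b hb y hyb, key0 x hx, dist_zero_left]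
    have := bound b hb y x fun h => hx (mem_iUnion₂.2 ⟨b, hb, h⟩)
    rw [dist_comm y x] at this
    exact this.trans hC
  · rw [key0 x hx, key0 y hy, dist_self]
    positivity

/-- A Lipschitz function with slopes in `K` that is supported in a bounded open convex set `Q`. -/
structure IsBlock (K : Set (ι → ℝ)) (w : (ι → ℝ) → ℝ) (Q : Set (ι → ℝ)) : Prop where
  isOpen : IsOpen Q
  convex : Convex ℝ Q
  isBounded : Bornology.IsBounded Q
  nonempty : Q.Nonempty
  lipschitz : ∃ C, LipschitzWith C w
  affinePieces : HasAffinePieces K w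
  eq_zero : ∀ x ∉ Q, w x = 0

/-- `w` has slope `g` on at least the fraction `p` of `Q`. -/
def HasSlopeFraction (w : (ι → ℝ) → ℝ) (Q : Set (ι → ℝ)) (g : ι → ℝ) (p : ℝ) : Prop :=
  ∃ Q' ⊆ Q, IsOpen Q' ∧ (∃ c : ℝ, ∀ x ∈ Q', w x = g ⬝ᵥ x + c) ∧
    ENNReal.ofReal p * volume Q ≤ volume Q'

omit [Fintype ι] in
theorem scaled_nonempty {Q : Set (ι → ℝ)} (hQ : Q.Nonempty) {a : (ι → ℝ) × ℝ} (ha : 0 < a.2) :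
    (scaled Q a).Nonempty := by
  obtain ⟨q, hq⟩ := hQ
  refine ⟨a.1 + a.2 • q, ?_⟩
  simp only [scaled, mem_ofPred_eq, add_sub_cancel_left]
  rwa [inv_smul_smul₀ ha.ne']

theorem isBounded_scaled {Q : Set (ι → ℝ)} (hQ : Bornology.IsBounded Q) {a : (ι → ℝ) × ℝ}
    (ha : 0 < a.2) : Bornology.IsBounded (scaled Q a) := by
  obtain ⟨R, hR⟩ := hQ.subset_closedBall 0
  have h := scaled_mono hR a
  rw [scaled_closedBall ha] at h
  exact Metric.isBounded_closedBall.subset h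

/-- The block construction transplanted to a countable union of open sets: slopes stay in `K`,
and slope fractions are preserved. -/
theorem IsBlock.exists_fill {K : Set (ι → ℝ)} {w : (ι → ℝ) → ℝ} {Q : Set (ι → ℝ)}
    (hB : IsBlock K w Q) {𝒮 : Set (Set (ι → ℝ))} (h𝒮 : ∀ V ∈ 𝒮, IsOpen V) :
    ∃ h : (ι → ℝ) → ℝ, (∃ C, LipschitzWith C h) ∧ (∀ x ∉ ⋃₀ 𝒮, h x = 0) ∧
      (∃ 𝒯, Tiles 𝒯 (⋃₀ 𝒮) ∧ ∀ T ∈ 𝒯, (∃ V ∈ 𝒮, T ⊆ V) ∧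
        ∃ g ∈ K, ∃ c : ℝ, ∀ x ∈ T, h x = g ⬝ᵥ x + c) ∧
      ∀ g p, HasSlopeFraction w Q g p → ∃ W ⊆ ⋃₀ 𝒮, IsOpen W ∧
        (∀ x ∈ W, ∃ c : ℝ, ∀ᶠ y in 𝓝 x, h y = g ⬝ᵥ y + c) ∧
        ENNReal.ofReal p * volume (⋃₀ 𝒮) ≤ volume W := by
  obtain ⟨t, htc, ht, htd, htn⟩ :=
    exists_scaled_covering hB.isOpen hB.convex hB.isBounded hB.nonempty h𝒮
  obtain ⟨C, hC⟩ := hB.lipschitz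
  obtain ⟨h, hh, hin, hout⟩ := exists_lipschitz_glue htd (f := fun a => rescale w a.1 a.2)
    (fun a ha => lipschitzWith_rescale hC a.1 (ht a ha).1)
    (fun a ha x hx => by simp only [rescale]; rw [hB.eq_zero _ hx, mul_zero])
  have hsub : ∀ a ∈ t, scaled Q a ⊆ ⋃₀ 𝒮 := fun a ha => by
    obtain ⟨V, hV, hs⟩ := (ht a ha).2
    exact hs.trans (subset_sUnion_of_mem hV)
  have hboxes : Tiles (scaled Q '' t) (⋃₀ 𝒮) := by
    refine ⟨htc.image _, ?_, ?_, ?_⟩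
    · rintro _ ⟨a, ha, rfl⟩
      exact ⟨isRegularDomain_of_convex (isOpen_scaled hB.isOpen a) (convex_scaled hB.convex a)
        (isBounded_scaled hB.isBounded (ht a ha).1) (scaled_nonempty hB.nonempty (ht a ha).1),
        hsub a ha⟩
    · rintro _ ⟨a, ha, rfl⟩ _ ⟨b, hb, rfl⟩ hne
      exact htd ha hb fun h => hne (h ▸ rfl)
    · rwa [sUnion_image]
  have hpieces : ∀ B ∈ scaled Q '' t, ∃ 𝒯, Tiles 𝒯 B ∧
      ∀ T ∈ 𝒯, ∃ g ∈ K, ∃ c : ℝ, ∀ x ∈ T, h x = g ⬝ᵥ x + c := by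
    rintro _ ⟨a, ha, rfl⟩
    obtain ⟨𝒯, h𝒯, H⟩ := (hB.affinePieces.rescale a.1 (ht a ha).1).exists_tiles
      (isOpen_scaled hB.isOpen a) (convex_scaled hB.convex a)
      (isBounded_scaled hB.isBounded (ht a ha).1)
    refine ⟨𝒯, h𝒯, fun T hT => ?_⟩
    obtain ⟨g, hg, c, e⟩ := H T hT
    exact ⟨g, hg, c, fun x hx => by rw [hin a ha x ((h𝒯.2.1 T hT).2 hx), e x hx]⟩
  choose! F hF using hpieces
  refine ⟨h, ⟨_, hh⟩, fun x hx => hout x fun hx' => ?_, ⟨_, hboxes.refine fun B hB => (hF B hB).1,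
    fun T hT => ?_⟩, ?_⟩
  · obtain ⟨a, ha, hxa⟩ := mem_iUnion₂.1 hx'
    exact hx (hsub a ha hxa)
  · obtain ⟨B, hBt, hT⟩ := mem_iUnion₂.1 hT
    refine ⟨?_, (hF B hBt).2 T hT⟩
    have hTB := ((hF B hBt).1.2.1 T hT).2
    obtain ⟨a, ha, rfl⟩ := hBt
    obtain ⟨V, hV, hs⟩ := (ht a ha).2
    exact ⟨V, hV, hTB.trans hs⟩
  · rintro g p ⟨Q', hQ', hQo, ⟨c, hc⟩, hp⟩
    refine ⟨⋃ a ∈ t, scaled Q' a, iUnion₂_subset fun a ha => (scaled_mono hQ' a).trans (hsub a ha),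
      isOpen_biUnion fun a _ => isOpen_scaled hQo a, fun x hx => ?_, ?_⟩
    · obtain ⟨a, ha, hxa⟩ := mem_iUnion₂.1 hx
      refine ⟨a.2 * c - g ⬝ᵥ a.1, ?_⟩
      filter_upwards [(isOpen_scaled hQo a).mem_nhds hxa] with y hy
      rw [hin a ha y (scaled_mono hQ' a hy)]
      exact rescale_eq_of_affine (ht a ha).1 (hc _ hy)
    · have hle : volume (⋃₀ 𝒮) ≤ volume (⋃ a ∈ t, scaled Q a) := by
        refine measure_mono_ae (ae_le_set.2 htn)
      refine (mul_le_mul_right hle _).trans ?_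
      rw [measure_biUnion htc htd fun a _ => (isOpen_scaled hB.isOpen a).measurableSet,
        measure_biUnion htc (htd.mono fun a => scaled_mono hQ' a)
          fun a _ => (isOpen_scaled hQo a).measurableSet, ← ENNReal.tsum_mul_left]
      refine ENNReal.tsum_le_tsum fun a => ?_
      rw [volume_scaled _ (ht a a.2).1, volume_scaled _ (ht a a.2).1, mul_left_comm]
      gcongr

theorem exists_lipschitzWith_dotProduct_add (g : ι → ℝ) (c : ℝ) :
    ∃ C, LipschitzWith C fun x : ι → ℝ => g ⬝ᵥ x + c := by
  refine ⟨∑ i, ‖g i‖₊, LipschitzWith.of_dist_le_mul fun x y => ?_⟩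
  rw [dist_add_right, dist_eq_norm, ← dotProduct_sub, dist_eq_norm, NNReal.coe_sum, Finset.sum_mul]
  refine (norm_sum_le _ _).trans (Finset.sum_le_sum fun i _ => ?_)
  rw [norm_mul, coe_nnnorm]
  gcongr
  exact norm_le_pi_norm (x - y) i

/-- A nonzero linear functional can be made one of the coordinates. -/
theorem exists_linearEquiv_coordinate [DecidableEq ι] {n : ι → ℝ} (hn : n ≠ 0) :
    ∃ (i₀ : ι) (L : (ι → ℝ) ≃ₗ[ℝ] (ι → ℝ)), ∀ x i, L x i = if i = i₀ then n ⬝ᵥ x else x i := by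
  obtain ⟨i₀, hi₀⟩ := Function.ne_iff.1 hn
  let f : (ι → ℝ) →ₗ[ℝ] (ι → ℝ) :=
    { toFun := fun x i => if i = i₀ then n ⬝ᵥ x else x i
      map_add' := fun x y => by
        ext i
        by_cases h : i = i₀ <;> simp [h, dotProduct_add]
      map_smul' := fun r x => by
        ext i
        by_cases h : i = i₀ <;> simp [h, dotProduct_smul] }
  have hf : ∀ x i, f x i = if i = i₀ then n ⬝ᵥ x else x i := fun _ _ => rfl
  have hinj : Function.Injective f := by
    rw [injective_iff_map_eq_zero]
    intro x hx
    have h : ∀ i, i ≠ i₀ → x i = 0 := fun i hi => by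
      have := congrFun hx i
      rwa [hf, if_neg hi] at this
    have h0 : n ⬝ᵥ x = 0 := by
      have := congrFun hx i₀
      rwa [hf, if_pos rfl] at this
    rw [dotProduct, Finset.sum_eq_single i₀ (fun i _ hi => by rw [h i hi, mul_zero])
      (by simp)] at h0
    ext i
    by_cases hi : i = i₀
    · subst hi
      exact (mul_eq_zero.1 h0).resolve_left hi₀
    · exact h i hi
  exact ⟨i₀, LinearEquiv.ofInjectiveEndo f hinj, hf⟩

/-- The box `α < n ⬝ x < β`, `|x i| < r` for `i ≠ i₀`. -/
def slab (n : ι → ℝ) (i₀ : ι) (α β r : ℝ) : Set (ι → ℝ) :=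
  {x | (α < n ⬝ᵥ x ∧ n ⬝ᵥ x < β) ∧ ∀ i ≠ i₀, |x i| < r}

theorem slab_eq_preimage [DecidableEq ι] {n : ι → ℝ} {i₀ : ι} {L : (ι → ℝ) ≃ₗ[ℝ] (ι → ℝ)}
    (hL : ∀ x i, L x i = if i = i₀ then n ⬝ᵥ x else x i) (α β r : ℝ) :
    slab n i₀ α β r = L ⁻¹' univ.pi fun i => if i = i₀ then Ioo α β else Ioo (-r) r := by
  ext x
  simp only [slab, mem_ofPred_eq, mem_preimage, mem_univ_pi, hL]
  constructor
  · rintro ⟨h0, h⟩ i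
    by_cases hi : i = i₀
    · simpa [hi] using h0
    · simpa [hi, abs_lt] using h i hi
  · intro h
    refine ⟨by simpa using h i₀, fun i hi => ?_⟩
    simpa [hi, abs_lt] using h i

theorem isOpen_slab (n : ι → ℝ) (i₀ : ι) (α β r : ℝ) : IsOpen (slab n i₀ α β r) := by
  classical
  have h : slab n i₀ α β r = {x | α < n ⬝ᵥ x} ∩ {x | n ⬝ᵥ x < β} ∩
      ⋂ i, {x : ι → ℝ | i ≠ i₀ → |x i| < r} := by
    ext x
    simp [slab, and_assoc]
  have hc : Continuous fun x : ι → ℝ => n ⬝ᵥ x := by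
    simp only [dotProduct]
    fun_prop
  rw [h]
  refine ((isOpen_lt continuous_const hc).inter (isOpen_lt hc continuous_const)).inter
    (isOpen_iInter_of_finite fun i => ?_)
  by_cases hi : i = i₀
  · simp [hi]
  · simp only [ne_eq, hi, not_false_eq_true, forall_const]
    exact isOpen_lt (by fun_prop) continuous_const

theorem convex_slab (n : ι → ℝ) (i₀ : ι) (α β r : ℝ) : Convex ℝ (slab n i₀ α β r) := by
  have h : slab n i₀ α β r = {x | (0 : ι → ℝ) ⬝ᵥ x + α < n ⬝ᵥ x + 0} ∩
      {x | n ⬝ᵥ x + 0 < (0 : ι → ℝ) ⬝ᵥ x + β} ∩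
      ⋂ i, ⋂ _ : i ≠ i₀, (fun x : ι → ℝ => x i) ⁻¹' Ioo (-r) r := by
    ext x
    simp [slab, and_assoc, abs_lt]
  rw [h]
  refine ((convex_setOf_dotProduct_add_lt ..).inter (convex_setOf_dotProduct_add_lt ..)).inter
    (convex_iInter fun i => convex_iInter fun _ => ?_)
  exact (convex_Ioo (-r) r).linear_preimage (LinearMap.proj (R := ℝ) (φ := fun _ : ι => ℝ) i)

theorem volume_slab {n : ι → ℝ} (hn : n ≠ 0) : ∃ i₀ : ι, ∃ c : ENNReal, ∀ α β r : ℝ, 0 ≤ r →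
    Bornology.IsBounded (slab n i₀ α β r) ∧
    (α < β → 0 < r → (slab n i₀ α β r).Nonempty) ∧
    volume (slab n i₀ α β r) = c * ENNReal.ofReal ((2 * r) ^ (Fintype.card ι - 1) * (β - α)) := by
  classical
  obtain ⟨i₀, L, hL⟩ := exists_linearEquiv_coordinate hn
  refine ⟨i₀, ENNReal.ofReal |LinearMap.det (L.symm : (ι → ℝ) →ₗ[ℝ] (ι → ℝ))|, 
    fun α β r hr => ⟨?_, fun hαβ hr => ?_, ?_⟩⟩
  · rw [slab_eq_preimage hL, ← LinearEquiv.image_symm_eq_preimage]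
    refine (L.symm.toContinuousLinearEquiv.lipschitz).isBounded_image
      (Bornology.IsBounded.pi fun i => ?_)
    split_ifs
    exacts [Metric.isBounded_Ioo _ _, Metric.isBounded_Ioo _ _]
  · rw [slab_eq_preimage hL]
    refine Set.Nonempty.preimage ?_ L.surjective
    refine univ_pi_nonempty_iff.2 fun i => ?_
    split_ifs
    exacts [nonempty_Ioo.2 hαβ, nonempty_Ioo.2 (by linarith)]
  · rw [slab_eq_preimage hL, Measure.addHaar_preimage_linearEquiv, volume_pi_pi]
    congr 1
    rw [← Finset.prod_erase_mul _ _ (Finset.mem_univ i₀),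
      Finset.prod_congr (g := fun _ => ENNReal.ofReal (2 * r)) rfl fun i hi => by
        rw [if_neg (Finset.ne_of_mem_erase hi), Real.volume_Ioo]; congr 1; ring,
      if_pos rfl, Real.volume_Ioo, Finset.prod_const, Finset.card_erase_of_mem (Finset.mem_univ _),
      Finset.card_univ, ← ENNReal.ofReal_pow (by positivity),
      ← ENNReal.ofReal_mul (by positivity)]

theorem HasAffinePieces.finset_sup' {K : Set (ι → ℝ)} {α : Type*} {s : Finset α} (hs : s.Nonempty)
    {f : α → (ι → ℝ) → ℝ}
    (h : ∀ i ∈ s, (∃ C, LipschitzWith C (f i)) ∧ HasAffinePieces K (f i)) :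
    (∃ C, LipschitzWith C (s.sup' hs f)) ∧ HasAffinePieces K (s.sup' hs f) := by
  refine Finset.sup'_induction hs f
    (p := fun w => (∃ C, LipschitzWith C w) ∧ HasAffinePieces K w) ?_ h
  rintro w₁ ⟨⟨C₁, h₁⟩, p₁⟩ w₂ ⟨⟨C₂, h₂⟩, p₂⟩
  exact ⟨⟨_, h₁.max h₂⟩, p₁.sup p₂⟩

/-- A one-dimensional sawtooth in direction `n`, cut off with small slopes in the transversal
directions. -/
theorem exists_block {K : Set (ι → ℝ)} (hK : K ∈ 𝓝 0) {n : ι → ℝ} (hn : n ≠ 0) {l θ ε : ℝ}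
    (hl : l ∈ Ioo (0 : ℝ) 1) (hθ : θ ∈ Ioc (0 : ℝ) 1) (hε : ε ∈ Ioc (0 : ℝ) 1)
    (hK₁ : (-(1 - l)) • n ∈ K) (hK₂ : l • n ∈ K) :
    ∃ w Q, IsBlock K w Q ∧ HasSlopeFraction w Q ((-(1 - l)) • n) ((1 - ε) * (θ * l)) ∧
      HasSlopeFraction w Q (l • n) ((1 - ε) * (θ * (1 - l))) ∧
      HasSlopeFraction w Q 0 ((1 - ε) * (1 - θ)) := by
  classical
  obtain ⟨i₀, V, hV⟩ := volume_slab hn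
  obtain ⟨δ, hδ, hδK⟩ := Metric.nhds_basis_closedBall.mem_iff.1 hK
  obtain ⟨hl0, hl1⟩ := hl
  obtain ⟨hθ0, hθ1⟩ := hθ
  obtain ⟨hε0, hε1⟩ := hε
  set k := Fintype.card ι - 1 with hk
  set R : ℝ := (k + 1) / (δ * ε) with hRdef
  have hR : 0 < R := by positivity
  set τ : ℝ := ε / (k + 1) with hτdef
  have hτ1 : τ ≤ 1 := by
    rw [hτdef, div_le_one (by positivity)]
    linarith [(Nat.cast_nonneg k : (0 : ℝ) ≤ k)]
  have hτ0 : 0 < τ := by positivity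
  set r : ℝ := R * (1 - τ) with hrdef
  have hr : 0 ≤ r := mul_nonneg hR.le (by linarith)
  have hrR : r ≤ R := by nlinarith
  have hδr : δ * (r - R) = -1 := by
    rw [hrdef, hRdef, hτdef]
    field_simp
    ring
  have hpow : (1 - ε) * (2 * R) ^ k ≤ (2 * r) ^ k := by
    have h1 : 1 - ε ≤ (1 - τ) ^ k := by
      have := one_add_mul_le_pow (a := -τ) (by linarith) k
      have h2 : (k : ℝ) * τ ≤ ε := by
        rw [hτdef, mul_div_assoc', div_le_iff₀ (by positivity)]
        nlinarith
      rw [sub_eq_add_neg 1 τ]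
      linarith
    calc (1 - ε) * (2 * R) ^ k ≤ (1 - τ) ^ k * (2 * R) ^ k := by gcongr
      _ = (2 * r) ^ k := by rw [← mul_pow, hrdef]; ring
  let f : ι → (ι → ℝ) → ℝ := fun i =>
    if i = i₀ then (fun x => ((-(1 - l)) • n) ⬝ᵥ x + 0) ⊔ (fun x => (l • n) ⬝ᵥ x + -(l * θ))
    else (fun x => (δ • Pi.single i (1 : ℝ) : ι → ℝ) ⬝ᵥ x + -(δ * R)) ⊔
      (fun x => (-(δ • Pi.single i (1 : ℝ) : ι → ℝ)) ⬝ᵥ x + -(δ * R))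
  have hne : (Finset.univ : Finset ι).Nonempty := ⟨i₀, Finset.mem_univ _⟩
  have hf₀ : ∀ x, f i₀ x = max (-(1 - l) * (n ⬝ᵥ x)) (l * (n ⬝ᵥ x - θ)) := fun x => by
    simp only [f, if_true, Pi.sup_apply, smul_dotProduct, smul_eq_mul, add_zero]
    congr 1
    ring
  have hf₁ : ∀ i ≠ i₀, ∀ x, f i x = δ * (|x i| - R) := fun i hi x => by
    simp only [f, if_neg hi, Pi.sup_apply, smul_dotProduct, smul_eq_mul, neg_dotProduct,
      single_one_dotProduct]
    rw [max_add_add_right, mul_sub, ← sub_eq_add_neg, ← mul_neg, ← mul_max_of_nonneg _ _ hδ.le]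
    rfl
  have hfK : ∀ i ∈ Finset.univ, (∃ C, LipschitzWith C (f i)) ∧ HasAffinePieces K (f i) := by
    intro i _
    by_cases hi : i = i₀
    · obtain ⟨C₁, h₁⟩ := exists_lipschitzWith_dotProduct_add ((-(1 - l)) • n) 0
      obtain ⟨C₂, h₂⟩ := exists_lipschitzWith_dotProduct_add (l • n) (-(l * θ))
      simp only [f, if_pos hi]
      exact ⟨⟨_, h₁.max h₂⟩, (HasAffinePieces.of_affine hK₁ _).sup (.of_affine hK₂ _)⟩
    · obtain ⟨C₁, h₁⟩ := exists_lipschitzWith_dotProduct_add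
        (δ • Pi.single i (1 : ℝ) : ι → ℝ) (-(δ * R))
      obtain ⟨C₂, h₂⟩ := exists_lipschitzWith_dotProduct_add
        (-(δ • Pi.single i (1 : ℝ) : ι → ℝ)) (-(δ * R))
      simp only [f, if_neg hi]
      refine ⟨⟨_, h₁.max h₂⟩,
        (HasAffinePieces.of_affine (hδK ?_) _).sup (.of_affine (hδK ?_) _)⟩ <;>
      simp [norm_smul, abs_of_pos hδ, Pi.norm_single]
  obtain ⟨⟨C, hC⟩, hpieces⟩ := HasAffinePieces.finset_sup' hne hfK
  obtain ⟨C₀, hC₀⟩ := exists_lipschitzWith_dotProduct_add (0 : ι → ℝ) 0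
  set w : (ι → ℝ) → ℝ := (fun x => (0 : ι → ℝ) ⬝ᵥ x + 0) ⊓ Finset.univ.sup' hne f with hw
  have hw_apply : ∀ x, w x = min 0 (Finset.univ.sup' hne fun i => f i x) := fun x => by
    simp [hw, Finset.sup'_apply]
  have hw_zero : ∀ x i, 0 ≤ f i x → w x = 0 := fun x i hi => by
    rw [hw_apply]
    exact min_eq_left (hi.trans (Finset.le_sup' (fun i => f i x) (Finset.mem_univ i)))
  have hw_eq : ∀ x, f i₀ x ≤ 0 → (∀ i ≠ i₀, |x i| < r) → n ⬝ᵥ x ≤ 1 → w x = f i₀ x := by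
    intro x h0 hx h1
    rw [hw_apply]
    have hge : -1 ≤ f i₀ x := by
      rw [hf₀]
      refine le_max_of_le_left ?_
      rcases le_total (n ⬝ᵥ x) 0 with h | h <;>
        nlinarith [mul_nonneg (sub_nonneg.2 hl1.le) (sub_nonneg.2 h),
          mul_nonneg hl0.le (sub_nonneg.2 h)]
    have : (Finset.univ.sup' hne fun i => f i x) = f i₀ x := by
      refine le_antisymm (Finset.sup'_le _ _ fun i _ => ?_)
        (Finset.le_sup' (fun i => f i x) (Finset.mem_univ i₀))
      by_cases hi : i = i₀
      · rw [hi]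
      · rw [hf₁ i hi]
        nlinarith [hx i hi]
    rw [this, min_eq_right h0]
  have hslope : ∀ (g : ι → ℝ) (α β c : ℝ), 0 ≤ α → α ≤ β → β ≤ 1 →
      (∀ x ∈ slab n i₀ α β r, w x = g ⬝ᵥ x + c) →
      HasSlopeFraction w (slab n i₀ 0 1 R) g ((1 - ε) * (β - α)) := by
    intro g α β c h0 hαβ h1 hg
    refine ⟨slab n i₀ α β r, fun x hx => ⟨⟨h0.trans_lt hx.1.1, hx.1.2.trans_le h1⟩,
      fun i hi => (hx.2 i hi).trans_le hrR⟩, isOpen_slab .., ⟨c, hg⟩, ?_⟩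
    rw [(hV 0 1 R hR.le).2.2, (hV α β r hr).2.2, mul_left_comm,
      ← ENNReal.ofReal_mul (mul_nonneg (by linarith) (by linarith))]
    refine mul_le_mul_right (ENNReal.ofReal_le_ofReal ?_) _
    nlinarith [mul_le_mul_of_nonneg_right hpow (sub_nonneg.2 hαβ)]
  refine ⟨w, slab n i₀ 0 1 R, ⟨isOpen_slab .., convex_slab .., (hV 0 1 R hR.le).1,
    (hV 0 1 R hR.le).2.1 one_pos hR, ⟨_, hC₀.min hC⟩,
    (HasAffinePieces.of_affine (mem_of_mem_nhds hK) 0).inf hpieces, fun x hx => ?_⟩, ?_, ?_, ?_⟩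
  · by_cases hn0 : n ⬝ᵥ x ≤ 0
    · exact hw_zero x i₀ (by rw [hf₀]; exact le_max_of_le_left (by nlinarith))
    by_cases hn1 : 1 ≤ n ⬝ᵥ x
    · exact hw_zero x i₀ (by rw [hf₀]; exact le_max_of_le_right (by nlinarith))
    have : ∃ i ≠ i₀, R ≤ |x i| := by
      by_contra! h
      exact hx ⟨⟨not_le.1 hn0, not_le.1 hn1⟩, h⟩
    obtain ⟨i, hi, hxi⟩ := this
    exact hw_zero x i (by rw [hf₁ i hi]; nlinarith)
  · have := hslope ((-(1 - l)) • n) 0 (θ * l) 0 le_rfl (by positivity) (by nlinarith) ?_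
    · rwa [sub_zero] at this
    rintro x ⟨⟨h0, h1⟩, hx⟩
    have hfx : f i₀ x = -(1 - l) * (n ⬝ᵥ x) := by
      rw [hf₀]
      exact max_eq_left (by nlinarith)
    rw [hw_eq x (by rw [hfx]; nlinarith) hx (by nlinarith), hfx, smul_dotProduct, smul_eq_mul,
      add_zero]
  · have := hslope (l • n) (θ * l) θ (-(l * θ)) (by positivity) (by nlinarith) hθ1 ?_
    · rwa [show θ * (1 - l) = θ - θ * l by ring]
    rintro x ⟨⟨h0, h1⟩, hx⟩
    have hfx : f i₀ x = l * (n ⬝ᵥ x - θ) := by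
      rw [hf₀]
      exact max_eq_right (by nlinarith)
    rw [hw_eq x (by rw [hfx]; nlinarith) hx (by linarith), hfx, smul_dotProduct, smul_eq_mul]
    ring
  · refine hslope 0 θ 1 0 hθ0.le hθ1 le_rfl ?_
    rintro x ⟨⟨h0, h1⟩, hx⟩
    rw [zero_dotProduct, add_zero]
    exact hw_zero x i₀ (by rw [hf₀]; exact le_max_of_le_right (by nlinarith))

instance : MeasurableSingletonClass (Matrix κ ι ℝ) :=
  inferInstanceAs (MeasurableSingletonClass (κ → ι → ℝ))

/-- The Jacobian matrix of `u` at `x`. -/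
def grad [DecidableEq ι] (u : (ι → ℝ) → κ → ℝ) (x : ι → ℝ) : Matrix κ ι ℝ :=
  Matrix.of fun k i => fderiv ℝ u x (Pi.single i 1) k

omit [Fintype κ] in
theorem lmap_eq_mulVec_add_s10 (B : Matrix κ ι ℝ) (c : κ → ℝ) :
    lmap B c = fun x => B.mulVec x + c := rfl

omit [Fintype κ] in
theorem lmap_add_smul (A : Matrix κ ι ℝ) (c a : κ → ℝ) (g : ι → ℝ) (e : ℝ) (x : ι → ℝ) :
    lmap A c x + (g ⬝ᵥ x + e) • a = lmap (A + Matrix.vecMulVec a g) (c + e • a) x := by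
  simp only [lmap_eq_mulVec_add_s10, Matrix.add_mulVec, Matrix.vecMulVec_mulVec]
  ext k
  simp
  ring

theorem hasFDerivAt_lmap (B : Matrix κ ι ℝ) (c : κ → ℝ) (x : ι → ℝ) :
    HasFDerivAt (lmap B c) (Matrix.mulVecLin B).toContinuousLinearMap x :=
  ((Matrix.mulVecLin B).toContinuousLinearMap.hasFDerivAt).add_const c

theorem exists_lipschitzWith_lmap_s10 (B : Matrix κ ι ℝ) (c : κ → ℝ) :
    ∃ C, LipschitzWith C (lmap B c) := by
  have := (Matrix.mulVecLin B).toContinuousLinearMap.lipschitz.add (LipschitzWith.const c)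
  exact ⟨_, this⟩

theorem grad_eq_of_eventuallyEq [DecidableEq ι] {u : (ι → ℝ) → κ → ℝ} {B : Matrix κ ι ℝ}
    {c : κ → ℝ} {x : ι → ℝ} (h : u =ᶠ[𝓝 x] lmap B c) : grad u x = B := by
  ext k i
  simp [grad, h.fderiv_eq, (hasFDerivAt_lmap B c x).fderiv]

theorem measurable_grad [DecidableEq ι] (u : (ι → ℝ) → κ → ℝ) :
    Measurable (grad u) :=
  measurable_pi_iff.2 fun k => measurable_pi_iff.2 fun i =>
    (measurable_pi_apply k).comp (measurable_fderiv_apply_const ℝ u (Pi.single i 1))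

omit [Fintype κ] in
theorem exists_vecMulVec_of_rank_eq_one {X : Matrix κ ι ℝ} (h : X.rank = 1) :
    ∃ a n, X = Matrix.vecMulVec a n := by
  rw [Matrix.rank, finrank_eq_one_iff'] at h
  obtain ⟨v, -, hv⟩ := h
  classical
  choose n hn using fun i => hv ⟨X.mulVecLin (Pi.single i 1), LinearMap.mem_range_self _ _⟩
  refine ⟨v, n, ?_⟩
  ext k i
  have := congrFun (congrArg Subtype.val (hn i)) k
  simpa [Matrix.vecMulVec_apply, mul_comm] using this.symm

theorem continuous_frobNorm : Continuous (frobNorm : Matrix κ ι ℝ → ℝ) := by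
  unfold frobNorm
  fun_prop

theorem frobNorm_sq (A : Matrix κ ι ℝ) : frobNorm A ^ 2 = ∑ k, ∑ i, A k i ^ 2 :=
  Real.sq_sqrt (by positivity)

theorem frobNorm_nonneg (A : Matrix κ ι ℝ) : 0 ≤ frobNorm A := Real.sqrt_nonneg _

theorem frobNorm_pos {A : Matrix κ ι ℝ} (hA : A ≠ 0) : 0 < frobNorm A := by
  refine Real.sqrt_pos.2 (lt_of_le_of_ne (by positivity) fun h => hA ?_)
  ext k i
  have h1 := (Finset.sum_eq_zero_iff_of_nonneg fun k _ => by positivity).1 h.symm k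
    (Finset.mem_univ k)
  have h2 := (Finset.sum_eq_zero_iff_of_nonneg fun i _ => by positivity).1 h1 i
    (Finset.mem_univ i)
  simpa using h2

/-- Strict convexity of the Frobenius norm. -/
theorem frobNorm_convexCombination_lt {B B' : Matrix κ ι ℝ} {l M : ℝ} (hl : l ∈ Ioo (0 : ℝ) 1)
    (hne : B ≠ B') (hB : frobNorm B ≤ M) (hB' : frobNorm B' ≤ M) :
    frobNorm (l • B + (1 - l) • B') < M := by
  have hM : 0 ≤ M := (frobNorm_nonneg B).trans hB
  have key : frobNorm (l • B + (1 - l) • B') ^ 2 + l * (1 - l) * frobNorm (B' - B) ^ 2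
      = l * frobNorm B ^ 2 + (1 - l) * frobNorm B' ^ 2 := by
    simp only [frobNorm_sq, Finset.mul_sum, ← Finset.sum_add_distrib]
    refine Finset.sum_congr rfl fun k _ => Finset.sum_congr rfl fun i _ => ?_
    simp
    ring
  have h1 : frobNorm B ^ 2 ≤ M ^ 2 := pow_le_pow_left₀ (frobNorm_nonneg _) hB 2
  have h2 : frobNorm B' ^ 2 ≤ M ^ 2 := pow_le_pow_left₀ (frobNorm_nonneg _) hB' 2
  have h3 : 0 < l * (1 - l) * frobNorm (B' - B) ^ 2 :=
    mul_pos (mul_pos hl.1 (sub_pos.2 hl.2)) (pow_pos (frobNorm_pos (sub_ne_zero.2 hne.symm)) 2)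
  refine lt_of_pow_lt_pow_left₀ 2 hM ?_
  nlinarith [mul_le_mul_of_nonneg_left h1 hl.1.le,
    mul_le_mul_of_nonneg_left h2 (sub_nonneg.2 hl.2.le)]

omit [Fintype ι] [Fintype κ] in
theorem vecMulVec_zero_right (a : κ → ℝ) : Matrix.vecMulVec a (0 : ι → ℝ) = 0 := by
  ext
  simp [Matrix.vecMulVec_apply]

/-- `u` is affine on each tile of some tiling of `Ω`, with gradients bounded by `M`. -/
def HasAffineTiling (M : ℝ) (u : (ι → ℝ) → κ → ℝ) (Ω : Set (ι → ℝ)) : Prop :=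
  ∃ 𝒮, Tiles 𝒮 Ω ∧ ∀ V ∈ 𝒮, ∃ B : Matrix κ ι ℝ, frobNorm B ≤ M ∧ ∃ c, EqOn u (lmap B c) V

theorem grad_eq_of_eqOn [DecidableEq ι] {u : (ι → ℝ) → κ → ℝ} {B : Matrix κ ι ℝ} {c : κ → ℝ}
    {V : Set (ι → ℝ)} (hV : IsOpen V) (h : EqOn u (lmap B c) V) {x : ι → ℝ} (hx : x ∈ V) :
    grad u x = B :=
  grad_eq_of_eventuallyEq (h.eventuallyEq_of_mem (hV.mem_nhds hx))

theorem Tiles.ae_mem {𝒮 : Set (Set (ι → ℝ))} {Ω : Set (ι → ℝ)} (h : Tiles 𝒮 Ω) :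
    ∀ᵐ x, x ∈ Ω → x ∈ ⋃₀ 𝒮 := by
  refine measure_mono_null (fun x hx => ?_) h.2.2.2
  simpa [Classical.not_imp] using hx

/-- Replacing, where the gradient of `u` is `A`, a fraction of `A` by rank-one connected
matrices `B` and `B'`. -/
theorem HasAffineTiling.exists_split [DecidableEq ι] [DecidableEq (Matrix κ ι ℝ)] {M : ℝ}
    {u : (ι → ℝ) → κ → ℝ} {Ω : Set (ι → ℝ)} (hu : HasAffineTiling M u Ω)
    (hLip : ∃ C, LipschitzWith C u) {A B B' : Matrix κ ι ℝ} {l θ ε : ℝ}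
    (hl : l ∈ Ioo (0 : ℝ) 1) (hθ : θ ∈ Ioc (0 : ℝ) 1) (hε : ε ∈ Ioc (0 : ℝ) 1)
    (hrank : (B' - B).rank = 1) (hA : A = l • B + (1 - l) • B')
    (hB : frobNorm B ≤ M) (hB' : frobNorm B' ≤ M) :
    ∃ u', HasAffineTiling M u' Ω ∧ (∃ C, LipschitzWith C u') ∧ (∀ x ∉ Ω, u' x = u x) ∧
      (∀ X ≠ A, volume {x ∈ Ω | grad u x = X} + ENNReal.ofReal ((1 - ε) * (θ *
          ((if X = B then l else 0) + if X = B' then 1 - l else 0))) *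
          volume {x ∈ Ω | grad u x = A} ≤ volume {x ∈ Ω | grad u' x = X}) ∧
      ENNReal.ofReal ((1 - ε) * (1 - θ)) * volume {x ∈ Ω | grad u x = A} ≤
        volume {x ∈ Ω | grad u' x = A} := by
  obtain ⟨a, n, han⟩ := exists_vecMulVec_of_rank_eq_one hrank
  have hn : n ≠ 0 := by
    rintro rfl
    simp [han, vecMulVec_zero_right] at hrank
  have hBA : A + Matrix.vecMulVec a ((-(1 - l)) • n) = B := by
    rw [Matrix.vecMulVec_smul, ← han, hA]
    module
  have hBA' : A + Matrix.vecMulVec a (l • n) = B' := by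
    rw [Matrix.vecMulVec_smul, ← han, hA]
    module
  have hBB' : B ≠ B' := by
    rintro rfl
    simp at hrank
  have hAM : frobNorm A < M := hA ▸ frobNorm_convexCombination_lt hl hBB' hB hB'
  set K : Set (ι → ℝ) := {g | frobNorm (A + Matrix.vecMulVec a g) ≤ M} with hKdef
  have hK : K ∈ 𝓝 0 := by
    have hcont : Continuous fun g : ι → ℝ => frobNorm (A + Matrix.vecMulVec a g) :=
      continuous_frobNorm.comp (by unfold Matrix.vecMulVec; fun_prop)
    refine mem_of_superset ((isOpen_lt hcont continuous_const).mem_nhds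
      (show frobNorm (A + Matrix.vecMulVec a 0) < M by
        simpa [vecMulVec_zero_right] using hAM)) fun g hg => ?_
    exact (mem_ofPred_eq ▸ hg : _ < _).le
  obtain ⟨w, Q, hQ, hw₁, hw₂, hw₀⟩ := exists_block hK hn hl hθ hε
    (show frobNorm _ ≤ M by rwa [hBA]) (show frobNorm _ ≤ M by rwa [hBA'])
  obtain ⟨C, hC⟩ := hLip
  obtain ⟨𝒮, h𝒮, h𝒮u⟩ := hu
  set 𝒮A : Set (Set (ι → ℝ)) := {V ∈ 𝒮 | ∃ c, EqOn u (lmap A c) V} with h𝒮A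
  set U := ⋃₀ 𝒮A with hU
  have hopen : ∀ V ∈ 𝒮, IsOpen V := fun V hV => (h𝒮.2.1 V hV).1.1
  have hUopen : IsOpen U := isOpen_sUnion fun V hV => hopen V hV.1
  have hUΩ : U ⊆ Ω := sUnion_subset fun V hV => (h𝒮.2.1 V hV.1).2
  obtain ⟨h, ⟨C', hC'⟩, hh0, ⟨𝒯, h𝒯, h𝒯h⟩, hfrac⟩ :=
    hQ.exists_fill (𝒮 := 𝒮A) fun V hV => hopen V hV.1
  rw [← hU] at hfrac h𝒯 hh0
  obtain ⟨Ca, hCa⟩ : ∃ Ca, LipschitzWith Ca fun s : ℝ => s • a :=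
    ⟨_, ((ContinuousLinearMap.id ℝ ℝ).smulRight a).lipschitz⟩
  set u' : (ι → ℝ) → κ → ℝ := fun x => u x + h x • a with hu'
  have hdisj : ∀ V ∈ 𝒮 \ 𝒮A, Disjoint V U := fun V hV => disjoint_sUnion_right.2 fun V' hV' =>
    h𝒮.2.2.1 hV.1 hV'.1 (by rintro rfl; exact hV.2 hV')
  have hold : ∀ V ∈ 𝒮 \ 𝒮A, EqOn u' u V := fun V hV x hx => by
    simp [hu', hh0 x ((hdisj V hV).notMem_of_mem_left hx)]
  have hgradU : ∀ x ∈ U, grad u x = A := by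
    rintro x ⟨V, hV, hx⟩
    obtain ⟨c, hc⟩ := hV.2
    exact grad_eq_of_eqOn (hopen V hV.1) hc hx
  have hAU : volume {x ∈ Ω | grad u x = A} ≤ volume U := by
    refine measure_mono_ae ?_
    filter_upwards [h𝒮.ae_mem] with x hx ⟨hxΩ, hxA⟩
    obtain ⟨V, hV, hxV⟩ := hx hxΩ
    obtain ⟨B₀, -, c, hc⟩ := h𝒮u V hV
    rw [grad_eq_of_eqOn (hopen V hV) hc hxV] at hxA
    exact ⟨V, ⟨hV, c, hxA ▸ hc⟩, hxV⟩
  have houtside : ∀ X ≠ A,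
      volume {x ∈ Ω | grad u x = X} ≤ volume ({x ∈ Ω | grad u' x = X} \ U) := by
    intro X hX
    refine measure_mono_ae ?_
    filter_upwards [h𝒮.ae_mem] with x hx ⟨hxΩ, hxX⟩
    have hxU : x ∉ U := fun hxU => hX (hxX ▸ hgradU x hxU)
    obtain ⟨V, hV, hxV⟩ := hx hxΩ
    have hVA : V ∈ 𝒮 \ 𝒮A := ⟨hV, fun hVA => hxU ⟨V, hVA, hxV⟩⟩
    obtain ⟨B₀, -, c, hc⟩ := h𝒮u V hV
    refine ⟨⟨hxΩ, ?_⟩, hxU⟩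
    rw [grad_eq_of_eqOn (hopen V hV) ((hold V hVA).trans hc) hxV,
      ← grad_eq_of_eqOn (hopen V hV) hc hxV, hxX]
  have hinside : ∀ g p X, HasSlopeFraction w Q g p → A + Matrix.vecMulVec a g = X →
      ENNReal.ofReal p * volume {x ∈ Ω | grad u x = A} ≤
        volume ({x ∈ Ω | grad u' x = X} ∩ U) := by
    rintro g p X hg rfl
    obtain ⟨W, hWU, -, hW, hle⟩ := hfrac g p hg
    refine (mul_le_mul_right hAU _).trans (hle.trans (measure_mono fun x hx => ?_))
    refine ⟨⟨hUΩ (hWU hx), ?_⟩, hWU hx⟩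
    obtain ⟨V, hV, hxV⟩ := hWU hx
    obtain ⟨c, hc⟩ := hV.2
    obtain ⟨e, he⟩ := hW x hx
    refine grad_eq_of_eventuallyEq (c := c + e • a) ?_
    filter_upwards [he, (hopen V hV.1).mem_nhds hxV] with y hy hyV
    simp only [hu', ← lmap_add_smul, ← hc hyV, hy]
  have hsplit : ∀ X, volume ({x ∈ Ω | grad u' x = X} \ U) +
      volume ({x ∈ Ω | grad u' x = X} ∩ U) = volume {x ∈ Ω | grad u' x = X} := fun X => by
    rw [add_comm, measure_inter_add_sdiff _ hUopen.measurableSet]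
  refine ⟨u', ⟨𝒮 \ 𝒮A ∪ 𝒯, ⟨(h𝒮.1.mono sdiff_subset).union h𝒯.1, ?_, ?_, ?_⟩, ?_⟩,
    ⟨_, hC.add (hCa.comp hC')⟩, fun x hx => by simp [hu', hh0 x fun hxU => hx (hUΩ hxU)],
    fun X hX => ?_, ?_⟩
  · rintro V (hV | hV)
    · exact h𝒮.2.1 V hV.1
    · exact ⟨(h𝒯.2.1 V hV).1, (h𝒯.2.1 V hV).2.trans hUΩ⟩
  · refine pairwiseDisjoint_union.2 ⟨h𝒮.2.2.1.subset sdiff_subset, h𝒯.2.2.1, ?_⟩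
    exact fun V hV T hT _ => (hdisj V hV).mono_right (h𝒯.2.1 T hT).2
  · refine measure_mono_null (t := (Ω \ ⋃₀ 𝒮) ∪ (U \ ⋃₀ 𝒯)) ?_
      (measure_union_null h𝒮.2.2.2 h𝒯.2.2.2)
    rintro x ⟨hxΩ, hx⟩
    rw [sUnion_union, mem_union, not_or] at hx
    by_cases hxS : x ∈ ⋃₀ 𝒮
    · obtain ⟨V, hV, hxV⟩ := hxS
      by_cases hVA : V ∈ 𝒮A
      · exact Or.inr ⟨⟨V, hVA, hxV⟩, hx.2⟩
      · exact absurd ⟨V, ⟨hV, hVA⟩, hxV⟩ hx.1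
    · exact Or.inl ⟨hxΩ, hxS⟩
  · rintro V (hV | hV)
    · obtain ⟨B₀, hB₀, c, hc⟩ := h𝒮u V hV.1
      exact ⟨B₀, hB₀, c, (hold V hV).trans hc⟩
    · obtain ⟨⟨V', hV', hVV'⟩, g, hg, e, he⟩ := h𝒯h V hV
      obtain ⟨c, hc⟩ := hV'.2
      refine ⟨A + Matrix.vecMulVec a g, hg, c + e • a, fun x hx => ?_⟩
      simp only [hu', ← lmap_add_smul, ← hc (hVV' hx), he x hx]
  · rw [← hsplit]
    refine add_le_add (houtside X hX) ?_
    by_cases h1 : X = B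
    · subst h1
      simpa [hBB'] using hinside _ _ _ hw₁ hBA
    · by_cases h2 : X = B'
      · subst h2
        simpa [h1] using hinside _ _ _ hw₂ hBA'
      · simp [h1, h2]
  · exact (hinside 0 _ A hw₀ (by simp [vecMulVec_zero_right])).trans
      (measure_mono inter_subset_left)

section Splitting

variable {lam l : ℝ} {A B B' : Matrix κ ι ℝ} {ν' : Measure (Matrix κ ι ℝ)}

theorem integrable_entry_dirac (A : Matrix κ ι ℝ) (k : κ) (i : ι) :
    Integrable (fun X : Matrix κ ι ℝ => X k i) (Measure.dirac A) :=
  integrable_dirac (by simp)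

theorem integrable_entry_split (k : κ) (i : ι)
    (h : Integrable (fun X => X k i)
      (ENNReal.ofReal lam • Measure.dirac A + ENNReal.ofReal (1 - lam) • ν')) :
    Integrable (fun X => X k i) (ENNReal.ofReal lam • (ENNReal.ofReal l • Measure.dirac B +
      ENNReal.ofReal (1 - l) • Measure.dirac B') + ENNReal.ofReal (1 - lam) • ν') :=
  ((((integrable_entry_dirac B k i).smul_measure ENNReal.ofReal_ne_top).add_measure
    ((integrable_entry_dirac B' k i).smul_measure ENNReal.ofReal_ne_top)).smul_measure
      ENNReal.ofReal_ne_top).add_measure h.right_of_add_measure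

theorem barycenter_split (hlam : lam ∈ Ioc (0 : ℝ) 1) (hl : l ∈ Ioo (0 : ℝ) 1)
    (hA : A = l • B + (1 - l) • B')
    (h : ∀ k i, Integrable (fun X => X k i)
      (ENNReal.ofReal lam • Measure.dirac A + ENNReal.ofReal (1 - lam) • ν')) :
    barycenter (ENNReal.ofReal lam • (ENNReal.ofReal l • Measure.dirac B +
      ENNReal.ofReal (1 - l) • Measure.dirac B') + ENNReal.ofReal (1 - lam) • ν') =
    barycenter (ENNReal.ofReal lam • Measure.dirac A + ENNReal.ofReal (1 - lam) • ν') := by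
  ext k i
  have h' := integrable_entry_split (B := B) (B' := B') (l := l) k i (h k i)
  have hl' := h'.left_of_add_measure
  rw [integrable_smul_measure (by simpa using hlam.1) ENNReal.ofReal_ne_top] at hl'
  simp only [barycenter, Matrix.of_apply]
  rw [integral_add_measure h'.left_of_add_measure h'.right_of_add_measure,
    integral_add_measure (h k i).left_of_add_measure (h k i).right_of_add_measure,
    integral_smul_measure, integral_smul_measure, integral_smul_measure,
    integral_add_measure hl'.left_of_add_measure hl'.right_of_add_measure,
    integral_smul_measure, integral_smul_measure, integral_dirac, integral_dirac, integral_dirac,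
    ENNReal.toReal_ofReal hl.1.le, ENNReal.toReal_ofReal (sub_nonneg.2 hl.2.le), hA]
  simp

theorem real_ofReal_smul_add_ofReal_smul {α : Type*} [MeasurableSpace α] {μ ν : Measure α}
    [IsFiniteMeasure μ] [IsFiniteMeasure ν] {p q : ℝ} (hp : 0 ≤ p) (hq : 0 ≤ q) (s : Set α) :
    (ENNReal.ofReal p • μ + ENNReal.ofReal q • ν).real s = p * μ.real s + q * ν.real s := by
  have := μ.smul_finite (ENNReal.ofReal_ne_top (r := p))
  have := ν.smul_finite (ENNReal.ofReal_ne_top (r := q))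
  rw [measureReal_add_apply, measureReal_ennreal_smul_apply, measureReal_ennreal_smul_apply,
    ENNReal.toReal_ofReal hp, ENNReal.toReal_ofReal hq]

theorem dirac_real_singleton [DecidableEq (Matrix κ ι ℝ)] (A X : Matrix κ ι ℝ) :
    (Measure.dirac A).real {X} = if X = A then 1 else 0 := by
  rw [Measure.real, Measure.dirac_apply]
  by_cases h : X = A <;> simp [h]

end Splitting

/-- Every laminate of finite order is approximated by gradients of piecewise affine maps. -/
theorem IsLaminate.exists_approx [DecidableEq ι] {ν : Measure (Matrix κ ι ℝ)}
    (hν : IsLaminate ν) :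
    (∀ k i, Integrable (fun X => X k i) ν) ∧
    ∀ M, ν {X | M < frobNorm X} = 0 → ∀ b, ∀ ε ∈ Ioc (0 : ℝ) 1, ∀ Ω, IsRegularDomain Ω →
      ∃ u, HasAffineTiling M u Ω ∧ (∃ C, LipschitzWith C u) ∧
        (∀ x ∉ Ω, u x = lmap (barycenter ν) b x) ∧
        ∀ X, ENNReal.ofReal ((1 - ε) * ν.real {X}) * volume Ω ≤
          volume {x ∈ Ω | grad u x = X} := by
  classical
  induction hν with
  | dirac A =>
    refine ⟨integrable_entry_dirac A, fun M hM b ε hε Ω hΩ => ⟨lmap A b, ?_, ?_, ?_, ?_⟩⟩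
    · refine ⟨{Ω}, ⟨countable_singleton _, by simp [hΩ], pairwiseDisjoint_singleton _ _, by simp⟩,
        ?_⟩
      rintro _ rfl
      refine ⟨A, ?_, b, fun _ _ => rfl⟩
      by_contra! h
      rw [Measure.dirac_apply_of_mem (show A ∈ {X | M < frobNorm X} from h)] at hM
      exact one_ne_zero hM
    · exact exists_lipschitzWith_lmap_s10 A b
    · intro x _
      congr
      ext k i
      simp [barycenter]
    · intro X
      rw [dirac_real_singleton]
      by_cases h : X = A
      · subst h
        have : {x ∈ Ω | grad (lmap X b) x = X} = Ω :=
          sep_eq_self_iff_mem_true.2 fun x _ => grad_eq_of_eventuallyEq EventuallyEq.rfl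
        rw [this]
        refine mul_le_of_le_one_left' (ENNReal.ofReal_le_one.2 ?_)
        simp [hε.1.le]
      · simp [h]
  | split lam l A B B' ν' hlam hl hprob hrank hA _ ih =>
    obtain ⟨hentry, ih⟩ := ih
    refine ⟨fun k i => integrable_entry_split k i (hentry k i), fun M hM b ε hε Ω hΩ => ?_⟩
    obtain ⟨⟨hMB, hMB'⟩, hM'⟩ : (frobNorm B ≤ M ∧ frobNorm B' ≤ M) ∧
        (ENNReal.ofReal (1 - lam) • ν') {X | M < frobNorm X} = 0 := by
      have hl0 := hl.1
      have hl1 := hl.2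
      have hlam0 := hlam.1
      simp only [Measure.add_apply, Measure.smul_apply, smul_eq_mul, add_eq_zero, mul_eq_zero,
        ENNReal.ofReal_eq_zero, not_le.2 hl0, not_le.2 hlam0, sub_nonpos, not_le.2 hl1,
        false_or] at hM ⊢
      refine ⟨⟨?_, ?_⟩, hM.2⟩
      · by_contra! h
        exact one_ne_zero ((Measure.dirac_apply_of_mem
          (show B ∈ {X | M < frobNorm X} from h)).symm.trans hM.1.1)
      · by_contra! h
        exact one_ne_zero ((Measure.dirac_apply_of_mem
          (show B' ∈ {X | M < frobNorm X} from h)).symm.trans hM.1.2)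
    have hBB' : B ≠ B' := by
      rintro rfl
      simp at hrank
    have hMA : frobNorm A < M := hA ▸ frobNorm_convexCombination_lt hl hBB' hMB hMB'
    have hAB : A ≠ B := by
      rintro rfl
      have : (1 - l) • (A - B') = A - (l • A + (1 - l) • B') := by module
      rw [← hA, sub_self] at this
      exact hBB' (sub_eq_zero.1 ((smul_eq_zero.1 this).resolve_left (sub_pos.2 hl.2).ne'))
    have hAB' : A ≠ B' := by
      rintro rfl
      have : l • (A - B) = A - (l • B + (1 - l) • A) := by module
      rw [← hA, sub_self] at this
      exact hBB' (sub_eq_zero.1 ((smul_eq_zero.1 this).resolve_left hl.1.ne')).symm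
    have hε2 : ε / 2 ∈ Ioc (0 : ℝ) 1 := ⟨half_pos hε.1, by linarith [hε.1, hε.2]⟩
    obtain ⟨u, hu, hLip, hub, hvol⟩ := ih M (by
      rw [Measure.add_apply, hM', Measure.smul_apply, Measure.dirac_apply]
      simp [hMA.le]) b (ε / 2) hε2 Ω hΩ
    set N : Matrix κ ι ℝ → ℝ := fun X => ν'.real {X} with hN
    have hN0 : ∀ X, 0 ≤ N X := fun X => measureReal_nonneg
    set w : ℝ := lam + (1 - lam) * N A with hw
    have hlam1 : 0 ≤ 1 - lam := sub_nonneg.2 hlam.2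
    have hlamw : lam ≤ w := le_add_of_nonneg_right (mul_nonneg hlam1 (hN0 A))
    have hw0 : 0 < w := hlam.1.trans_le hlamw
    have hθ : lam / w ∈ Ioc (0 : ℝ) 1 := ⟨div_pos hlam.1 hw0, (div_le_one hw0).2 hlamw⟩
    obtain ⟨u', hu', hLip', hu'b, hne, heq⟩ :=
      hu.exists_split hLip hl hθ hε2 hrank hA hMB hMB'
    refine ⟨u', hu', hLip', fun x hx => ?_, fun X => ?_⟩
    · rw [hu'b x hx, hub x hx, barycenter_split hlam hl hA hentry]
    have hvolA : ENNReal.ofReal ((1 - ε / 2) * w) * volume Ω ≤ volume {x ∈ Ω | grad u x = A} := by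
      have := hvol A
      rwa [real_ofReal_smul_add_ofReal_smul hlam.1.le hlam1, dirac_real_singleton,
        if_pos rfl, mul_one] at this
    have hreal : (ENNReal.ofReal lam • (ENNReal.ofReal l • Measure.dirac B +
        ENNReal.ofReal (1 - l) • Measure.dirac B') + ENNReal.ofReal (1 - lam) • ν').real {X} =
        lam * ((if X = B then l else 0) + if X = B' then 1 - l else 0) + (1 - lam) * N X := by
      have := (Measure.dirac B).smul_finite (ENNReal.ofReal_ne_top (r := l))
      have := (Measure.dirac B').smul_finite (ENNReal.ofReal_ne_top (r := 1 - l))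
      rw [real_ofReal_smul_add_ofReal_smul hlam.1.le hlam1,
        real_ofReal_smul_add_ofReal_smul hl.1.le (sub_nonneg.2 hl.2.le), dirac_real_singleton,
        dirac_real_singleton, mul_ite, mul_ite, mul_one, mul_one, mul_zero, mul_zero]
    have hsq : 1 - ε ≤ (1 - ε / 2) * (1 - ε / 2) := by nlinarith [sq_nonneg ε]
    have hε1 : 0 ≤ 1 - ε / 2 := sub_nonneg.2 hε2.2
    rw [hreal]
    by_cases hX : X = A
    · subst hX
      rw [if_neg hAB, if_neg hAB']
      refine le_trans ?_ ((mul_le_mul_right hvolA _).trans heq)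
      rw [← mul_assoc, ← ENNReal.ofReal_mul (mul_nonneg hε1 (sub_nonneg.2 hθ.2))]
      refine mul_le_mul_left (ENNReal.ofReal_le_ofReal ?_) _
      have : (1 - lam / w) * w = (1 - lam) * N X := by
        rw [sub_mul, div_mul_cancel₀ _ hw0.ne', hw]
        ring
      calc (1 - ε) * (lam * (0 + 0) + (1 - lam) * N X)
          ≤ (1 - ε / 2) * (1 - ε / 2) * ((1 - lam) * N X) := by
            rw [add_zero, mul_zero, zero_add]
            exact mul_le_mul_of_nonneg_right hsq (mul_nonneg hlam1 (hN0 X))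
        _ = _ := by rw [← this]; ring
    · set p : ℝ := (if X = B then l else 0) + if X = B' then 1 - l else 0 with hp
      have hp0 : 0 ≤ p := by
        have := hl.1.le
        have := hl.2.le
        positivity
      have hneX := hne X hX
      rw [← hp] at hneX
      have hvolX := hvol X
      rw [real_ofReal_smul_add_ofReal_smul hlam.1.le hlam1, dirac_real_singleton,
        if_neg hX, mul_zero, zero_add] at hvolX
      refine le_trans ?_ ((add_le_add hvolX (mul_le_mul_right hvolA _)).trans hneX)
      rw [← mul_assoc (ENNReal.ofReal ((1 - ε / 2) * (lam / w * p))), ← add_mul,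
        ← ENNReal.ofReal_mul (mul_nonneg hε1 (mul_nonneg hθ.1.le hp0)),
        ← ENNReal.ofReal_add (mul_nonneg hε1 (mul_nonneg hlam1 (hN0 X)))
          (by have := hθ.1; positivity)]
      refine mul_le_mul_left (ENNReal.ofReal_le_ofReal ?_) _
      have : lam / w * w = lam := div_mul_cancel₀ _ hw0.ne'
      calc (1 - ε) * (lam * p + (1 - lam) * N X)
          = (1 - ε) * ((1 - lam) * N X) + (1 - ε) * (lam * p) := by ring
        _ ≤ (1 - ε / 2) * ((1 - lam) * N X) + (1 - ε / 2) * (1 - ε / 2) * (lam * p) := by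
            refine add_le_add (mul_le_mul_of_nonneg_right (by linarith [hε.1])
              (mul_nonneg hlam1 (hN0 X)))
              (mul_le_mul_of_nonneg_right hsq (mul_nonneg hlam.1.le hp0))
        _ = _ := by linear_combination (-((1 - ε / 2) ^ 2 * p)) * this

theorem hasWeakGradientOn_grad [DecidableEq ι] {C : NNReal} {u : (ι → ℝ) → κ → ℝ}
    (hu : LipschitzWith C u) {Ω : Set (ι → ℝ)} (hΩ : Bornology.IsBounded Ω) :
    HasWeakGradientOn u (grad u) Ω where
  integrable :=
    (hu.continuous.continuousOn.integrableOn_compact hΩ.isCompact_closure).mono_set subset_closure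
  integrable_grad k i := by
    have hmeas : Measurable fun x => grad u x k i :=
      measurable_pi_iff.1 (measurable_pi_iff.1 (measurable_grad u) k) i
    refine Measure.integrableOn_of_bounded (M := C) hΩ.measure_lt_top.ne
      hmeas.aestronglyMeasurable (ae_of_all _ fun x => ?_)
    calc ‖grad u x k i‖ ≤ ‖fderiv ℝ u x (Pi.single i 1)‖ := norm_le_pi_norm _ k
      _ ≤ ‖fderiv ℝ u x‖ * ‖(Pi.single i 1 : ι → ℝ)‖ := (fderiv ℝ u x).le_opNorm _
      _ ≤ C * 1 := by
        gcongr
        · exact norm_fderiv_le_of_lipschitz ℝ hu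
        · simp [Pi.norm_single]
      _ = C := mul_one _
  parts φ hφ hφc hφΩ k i := by
    obtain ⟨D, hD⟩ := ContDiff.lipschitzWith_of_hasCompactSupport hφc (hφ 1) (by simp)
    have huk : LipschitzWith C fun x => u x k := by
      simpa [Function.comp_def] using (LipschitzWith.eval k).comp hu
    have hparts := LipschitzWith.integral_lineDeriv_mul_eq (μ := volume) huk hD hφc
      (Pi.single i 1 : ι → ℝ)
    have hout : ∀ x ∉ Ω, x ∉ tsupport φ := fun x hx hxφ => hx (hφΩ hxφ)
    rw [setIntegral_eq_integral_of_forall_compl_eq_zero fun x hx => by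
        rw [Function.notMem_support.1 fun h => hout x hx (support_fderiv_subset ℝ h)]
        simp,
      setIntegral_eq_integral_of_forall_compl_eq_zero fun x hx => by
        rw [image_eq_zero_of_notMem_tsupport (hout x hx), mul_zero]]
    have hleft : ∫ x, lineDeriv ℝ (fun x => u x k) x (Pi.single i 1) * φ x =
        ∫ x, grad u x k i * φ x := by
      refine integral_congr_ae ?_
      filter_upwards [hu.ae_differentiableAt] with x hx
      have hk := hasFDerivAt_pi'.1 hx.hasFDerivAt k
      rw [hk.differentiableAt.lineDeriv_eq_fderiv, hk.fderiv]
      rfl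
    rw [← hleft, hparts, ← integral_neg]
    refine integral_congr_ae (ae_of_all _ fun x => ?_)
    simp only
    rw [((hφ 1).differentiable (by simp)).differentiableAt.lineDeriv_eq_fderiv, map_neg]
    ring

theorem measure_le_of_disjoint_of_le {α β : Type*} [MeasurableSpace α] {μ : Measure α}
    {Ω F : Set α} {E : β → Set α} {s : Finset β} {t : β → ℝ} {c : ℝ} (hΩ : μ Ω ≠ ⊤)
    (hE : ∀ k ∈ s, MeasurableSet (E k)) (hEΩ : ∀ k ∈ s, E k ⊆ Ω) (hF : F ⊆ Ω)
    (hdisj : (s : Set β).PairwiseDisjoint E) (hFE : ∀ k ∈ s, Disjoint F (E k))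
    (ht : ∀ k ∈ s, 0 ≤ t k) (hle : ∀ k ∈ s, ENNReal.ofReal (t k) * μ Ω ≤ μ (E k))
    (hc : 0 ≤ c) (hsum : 1 ≤ c + ∑ k ∈ s, t k) :
    μ F ≤ ENNReal.ofReal c * μ Ω := by
  have hs0 : 0 ≤ ∑ k ∈ s, t k := Finset.sum_nonneg ht
  have hfin : ENNReal.ofReal (∑ k ∈ s, t k) * μ Ω ≠ ⊤ := ENNReal.mul_ne_top (by simp) hΩ
  refine (ENNReal.add_le_add_iff_right hfin).1 ?_
  calc μ F + ENNReal.ofReal (∑ k ∈ s, t k) * μ Ω ≤ μ F + μ (⋃ k ∈ s, E k) := by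
        rw [ENNReal.ofReal_sum_of_nonneg ht, Finset.sum_mul, measure_biUnion_finset hdisj hE]
        exact add_le_add le_rfl (Finset.sum_le_sum hle)
    _ = μ (F ∪ ⋃ k ∈ s, E k) :=
        (measure_union (disjoint_iUnion₂_right.2 hFE) (s.measurableSet_biUnion hE)).symm
    _ ≤ μ Ω := measure_mono (union_subset hF (iUnion₂_subset hEΩ))
    _ ≤ ENNReal.ofReal (c + ∑ k ∈ s, t k) * μ Ω :=
        le_mul_of_one_le_left' (ENNReal.one_le_ofReal.2 hsum)
    _ = _ := by rw [ENNReal.ofReal_add hc hs0, add_mul]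

theorem HasAffineTiling.isPiecewiseAffineOn {M : ℝ} {u : (ι → ℝ) → κ → ℝ} {Ω : Set (ι → ℝ)}
    (h : HasAffineTiling M u Ω) : IsPiecewiseAffineOn u Ω := by
  obtain ⟨𝒮, ⟨hc, hV, hd, h0⟩, hu⟩ := h
  refine ⟨𝒮, hc, fun V hVS => ⟨(hV V hVS).1, (hV V hVS).2, ?_⟩, hd, h0⟩
  obtain ⟨B, -, c, hBc⟩ := hu V hVS
  exact ⟨B, c, hBc⟩

theorem HasAffineTiling.ae_frobNorm_grad_le [DecidableEq ι] {M : ℝ} {u : (ι → ℝ) → κ → ℝ}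
    {Ω : Set (ι → ℝ)} (h : HasAffineTiling M u Ω) (hΩ : MeasurableSet Ω) :
    ∀ᵐ x ∂volume.restrict Ω, frobNorm (grad u x) ≤ M := by
  obtain ⟨𝒮, h𝒮, hu⟩ := h
  filter_upwards [ae_restrict_mem hΩ, ae_restrict_of_ae h𝒮.ae_mem] with x hx hx'
  obtain ⟨V, hV, hxV⟩ := hx' hx
  obtain ⟨B, hB, c, hBc⟩ := hu V hV
  rwa [grad_eq_of_eqOn (h𝒮.2.1 V hV).1.1 hBc hxV]

/-- Lemma (basic construction for laminates of finite order). -/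
theorem laminate_basic_construction {d m : ℕ} (J : ℕ) (hJ : 0 < J)
    (lam : Fin J → ℝ) (Amat : Fin J → Matrix (Fin d) (Fin m) ℝ)
    (hlam : ∀ j, 0 < lam j) (hsum : ∑ j, lam j = 1) (hinj : Function.Injective Amat)
    (A : Matrix (Fin d) (Fin m) ℝ)
    (hlaminate : IsLaminate (∑ j, ENNReal.ofReal (lam j) • Measure.dirac (Amat j)))
    (hbary : barycenter (∑ j, ENNReal.ofReal (lam j) • Measure.dirac (Amat j)) = A) :
    ∀ b : Fin d → ℝ, ∀ ε : ℝ, 0 < ε → ∀ Ω : Set (Fin m → ℝ), IsRegularDomain Ω →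
    ∃ (u : (Fin m → ℝ) → Fin d → ℝ) (G : (Fin m → ℝ) → Matrix (Fin d) (Fin m) ℝ),
      (∃ C : NNReal, LipschitzOnWith C u Ω) ∧
      IsPiecewiseAffineOn u Ω ∧ HasWeakGradientOn u G Ω ∧ ContinuousOn u (closure Ω) ∧
      (∀ x ∈ frontier Ω, u x = lmap A b x) ∧
      (∀ᵐ x ∂(volume.restrict Ω), ∃ j, frobNorm (G x) ≤ frobNorm (Amat j)) ∧
      (∀ j, ENNReal.ofReal ((1 - ε) * lam j) * volume Ω ≤ volume {x ∈ Ω | G x = Amat j} ∧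
        volume {x ∈ Ω | G x = Amat j} ≤ ENNReal.ofReal ((1 + ε) * lam j) * volume Ω) ∧
      volume {x ∈ Ω | G x ∉ Set.range Amat} ≤ ENNReal.ofReal ε * volume Ω := by
  classical
  intro b ε hε Ω hΩ
  have : Nonempty (Fin J) := ⟨⟨0, hJ⟩⟩
  obtain ⟨j₀, hj₀⟩ := Finite.exists_max fun j => frobNorm (Amat j)
  obtain ⟨j₁, hj₁⟩ := Finite.exists_min lam
  set η : ℝ := min 1 (ε * lam j₁) with hη
  have hη1 : η ≤ 1 := min_le_left _ _
  have hη0 : 0 < η := lt_min one_pos (mul_pos hε (hlam j₁))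
  have hηlam : ∀ j, η ≤ ε * lam j := fun j =>
    (min_le_right _ _).trans (mul_le_mul_of_nonneg_left (hj₁ j) hε.le)
  have hlam1 : ∀ j, lam j ≤ 1 := fun j =>
    hsum ▸ Finset.single_le_sum (fun k _ => (hlam k).le) (Finset.mem_univ j)
  have hηε : η ≤ ε := (hηlam j₁).trans (mul_le_of_le_one_right hε.le (hlam1 j₁))
  have hM : (∑ j, ENNReal.ofReal (lam j) • Measure.dirac (Amat j))
      {X | frobNorm (Amat j₀) < frobNorm X} = 0 := by
    simp [Measure.finsetSum_apply, Measure.dirac_apply, hj₀]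
  have hmass : ∀ j, (∑ j, ENNReal.ofReal (lam j) • Measure.dirac (Amat j)).real {Amat j} =
      lam j := fun j => by
    simp [Measure.real, Measure.finsetSum_apply, Set.indicator_apply,
      hinj.eq_iff, (hlam j).le]
  obtain ⟨u, hu, ⟨C, hC⟩, hub, hvol⟩ := hlaminate.exists_approx.2 _ hM b η ⟨hη0, hη1⟩ Ω hΩ
  have hlow : ∀ j, ENNReal.ofReal ((1 - η) * lam j) * volume Ω ≤
      volume {x ∈ Ω | grad u x = Amat j} := fun j => by
    have := hvol (Amat j)
    rwa [hmass] at this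
  have hfin : volume Ω ≠ ⊤ := hΩ.2.1.measure_lt_top.ne
  have hmeas : ∀ j, MeasurableSet {x ∈ Ω | grad u x = Amat j} := fun j =>
    hΩ.1.measurableSet.inter (measurable_grad u (measurableSet_singleton (Amat j)))
  have hdisj : Pairwise fun j k => Disjoint {x ∈ Ω | grad u x = Amat j}
      {x ∈ Ω | grad u x = Amat k} := fun j k hjk =>
    Set.disjoint_left.2 fun x hx hx' => hjk (hinj (hx.2.symm.trans hx'.2))
  have hpos : ∀ j, 0 ≤ (1 - η) * lam j := fun j => mul_nonneg (by linarith) (hlam j).le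
  refine ⟨u, grad u, ⟨C, hC.lipschitzOnWith⟩, hu.isPiecewiseAffineOn,
    hasWeakGradientOn_grad hC hΩ.2.1,
    hC.continuous.continuousOn, fun x hx => ?_, ?_, fun j => ⟨?_, ?_⟩, ?_⟩
  · rw [hub x fun hxΩ => ?_, hbary]
    rw [hΩ.1.frontier_eq] at hx
    exact hx.2 hxΩ
  · filter_upwards [hu.ae_frobNorm_grad_le hΩ.1.measurableSet] with x hx using ⟨j₀, hx⟩
  · refine (mul_le_mul_left (ENNReal.ofReal_le_ofReal ?_) _).trans (hlow j)
    exact mul_le_mul_of_nonneg_right (by linarith) (hlam j).le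
  · refine measure_le_of_disjoint_of_le (E := fun k => {x ∈ Ω | grad u x = Amat k})
      (s := Finset.univ.erase j) (t := fun k => (1 - η) * lam k) hfin (fun k _ => hmeas k)
      (fun k _ => sep_subset _ _) (sep_subset _ _) (hdisj.set_pairwise _)
      (fun k hk => hdisj (Finset.ne_of_mem_erase hk).symm) (fun k _ => hpos k)
      (fun k _ => hlow k) (mul_nonneg (by linarith) (hlam j).le) ?_
    rw [← Finset.mul_sum, Finset.sum_erase_eq_sub (Finset.mem_univ j), hsum]
    nlinarith [hηlam j, mul_pos hη0 (hlam j)]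
  · refine measure_le_of_disjoint_of_le (E := fun k => {x ∈ Ω | grad u x = Amat k})
      (s := Finset.univ) (t := fun k => (1 - η) * lam k) hfin (fun k _ => hmeas k)
      (fun k _ => sep_subset _ _) (sep_subset _ _) (hdisj.set_pairwise _)
      (fun k _ => Set.disjoint_left.2 fun x hx hx' => hx.2 ⟨k, hx'.2.symm⟩) (fun k _ => hpos k)
      (fun k _ => hlow k) hε.le ?_
    rw [← Finset.mul_sum, hsum]
    linarith

end Paper
end
end

section
/- Let d ≥ 2, let Λ^{(m)} := {X ∈ ℝ^{d×d} : rank X ≤ m}, and let A ∈ Λ^{(m)} ∩ 𝒟 be a diagonal d×d matrix of rank at most m, for some 2 ≤ m ≤ d. Then there exists a laminate of finite order ω on ℝ^{d×d} with barycenter A which can be written as ω = (1−γ)μ + γδ_{2A} with γ = 2^{−m}, where μ is a probability measure with supp μ ⊂ Λ^{(m−1)} ∩ 𝒟 ∩ {X : |X| ≤ 2|A|} and μ({X : |X| ≥ |A|/√m}) ≥ 2^{−m}. -/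
open MeasureTheory Set Filter Topology

noncomputable section

namespace Paper

variable {ι κ : Type*}

variable [Fintype ι] [Fintype κ]

theorem IsLaminate.isProbabilityMeasure {ν : Measure (Matrix κ ι ℝ)} (h : IsLaminate ν) :
    IsProbabilityMeasure ν := by
  induction h with
  | dirac A => infer_instance
  | split lam lam' A B B' ν' hlam hlam' hprob _ _ _ _ =>
    constructor
    simp only [Measure.coe_add, Measure.coe_smul, Pi.add_apply, Pi.smul_apply, measure_univ,
      smul_eq_mul, mul_one]
    rw [← ENNReal.ofReal_add hlam'.1.le (by linarith [hlam'.2]), add_sub_cancel,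
      ENNReal.ofReal_one, mul_one, ← ENNReal.ofReal_add hlam.1.le (by linarith [hlam.2]),
      add_sub_cancel, ENNReal.ofReal_one]

/-- A measure of finite mass is its mass times a probability measure. -/
theorem exists_isProbabilityMeasure_eq_smul {α : Type*} [MeasurableSpace α] [Nonempty α]
    (ν : Measure α) (c : ℝ) (h : ν univ = ENNReal.ofReal c) :
    ∃ ν' : Measure α, IsProbabilityMeasure ν' ∧ ν = ENNReal.ofReal c • ν' := by
  rcases le_or_gt c 0 with hc | hc
  · rw [ENNReal.ofReal_of_nonpos hc] at h ⊢
    refine ⟨Measure.dirac (Classical.arbitrary α), inferInstance, ?_⟩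
    rw [zero_smul, Measure.measure_univ_eq_zero.1 h]
  · have h0 : ENNReal.ofReal c ≠ 0 := by simpa using hc
    refine ⟨(ENNReal.ofReal c)⁻¹ • ν, ⟨?_⟩, ?_⟩
    · simp [h, ENNReal.inv_mul_cancel h0 ENNReal.ofReal_ne_top]
    · rw [smul_smul, ENNReal.mul_inv_cancel h0 ENNReal.ofReal_ne_top, one_smul]

/-- An atom of a laminate may be replaced by the two endpoints of a segment, possibly degenerate,
in a rank-one direction of which it is the midpoint. -/
theorem IsLaminate.split_midpoint {ν : Measure (Matrix κ ι ℝ)} {c : ℝ} (hc : 0 < c)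
    {A B B' : Matrix κ ι ℝ} (hA : A = (1 / 2 : ℝ) • B + (1 / 2 : ℝ) • B')
    (hB : B = B' ∨ (B' - B).rank = 1)
    (h : IsLaminate (ENNReal.ofReal c • Measure.dirac A + ν)) :
    IsLaminate (ENNReal.ofReal (c / 2) • Measure.dirac B
      + ENNReal.ofReal (c / 2) • Measure.dirac B' + ν) := by
  rcases hB with rfl | hB
  · rw [← add_smul, ← ENNReal.ofReal_add (by positivity) (by positivity), add_halves]
    rw [← add_smul, add_halves, one_smul] at hA
    rwa [hA] at h
  have hmass : ENNReal.ofReal c + ν univ = 1 := by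
    simpa using h.isProbabilityMeasure.measure_univ
  have hc1 : c ≤ 1 := by
    rw [← ENNReal.ofReal_le_one, ← hmass]
    exact le_self_add
  have hν : ν univ = ENNReal.ofReal (1 - c) := by
    rw [ENNReal.ofReal_sub _ hc.le, ENNReal.ofReal_one, ← hmass,
      ENNReal.add_sub_cancel_left ENNReal.ofReal_ne_top]
  obtain ⟨ν', hprob, rfl⟩ := exists_isProbabilityMeasure_eq_smul ν _ hν
  have key := IsLaminate.split c (1 / 2) A B B' ν' ⟨hc, hc1⟩ (by norm_num) hprob hB
    (by rw [hA]; norm_num) h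
  convert key using 2
  rw [smul_add, smul_smul, smul_smul, ← ENNReal.ofReal_mul hc.le, ← ENNReal.ofReal_mul hc.le]
  norm_num [div_eq_mul_inv]

theorem IsLaminate.split_midpoint_finset {α : Type*} (s : Finset α) {c : ℝ} (hc : 0 < c)
    {A B B' : α → Matrix κ ι ℝ}
    (hA : ∀ j ∈ s, A j = (1 / 2 : ℝ) • B j + (1 / 2 : ℝ) • B' j)
    (hB : ∀ j ∈ s, B j = B' j ∨ (B' j - B j).rank = 1)
    (ν : Measure (Matrix κ ι ℝ))
    (h : IsLaminate (ν + ∑ j ∈ s, ENNReal.ofReal c • Measure.dirac (A j))) :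
    IsLaminate (ν + ∑ j ∈ s, (ENNReal.ofReal (c / 2) • Measure.dirac (B j)
      + ENNReal.ofReal (c / 2) • Measure.dirac (B' j))) := by
  classical
  induction s using Finset.induction_on generalizing ν with
  | empty => simpa using h
  | insert a s ha ih =>
    rw [Finset.sum_insert ha, add_left_comm] at h
    have h1 := h.split_midpoint hc (hA a (by simp)) (hB a (by simp))
    rw [← add_assoc] at h1
    have h2 := ih (fun j hj => hA j (by simp [hj])) (fun j hj => hB j (by simp [hj])) _ h1
    rw [Finset.sum_insert ha]
    convert h2 using 1
    abel

theorem barycenter_sum_smul_dirac {α : Type*} (s : Finset α) {c : ℝ} (hc : 0 ≤ c)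
    (X : α → Matrix κ ι ℝ) :
    barycenter (∑ j ∈ s, ENNReal.ofReal c • Measure.dirac (X j)) = ∑ j ∈ s, c • X j := by
  ext k i
  rw [barycenter, Matrix.of_apply, integral_finsetSum_measure]
  · simp [Matrix.sum_apply, ENNReal.toReal_ofReal hc]
  · intro j _
    exact (integrable_dirac (by simp)).smul_measure ENNReal.ofReal_ne_top

section DiagonalSplitting

variable [DecidableEq ι]

/-- The diagonal matrix with entries `g i` outside `T`, doubled on `S ∩ T`, and zero on `T \ S`. -/
def splitDiagonal (g : ι → ℝ) (T S : Finset ι) : Matrix ι ι ℝ :=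
  Matrix.diagonal fun i => if i ∈ T then (if i ∈ S then 2 * g i else 0) else g i

/-- Splitting every diagonal entry in `T` into `0` and its double. -/
theorem isLaminate_sum_splitDiagonal (g : ι → ℝ) (T : Finset ι) :
    IsLaminate (∑ S ∈ T.powerset,
      ENNReal.ofReal (((2:ℝ) ^ T.card)⁻¹) • Measure.dirac (splitDiagonal g T S)) := by
  induction T using Finset.induction_on with
  | empty => simpa using IsLaminate.dirac _
  | insert a T ha ih =>
    rw [← zero_add (∑ S ∈ T.powerset, _)] at ih
    have h := IsLaminate.split_midpoint_finset T.powerset (by positivity)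
      (B := splitDiagonal g (insert a T)) (B' := fun S => splitDiagonal g (insert a T) (insert a S))
      ?_ ?_ _ ih
    · rw [Finset.sum_powerset_insert ha, ← Finset.sum_add_distrib, Finset.card_insert_of_notMem ha]
      rw [zero_add] at h
      convert h using 6 <;> rw [pow_succ, mul_inv, div_eq_mul_inv]
    · intro S hS
      have haS : a ∉ S := fun h => ha (Finset.mem_powerset.1 hS h)
      simp only [splitDiagonal, ← Matrix.diagonal_smul, Matrix.diagonal_add]
      congr 1
      ext i
      by_cases hi : i = a
      · subst hi
        simp [ha, haS]
      · simp only [Finset.mem_insert, hi, false_or, Pi.smul_apply, smul_eq_mul]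
        ring
    · intro S hS
      have haS : a ∉ S := fun h => ha (Finset.mem_powerset.1 hS h)
      have hdiff : splitDiagonal g (insert a T) (insert a S) - splitDiagonal g (insert a T) S
          = Matrix.diagonal (Pi.single a (2 * g a)) := by
        rw [splitDiagonal, splitDiagonal, Matrix.diagonal_sub]
        congr 1
        ext i
        by_cases hi : i = a
        · subst hi
          simp [haS]
        · simp [hi]
      by_cases hg : g a = 0
      · left
        rw [hg] at hdiff
        simpa using (sub_eq_zero.1 (by simpa using hdiff)).symm
      · right
        rw [hdiff, Matrix.rank_diagonal, Fintype.card_eq_one_iff]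
        refine ⟨⟨a, by simpa using hg⟩, fun ⟨i, hi⟩ => ?_⟩
        by_contra hne
        exact hi (Pi.single_eq_of_ne (by simpa using hne) _)

omit [Fintype ι] in
theorem sum_splitDiagonal (g : ι → ℝ) (T : Finset ι) :
    ∑ S ∈ T.powerset, ((2:ℝ) ^ T.card)⁻¹ • splitDiagonal g T S = Matrix.diagonal g := by
  induction T using Finset.induction_on with
  | empty => simp [splitDiagonal]
  | insert a T ha ih =>
    rw [← ih, Finset.sum_powerset_insert ha, ← Finset.sum_add_distrib,
      Finset.card_insert_of_notMem ha]
    refine Finset.sum_congr rfl fun S hS => ?_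
    have haS : a ∉ S := fun h => ha (Finset.mem_powerset.1 hS h)
    simp only [splitDiagonal, ← Matrix.diagonal_smul, Matrix.diagonal_add]
    congr 1
    ext i
    by_cases hi : i = a
    · subst hi
      simp only [ha, haS, Finset.mem_insert, true_or, if_true, if_false, Pi.smul_apply, smul_eq_mul,
        pow_succ, mul_inv]
      ring
    · simp only [Finset.mem_insert, hi, false_or, Pi.smul_apply, smul_eq_mul, pow_succ, mul_inv]
      ring

theorem frobNorm_diagonal (g : ι → ℝ) :
    frobNorm (Matrix.diagonal g) = Real.sqrt (∑ i, g i ^ 2) := by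
  simp [frobNorm, Matrix.diagonal_apply, ite_pow]

theorem frobNorm_splitDiagonal_le (g : ι → ℝ) (T S : Finset ι) :
    frobNorm (splitDiagonal g T S) ≤ 2 * frobNorm (Matrix.diagonal g) := by
  rw [splitDiagonal, frobNorm_diagonal, frobNorm_diagonal]
  refine Real.sqrt_le_iff.2 ⟨by positivity, ?_⟩
  rw [mul_pow, Real.sq_sqrt (by positivity), Finset.mul_sum]
  refine Finset.sum_le_sum fun i _ => ?_
  have := sq_nonneg (g i)
  split_ifs <;> nlinarith

theorem rank_splitDiagonal_le (g : ι → ℝ) {T S : Finset ι} (hT : ∀ i ∉ T, g i = 0) :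
    (splitDiagonal g T S).rank ≤ S.card := by
  rw [splitDiagonal, Matrix.rank_diagonal, Fintype.card_subtype]
  refine Finset.card_le_card fun i hi => ?_
  by_contra hiS
  by_cases hiT : i ∈ T <;> simp [hiS, hiT, hT] at hi

theorem exists_le_frobNorm_splitDiagonal_singleton (g : ι → ℝ) {T : Finset ι}
    (hT : ∀ i ∉ T, g i = 0) (hne : T.Nonempty) :
    ∃ i ∈ T, frobNorm (Matrix.diagonal g) / Real.sqrt T.card
      ≤ frobNorm (splitDiagonal g T {i}) := by
  obtain ⟨i, hi, hmax⟩ := T.exists_max_image (fun i => g i ^ 2) hne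
  refine ⟨i, hi, ?_⟩
  have hcard : (0:ℝ) < T.card := by exact_mod_cast hne.card_pos
  rw [splitDiagonal, frobNorm_diagonal, frobNorm_diagonal, ← Real.sqrt_div' _ hcard.le]
  refine Real.sqrt_le_sqrt ?_
  rw [div_le_iff₀ hcard]
  have h1 : ∑ j, g j ^ 2 ≤ T.card * g i ^ 2 := by
    rw [← Finset.sum_subset (Finset.subset_univ T) (fun j _ hj => by simp [hT j hj]),
      ← nsmul_eq_mul]
    exact Finset.sum_le_card_nsmul _ _ _ hmax
  have h2 := Finset.single_le_sum
    (f := fun j => (if j ∈ T then (if j ∈ ({i} : Finset ι) then 2 * g j else 0) else g j) ^ 2)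
    (fun j _ => sq_nonneg _) (Finset.mem_univ i)
  simp only [hi, Finset.mem_singleton_self, if_true] at h2
  calc ∑ j, g j ^ 2 ≤ T.card * g i ^ 2 := h1
    _ ≤ T.card * (2 * g i) ^ 2 := mul_le_mul_of_nonneg_left (by nlinarith [sq_nonneg (g i)]) hcard.le
    _ ≤ _ := by rw [mul_comm]; gcongr

end DiagonalSplitting

/-- Lemma (laminates supported in rank `≤ m − 1` diagonal matrices). -/
theorem laminate_supported_in_lower_rank (d r : ℕ) (hd : 2 ≤ d) (hr2 : 2 ≤ r) (hrd : r ≤ d)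
    (A : Matrix (Fin d) (Fin d) ℝ) (hdiag : ∃ g, A = Matrix.diagonal g) (hrank : A.rank ≤ r)
    (γ : ℝ) (hγ : γ = ((2:ℝ) ^ r)⁻¹) :
    ∃ μ : Measure (Matrix (Fin d) (Fin d) ℝ), IsProbabilityMeasure μ ∧
      IsLaminate (ENNReal.ofReal (1 - γ) • μ
        + ENNReal.ofReal γ • Measure.dirac ((2:ℝ) • A)) ∧
      barycenter (ENNReal.ofReal (1 - γ) • μ
        + ENNReal.ofReal γ • Measure.dirac ((2:ℝ) • A)) = A ∧
      μ {X | ¬ (X.rank ≤ r - 1 ∧ (∃ g, X = Matrix.diagonal g) ∧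
        frobNorm X ≤ 2 * frobNorm A)} = 0 ∧
      ENNReal.ofReal (((2:ℝ) ^ r)⁻¹) ≤ μ {X | frobNorm A / Real.sqrt r ≤ frobNorm X} := by
  classical
  obtain ⟨g, rfl⟩ := hdiag
  obtain ⟨T, hsub, -, hcard⟩ := Finset.exists_subsuperset_card_eq
    (s := Finset.univ.filter fun i => g i ≠ 0) (t := Finset.univ) (n := r) (Finset.subset_univ _)
    (by rwa [Matrix.rank_diagonal, Fintype.card_subtype] at hrank) (by simpa using hrd)
  have hT : ∀ i ∉ T, g i = 0 := fun i hi => by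
    by_contra h
    exact hi (hsub (by simpa using h))
  have hγ0 : 0 < γ := by rw [hγ]; positivity
  have hγ1 : γ < 1 := by
    rw [hγ]
    exact inv_lt_one_of_one_lt₀ (one_lt_pow₀ (by norm_num) (by omega))
  have hlast : splitDiagonal g T T = (2:ℝ) • Matrix.diagonal g := by
    rw [splitDiagonal, ← Matrix.diagonal_smul]
    congr 1
    ext i
    by_cases hi : i ∈ T <;> simp [hi, hT]
  set ν : Measure (Matrix (Fin d) (Fin d) ℝ) :=
    ∑ S ∈ T.ssubsets, ENNReal.ofReal γ • Measure.dirac (splitDiagonal g T S) with hνdef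
  have hω : ∑ S ∈ T.powerset, ENNReal.ofReal γ • Measure.dirac (splitDiagonal g T S)
      = ν + ENNReal.ofReal γ • Measure.dirac ((2:ℝ) • Matrix.diagonal g) := by
    rw [← hlast, hνdef, Finset.ssubsets, Finset.sum_erase_add _ _ (Finset.mem_powerset_self T)]
  have hlam := isLaminate_sum_splitDiagonal g T
  have hbary := barycenter_sum_smul_dirac T.powerset hγ0.le (splitDiagonal g T)
  have hsum := sum_splitDiagonal g T
  rw [hcard, ← hγ] at hlam hsum
  rw [hsum, hω] at hbary
  rw [hω] at hlam
  have hmass : ν univ + ENNReal.ofReal γ = 1 := by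
    simpa using hlam.isProbabilityMeasure.measure_univ
  have hν : ν univ = ENNReal.ofReal (1 - γ) := by
    rw [ENNReal.ofReal_sub _ hγ0.le, ENNReal.ofReal_one, ← hmass,
      ENNReal.add_sub_cancel_right ENNReal.ofReal_ne_top]
  obtain ⟨μ, hprob, hνμ⟩ := exists_isProbabilityMeasure_eq_smul ν _ hν
  rw [hνμ] at hlam hbary
  have h0 : ENNReal.ofReal (1 - γ) ≠ 0 := by simpa using hγ1
  refine ⟨μ, hprob, hlam, hbary, ?_, ?_⟩
  · have hzero : ν {X | ¬ (X.rank ≤ r - 1 ∧ (∃ g, X = Matrix.diagonal g) ∧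
        frobNorm X ≤ 2 * frobNorm (Matrix.diagonal g))} = 0 := by
      rw [hνdef, Measure.finsetSum_apply, Finset.sum_eq_zero]
      intro S hS
      have hlt := Finset.card_lt_card (Finset.mem_ssubsets.1 hS)
      have hmem : (splitDiagonal g T S).rank ≤ r - 1 ∧
          (∃ g', splitDiagonal g T S = Matrix.diagonal g') ∧
          frobNorm (splitDiagonal g T S) ≤ 2 * frobNorm (Matrix.diagonal g) :=
        ⟨(rank_splitDiagonal_le g hT).trans (by omega), ⟨_, rfl⟩,
          frobNorm_splitDiagonal_le g T S⟩
      rw [Measure.smul_apply, Measure.dirac_apply, indicator_of_notMem (by simpa using hmem),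
        smul_zero]
    rw [hνμ, Measure.smul_apply, smul_eq_mul, mul_eq_zero] at hzero
    exact hzero.resolve_left h0
  · rw [← hγ]
    obtain ⟨i, hi, hle⟩ := exists_le_frobNorm_splitDiagonal_singleton g hT
      (Finset.card_pos.1 (by omega))
    rw [hcard] at hle
    have hiT : ({i} : Finset (Fin d)) ∈ T.ssubsets := by
      rw [Finset.mem_ssubsets]
      refine (Finset.singleton_subset_iff.2 hi).ssubset_of_ne fun h => ?_
      rw [← h, Finset.card_singleton] at hcard
      omega
    have hνge : ENNReal.ofReal γ ≤
        ν {X | frobNorm (Matrix.diagonal g) / Real.sqrt r ≤ frobNorm X} := by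
      rw [hνdef, Measure.finsetSum_apply]
      refine le_trans ?_ (Finset.single_le_sum (fun _ _ => zero_le) hiT)
      rw [Measure.smul_apply, Measure.dirac_apply_of_mem (by exact hle), smul_eq_mul, mul_one]
    refine hνge.trans ?_
    rw [hνμ, Measure.smul_apply, smul_eq_mul]
    refine mul_le_of_le_one_left (zero_le) ?_
    rw [ENNReal.ofReal_le_one]
    linarith

end Paper
end
end

section
/- Let 𝒦 > 1 and x ≥ 1, and set A(x) := diag(−x, x) ∈ ℝ^{2×2}. Then there exists a laminate of finite order ω on ℝ^{2×2} with barycenter A(x) which can be written as ω = (1−γ)μ + γδ_{A(x+1)}, where γ = (x/(x+1))·(1 − (1−𝒦^{−1})/(1+(1+𝒦^{−1})x)), and μ is a probability measure with supp μ ⊂ 𝒟 ∩ (E_𝒦 ∪ E_{1/𝒦}) and supp μ ⊂ {X : |A(x)|/√2 ≤ |X| ≤ 2|A(x)|}. -/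
open MeasureTheory Set Filter Topology

noncomputable section

namespace Paper

variable {ι κ : Type*}

variable [Fintype ι] [Fintype κ]

/-- The special orthogonal group `SO(2)` as a set of `2×2` matrices. -/
def SO2 : Set (Matrix (Fin 2) (Fin 2) ℝ) := {R | R.transpose * R = 1 ∧ R.det = 1}

/-- The set `E_ρ = {diag(λ, ρλ) R : λ ≥ 0, R ∈ SO(2)}`. -/
def Eset (ρ : ℝ) : Set (Matrix (Fin 2) (Fin 2) ℝ) :=
  {X | ∃ lam : ℝ, 0 ≤ lam ∧ ∃ R ∈ SO2, X = Matrix.diagonal ![lam, ρ * lam] * R}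

instance [Countable ι] [Countable κ] : MeasurableSingletonClass (Matrix κ ι ℝ) :=
  inferInstanceAs (MeasurableSingletonClass (κ → ι → ℝ))

theorem frobNorm_diagonal_s13 (u v : ℝ) :
    frobNorm (Matrix.diagonal ![u, v]) = Real.sqrt (u ^ 2 + v ^ 2) := by
  simp [frobNorm, Fin.sum_univ_two]

theorem frobNorm_diagonal_bounds {x u v : ℝ} (hx : 0 ≤ x) (hlow : x ^ 2 ≤ u ^ 2 + v ^ 2)
    (hup : u ^ 2 + v ^ 2 ≤ 8 * x ^ 2) :
    frobNorm (Matrix.diagonal ![-x, x]) / Real.sqrt 2 ≤ frobNorm (Matrix.diagonal ![u, v]) ∧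
      frobNorm (Matrix.diagonal ![u, v]) ≤ 2 * frobNorm (Matrix.diagonal ![-x, x]) := by
  have hnorm : frobNorm (Matrix.diagonal ![-x, x]) = Real.sqrt 2 * x := by
    rw [frobNorm_diagonal_s13, show (-x) ^ 2 + x ^ 2 = 2 * x ^ 2 by ring,
      Real.sqrt_mul zero_le_two, Real.sqrt_sq hx]
  rw [hnorm, frobNorm_diagonal_s13, mul_div_cancel_left₀ _ (by positivity)]
  refine ⟨Real.le_sqrt_of_sq_le hlow, Real.sqrt_le_iff.2 ⟨by positivity, hup.trans_eq ?_⟩⟩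
  rw [mul_pow, mul_pow, Real.sq_sqrt zero_le_two]
  ring

/-- Diagonal matrices on the line `v = ρ u` belong to `E_ρ`, whatever the sign of `u`. -/
theorem diagonal_mem_Eset (ρ u : ℝ) : Matrix.diagonal ![u, ρ * u] ∈ Eset ρ := by
  rcases le_total 0 u with hu | hu
  · exact ⟨u, hu, 1, by simp [SO2], by simp⟩
  · refine ⟨-u, by linarith, -1, by simp [SO2, Matrix.det_neg], ?_⟩
    ext i j
    fin_cases i <;> fin_cases j <;> simp

theorem rank_diagonal_eq_one {u v : ℝ} (h : (u ≠ 0 ∧ v = 0) ∨ (u = 0 ∧ v ≠ 0)) :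
    (Matrix.diagonal ![u, v]).rank = 1 := by
  rw [Matrix.rank_diagonal, Fintype.card_subtype, Finset.card_filter, Fin.sum_univ_two]
  rcases h with ⟨hu, hv⟩ | ⟨hu, hv⟩ <;> simp [hu, hv]

theorem diagonal_sub_diagonal_two (u v u' v' : ℝ) :
    Matrix.diagonal ![u, v] - Matrix.diagonal ![u', v']
      = Matrix.diagonal ![u - u', v - v'] := by
  rw [Matrix.diagonal_sub]
  congr 1
  ext i
  fin_cases i <;> rfl

theorem diagonal_combination (s t u v u' v' : ℝ) :
    s • Matrix.diagonal ![u, v] + t • Matrix.diagonal ![u', v']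
      = Matrix.diagonal ![s * u + t * u', s * v + t * v'] := by
  ext i j
  fin_cases i <;> fin_cases j <;> simp

/-- Splitting a Dirac mass once, and then splitting the first of the two resulting atoms. -/
theorem IsLaminate.split_split {a b : ℝ} {A B P C Q : Matrix κ ι ℝ}
    (ha : a ∈ Set.Ioo (0:ℝ) 1) (hb : b ∈ Set.Ioo (0:ℝ) 1)
    (hBP : (P - B).rank = 1) (hA : A = a • B + (1 - a) • P)
    (hCQ : (Q - C).rank = 1) (hB : B = b • C + (1 - b) • Q) :
    IsLaminate (ENNReal.ofReal a •
        (ENNReal.ofReal b • Measure.dirac C + ENNReal.ofReal (1 - b) • Measure.dirac Q)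
      + ENNReal.ofReal (1 - a) • Measure.dirac P) := by
  refine .split a b B C Q _ ⟨ha.1, ha.2.le⟩ hb inferInstance hCQ hB ?_
  have h := IsLaminate.split 1 a A B P (Measure.dirac A) (by simp) ha inferInstance hBP hA
    (by simpa using IsLaminate.dirac A)
  simpa using h

/-- Barycenter of a combination of three Dirac masses. -/
theorem barycenter_three {p q r : ℝ} (hp : 0 ≤ p) (hq : 0 ≤ q) (hr : 0 ≤ r)
    (P Q C : Matrix κ ι ℝ) :
    barycenter (ENNReal.ofReal p • Measure.dirac P + ENNReal.ofReal q • Measure.dirac Q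
      + ENNReal.ofReal r • Measure.dirac C) = p • P + q • Q + r • C := by
  have hint (t : ℝ) (M : Matrix κ ι ℝ) (k : κ) (i : ι) :
      Integrable (fun X : Matrix κ ι ℝ => X k i) (ENNReal.ofReal t • Measure.dirac M) :=
    (integrable_dirac (by simp)).smul_measure ENNReal.ofReal_ne_top
  ext k i
  simp only [barycenter, Matrix.of_apply]
  rw [integral_add_measure ((hint _ _ _ _).add_measure (hint _ _ _ _)) (hint _ _ _ _),
    integral_add_measure (hint _ _ _ _) (hint _ _ _ _)]
  simp [integral_smul_measure, hp, hq, hr]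

/-- Lemma (staircase step for isotropic elliptic equations, Astala–Faraco–Székelyhidi). -/
theorem laminate_step_elliptic (𝒦 x : ℝ) (h𝒦 : 1 < 𝒦) (hx : 1 ≤ x)
    (γ : ℝ) (hγ : γ = (x / (x + 1)) * (1 - (1 - 𝒦⁻¹) / (1 + (1 + 𝒦⁻¹) * x))) :
    ∃ μ : Measure (Matrix (Fin 2) (Fin 2) ℝ), IsProbabilityMeasure μ ∧
      IsLaminate (ENNReal.ofReal (1 - γ) • μ
        + ENNReal.ofReal γ • Measure.dirac (Matrix.diagonal ![-(x + 1), x + 1])) ∧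
      barycenter (ENNReal.ofReal (1 - γ) • μ
        + ENNReal.ofReal γ • Measure.dirac (Matrix.diagonal ![-(x + 1), x + 1]))
        = Matrix.diagonal ![-x, x] ∧
      μ {X | ¬ ((∃ g, X = Matrix.diagonal g) ∧ X ∈ Eset 𝒦 ∪ Eset 𝒦⁻¹)} = 0 ∧
      μ {X | ¬ (frobNorm (Matrix.diagonal ![-x, x]) / Real.sqrt 2 ≤ frobNorm X ∧
        frobNorm X ≤ 2 * frobNorm (Matrix.diagonal ![-x, x]))} = 0 := by
  obtain ⟨k, hk⟩ : ∃ k, k = 𝒦⁻¹ := ⟨_, rfl⟩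
  have hk0 : 0 < k := hk ▸ inv_pos.2 (by linarith)
  have hk1 : k < 1 := hk ▸ inv_lt_one_of_one_lt₀ h𝒦
  have hKk : 𝒦 * k = 1 := hk ▸ mul_inv_cancel₀ (by linarith)
  rw [← hk] at hγ ⊢
  have hx0 : 0 < x := by linarith
  have hD : 0 < 1 + (1 + k) * x := by positivity
  have hE : 0 < (x + 1) * (1 + k) := by positivity
  set a := (1 + k) * x / (1 + (1 + k) * x) with ha
  set b := (x + (x + 1) * k) / ((x + 1) * (1 + k)) with hb
  have ha0 : 0 < a := by positivity
  have ha1 : a < 1 := by rw [ha, div_lt_one hD]; linarith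
  have hb0 : 0 < b := by positivity
  have hb1 : b < 1 := by rw [hb, div_lt_one hE]; nlinarith
  have hab : γ = a * b := by rw [hγ, ha, hb]; field_simp; ring
  have hγ0 : 0 < γ := hab ▸ mul_pos ha0 hb0
  have hγ1 : 0 < 1 - γ := by rw [hab]; nlinarith
  have hA₁ : a * -(x + 1) + (1 - a) * (k * x) = -x := by rw [ha]; field_simp; ring
  have hB₂ : b * (x + 1) + (1 - b) * (k * -(x + 1)) = x := by rw [hb]; field_simp; ring
  set P : Matrix (Fin 2) (Fin 2) ℝ := Matrix.diagonal ![k * x, x] with hP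
  set Q : Matrix (Fin 2) (Fin 2) ℝ := Matrix.diagonal ![-(x + 1), k * -(x + 1)] with hQ
  set C : Matrix (Fin 2) (Fin 2) ℝ := Matrix.diagonal ![-(x + 1), x + 1] with hC
  have hp : 0 ≤ (1 - a) / (1 - γ) := div_nonneg (by linarith) hγ1.le
  have hq : 0 ≤ a * (1 - b) / (1 - γ) := div_nonneg (by nlinarith) hγ1.le
  set μ : Measure (Matrix (Fin 2) (Fin 2) ℝ) :=
    ENNReal.ofReal ((1 - a) / (1 - γ)) • Measure.dirac P
      + ENNReal.ofReal (a * (1 - b) / (1 - γ)) • Measure.dirac Q with hμ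
  have hω : ENNReal.ofReal (1 - γ) • μ = ENNReal.ofReal (1 - a) • Measure.dirac P
      + ENNReal.ofReal (a * (1 - b)) • Measure.dirac Q := by
    rw [hμ, smul_add, smul_smul, smul_smul, ← ENNReal.ofReal_mul hγ1.le,
      ← ENNReal.ofReal_mul hγ1.le, mul_div_cancel₀ _ hγ1.ne', mul_div_cancel₀ _ hγ1.ne']
  have hnull (S : Set (Matrix (Fin 2) (Fin 2) ℝ)) (hPS : P ∉ S) (hQS : Q ∉ S) : μ S = 0 := by
    simp [hμ, hPS, hQS]
  have hk2 : k ^ 2 ≤ 1 := by nlinarith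
  refine ⟨μ, ⟨?_⟩, ?_, ?_, hnull _ (fun h => h ?_) (fun h => h ?_),
    hnull _ (fun h => h ?_) (fun h => h ?_)⟩
  · have hsum : (1 - a) / (1 - γ) + a * (1 - b) / (1 - γ) = 1 := by
      rw [← add_div, div_eq_one_iff_eq hγ1.ne', hab]; ring
    simp [hμ, ← ENNReal.ofReal_add hp hq, hsum]
  · have h := IsLaminate.split_split (A := Matrix.diagonal ![-x, x])
      (B := Matrix.diagonal ![-(x + 1), x]) (P := P) (C := C) (Q := Q)
      ⟨ha0, ha1⟩ ⟨hb0, hb1⟩ ?_ ?_ ?_ ?_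
    · rw [hω, hab, ENNReal.ofReal_mul ha0.le, ENNReal.ofReal_mul ha0.le]
      convert h using 1
      rw [smul_add, smul_smul, smul_smul]
      abel
    · rw [hP, diagonal_sub_diagonal_two]
      exact rank_diagonal_eq_one (.inl ⟨by nlinarith [mul_pos hk0 hx0], sub_self _⟩)
    · rw [hP, diagonal_combination, hA₁]
      congr 3
      ring
    · rw [hQ, hC, diagonal_sub_diagonal_two]
      exact rank_diagonal_eq_one (.inr ⟨sub_self _, by nlinarith [mul_pos hk0 hx0]⟩)
    · rw [hQ, hC, diagonal_combination, hB₂]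
      congr 2
      ring
  · rw [hω, barycenter_three (by linarith) (by nlinarith) hγ0.le, hP, hQ, hC,
      diagonal_combination, ← one_smul ℝ (Matrix.diagonal ![_, _]), diagonal_combination, hab]
    congr 2
    · linear_combination hA₁
    · congr 1
      linear_combination a * hB₂
  · refine ⟨⟨_, hP⟩, .inl ?_⟩
    have := diagonal_mem_Eset 𝒦 (k * x)
    rwa [← mul_assoc, hKk, one_mul] at this
  · exact ⟨⟨_, hQ⟩, .inr (diagonal_mem_Eset k _)⟩
  · refine frobNorm_diagonal_bounds hx0.le (by nlinarith [sq_nonneg (k * x)]) ?_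
    rw [mul_pow]
    nlinarith [mul_le_mul_of_nonneg_right hk2 (sq_nonneg x)]
  · have hx1 : (x + 1) ^ 2 ≤ 4 * x ^ 2 := by nlinarith
    have hlow : x ^ 2 ≤ (x + 1) ^ 2 := by nlinarith
    refine frobNorm_diagonal_bounds hx0.le ?_ ?_ <;> rw [mul_pow, neg_sq]
    · nlinarith [mul_nonneg (sq_nonneg k) (sq_nonneg (x + 1))]
    · linarith [mul_le_mul_of_nonneg_right hk2 (sq_nonneg (x + 1))]

end Paper
end
end
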